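/- arXiv:1810.12102 — 5 statements merged into one kernel-verified Lean document; each statement's English description precedes it below -/
import Mathlib

section
/- Let p be an odd prime and let A be an integer with ((A²+4)/p) = −1 (Legendre symbol). If p ≡ 1 (mod 4) then T_p(1, −A, −1) ≡ (−A²−4)^{(p−1)/4} (mod p), and if p ≡ 3 (mod 4) then T_p(1, −A, −1) ≡ (−A²−4)^{(p+1)/4} · u_{(p+1)/2}(A)/2 (mod p) (i.e., 2·T_p(1,−A,−1) ≡ (−A²−4)^{(p+1)/4} · u_{(p+1)/2}(A) (mod p)). -/
/-- The Lucas sequence `u_n(A)` given by `u_0 = 0`, `u_1 = 1` and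
`u_{n+1} = A·u_n + u_{n-1}`. -/
def lucasU (A : ℤ) : ℕ → ℤ
  | 0 => 0
  | 1 => 1
  | n + 2 => A * lucasU A (n + 1) + lucasU A n

section ProductsOverRanges

variable {M : Type*} [CommMonoid M]

/-- A product over a square splits into its diagonal and the pairs off the diagonal. -/
theorem prod_range_prod_range_eq_diag_mul (f : ℕ → ℕ → M) (n : ℕ) :
    ∏ a ∈ Finset.range n, ∏ b ∈ Finset.range n, f a b =
      ∏ b ∈ Finset.range n, (f b b * ∏ a ∈ Finset.range b, f a b * f b a) := by
  induction n with
  | zero => simp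
  | succ n ih =>
    rw [Finset.prod_range_succ, Finset.prod_range_succ _ n]
    simp only [Finset.prod_range_succ _ n]
    rw [Finset.prod_mul_distrib, ih, Finset.prod_mul_distrib]
    simp only [Finset.prod_mul_distrib, mul_assoc, mul_comm, mul_left_comm]

theorem prod_range_prod_range_sub (h : ℕ → M) (n : ℕ) :
    ∏ b ∈ Finset.range n, ∏ a ∈ Finset.range b, h (b - a) =
      ∏ d ∈ Finset.range n, h (d + 1) ^ (n - 1 - d) := by
  induction n with
  | zero => simp
  | succ n ih =>
    rw [Finset.prod_range_succ, ih, Finset.prod_range_succ _ n,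
      ← Finset.prod_range_reflect (fun a => h (n - a)), ← Finset.prod_mul_distrib]
    simp only [Nat.add_sub_cancel, Nat.sub_self, pow_zero, mul_one]
    refine Finset.prod_congr rfl fun d hd => ?_
    have hd := Finset.mem_range.1 hd
    rw [show n - (n - 1 - d) = d + 1 by omega, ← pow_succ, show n - 1 - d + 1 = n - d by omega]

theorem prod_range_pow_of_symm_odd (h : ℕ → M) (m : ℕ)
    (hs : ∀ d ≤ 2 * m + 1, h (2 * m + 1 - d) = h d) :
    ∏ d ∈ Finset.range (2 * m + 1), h (d + 1) ^ (2 * m - d) =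
      (∏ d ∈ Finset.range m, h (d + 1)) ^ (2 * m + 1) := by
  rw [Finset.prod_range_succ, Nat.sub_self, pow_zero, mul_one, two_mul, Finset.prod_range_add,
    ← Finset.prod_range_reflect (fun x => h (m + x + 1) ^ (m + m - (m + x))),
    ← Finset.prod_mul_distrib, ← Finset.prod_pow]
  refine Finset.prod_congr rfl fun d hd => ?_
  have hd := Finset.mem_range.1 hd
  rw [← hs (d + 1) (by omega),
    show m + (m - 1 - d) + 1 = 2 * m + 1 - (d + 1) by omega, ← pow_add]
  congr 1
  omega

theorem prod_range_pow_of_symm_even (h : ℕ → M) (k : ℕ)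
    (hs : ∀ d ≤ 2 * k + 2, h (2 * k + 2 - d) = h d) :
    ∏ d ∈ Finset.range (2 * k + 2), h (d + 1) ^ (2 * k + 1 - d) =
      (∏ d ∈ Finset.range k, h (d + 1)) ^ (2 * k + 2) * h (k + 1) ^ (k + 1) := by
  rw [Finset.prod_range_succ, Nat.sub_self, pow_zero, mul_one,
    show 2 * k + 1 = (k + 1) + k by omega, Finset.prod_range_add, Finset.prod_range_succ,
    ← Finset.prod_range_reflect (fun x => h (k + 1 + x + 1) ^ (k + 1 + k - (k + 1 + x))),
    mul_right_comm, ← Finset.prod_mul_distrib, ← Finset.prod_pow,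
    show k + 1 + k - k = k + 1 by omega]
  congr 1
  refine Finset.prod_congr rfl fun d hd => ?_
  have hd := Finset.mem_range.1 hd
  rw [← hs (d + 1) (by omega),
    show k + 1 + (k - 1 - d) + 1 = 2 * k + 2 - (d + 1) by omega, ← pow_add]
  congr 1
  omega

theorem prod_range_eq_pairs_odd (f : ℕ → M) (m : ℕ) :
    ∏ d ∈ Finset.range (2 * m + 1), f d =
      f 0 * ∏ d ∈ Finset.range m, f (d + 1) * f (2 * m + 1 - (d + 1)) := by
  rw [Finset.prod_range_succ', two_mul, Finset.prod_range_add,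
    ← Finset.prod_range_reflect (fun x => f (m + x + 1)), ← Finset.prod_mul_distrib, mul_comm]
  congr 1
  refine Finset.prod_congr rfl fun d hd => ?_
  have hd := Finset.mem_range.1 hd
  congr 2
  omega

theorem prod_range_eq_pairs_even (f : ℕ → M) (k : ℕ) :
    ∏ d ∈ Finset.range (2 * k + 2), f d =
      f 0 * f (k + 1) * ∏ d ∈ Finset.range k, f (d + 1) * f (2 * k + 2 - (d + 1)) := by
  rw [Finset.prod_range_succ', show 2 * k + 1 = (k + 1) + k by omega, Finset.prod_range_add,
    Finset.prod_range_succ, ← Finset.prod_range_reflect (fun x => f (k + 1 + x + 1)),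
    Finset.prod_mul_distrib, Finset.prod_congr rfl fun d hd => congrArg f
      (show k + 1 + (k - 1 - d) + 1 = 2 * k + 2 - (d + 1) by
        have := Finset.mem_range.1 hd; omega)]
  ac_rfl

end ProductsOverRanges

theorem IsPrimitiveRoot.pow_sub_one_eq_prod_range {K : Type*} [Field K] {ρ : K} {n : ℕ}
    (hρ : IsPrimitiveRoot ρ n) (hn : 0 < n) (y : K) :
    y ^ n - 1 = ∏ d ∈ Finset.range n, (y - ρ ^ d) := by
  classical
  have h := hρ.pow_sub_pow_eq_prod_sub_mul y 1 hn
  rw [one_pow] at h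
  have hsub : (Finset.range n).image (fun d => ρ ^ d) ⊆ Polynomial.nthRootsFinset n (1 : K) := by
    intro x hx
    obtain ⟨d, -, rfl⟩ := Finset.mem_image.1 hx
    rw [Polynomial.mem_nthRootsFinset hn, ← pow_mul, mul_comm, pow_mul, hρ.pow_eq_one, one_pow]
  have hinj : Set.InjOn (fun d => ρ ^ d) (Finset.range n : Set ℕ) := fun a ha b hb hab =>
    hρ.pow_inj (Finset.mem_range.1 ha) (Finset.mem_range.1 hb) hab
  have himg := Finset.eq_of_subset_of_card_le hsub (by
    rw [hρ.card_nthRootsFinset, Finset.card_image_of_injOn hinj, Finset.card_range])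
  rw [h, ← himg, Finset.prod_image hinj]
  simp

section RatioForm

variable {K : Type*} [Field K]

/-- The value of `A² - (x/y - y/x)²` when `(x/y)² = ρ^d`. -/
def ratioForm (A ρ : K) (d : ℕ) : K := A ^ 2 + 2 - ρ ^ d - (ρ ^ d)⁻¹

theorem ratioForm_symm (A : K) {ρ : K} {n d : ℕ} (hρ : ρ ^ n = 1) (hd : d ≤ n) :
    ratioForm A ρ (n - d) = ratioForm A ρ d := by
  have h : ρ ^ (n - d) * ρ ^ d = 1 := by rw [← pow_add, Nat.sub_add_cancel hd, hρ]
  rw [ratioForm, ratioForm, eq_inv_of_mul_eq_one_left h, inv_inv]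
  ring

/-- The contribution of the off-diagonal pair `(x, y)`, `(y, x)`, normalised by `x y`. -/
theorem form_mul_form_swap (A x y r : K) (hx : x ≠ 0) (hy : y ≠ 0) (hr : y ^ 2 = r * x ^ 2) :
    (x ^ 2 - A * x * y - y ^ 2) / (x * y) * ((y ^ 2 - A * y * x - x ^ 2) / (y * x)) =
      A ^ 2 + 2 - r - r⁻¹ := by
  have hr' : r = y ^ 2 / x ^ 2 := by field_simp; exact hr.symm
  rw [hr']
  field_simp
  ring

theorem prod_form_eq (A ρ : K) (n : ℕ) (s : ℕ → K) (hρ : ρ ≠ 0)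
    (hs : ∀ a < n, s a ^ 2 = ρ ^ a) (hprod : (∏ a ∈ Finset.range n, s a) ^ (2 * n) = 1) :
    ∏ a ∈ Finset.range n, ∏ b ∈ Finset.range n, (s a ^ 2 - A * s a * s b - s b ^ 2) =
      (-A) ^ n * ∏ d ∈ Finset.range n, ratioForm A ρ (d + 1) ^ (n - 1 - d) := by
  have hs0 : ∀ a < n, s a ≠ 0 := fun a ha h0 => by
    have := hs a ha
    rw [h0, zero_pow two_ne_zero] at this
    exact pow_ne_zero _ hρ this.symm
  have hden : ∏ a ∈ Finset.range n, ∏ b ∈ Finset.range n, s a * s b = 1 := by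
    simp only [Finset.prod_mul_distrib, Finset.prod_const, Finset.card_range, Finset.prod_pow]
    rw [← pow_add, ← two_mul, hprod]
  have hdiv : ∏ a ∈ Finset.range n, ∏ b ∈ Finset.range n, (s a ^ 2 - A * s a * s b - s b ^ 2) =
      ∏ a ∈ Finset.range n, ∏ b ∈ Finset.range n,
        (s a ^ 2 - A * s a * s b - s b ^ 2) / (s a * s b) := by
    rw [Finset.prod_congr rfl fun a _ => Finset.prod_div_distrib _ _, Finset.prod_div_distrib, hden,
      div_one]
  rw [hdiv, prod_range_prod_range_eq_diag_mul, ← prod_range_prod_range_sub,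
    Finset.prod_mul_distrib]
  congr 1
  · rw [Finset.prod_congr rfl (g := fun _ => -A), Finset.prod_const, Finset.card_range]
    intro b hb
    have := hs0 b (Finset.mem_range.1 hb)
    field_simp
    ring
  · refine Finset.prod_congr rfl fun b hb => Finset.prod_congr rfl fun a ha => ?_
    have hb := Finset.mem_range.1 hb
    have ha := Finset.mem_range.1 ha
    refine form_mul_form_swap A _ _ _ (hs0 a (ha.trans hb)) (hs0 b hb) ?_
    rw [hs a (ha.trans hb), hs b hb, ← pow_add, Nat.sub_add_cancel ha.le]

theorem sub_mul_sub_eq_ratioForm {A α β ρ : K} (hsum : α + β = A) (hmul : α * β = -1) {n d : ℕ}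
    (hρ : ρ ^ n = 1) (hd : d ≤ n) :
    (α ^ 2 - ρ ^ d) * (α ^ 2 - ρ ^ (n - d)) = α ^ 2 * ratioForm A ρ d := by
  have h : ρ ^ (n - d) * ρ ^ d = 1 := by rw [← pow_add, Nat.sub_add_cancel hd, hρ]
  have h0 : ρ ^ d ≠ 0 := right_ne_zero_of_mul_eq_one h
  rw [ratioForm, eq_inv_of_mul_eq_one_left h, ← hsum]
  have e : α ^ 2 * ((α + β) ^ 2 + 2 - ρ ^ d - (ρ ^ d)⁻¹) =
      α ^ 4 + 1 - α ^ 2 * ρ ^ d - α ^ 2 * (ρ ^ d)⁻¹ := by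
    linear_combination (2 * α ^ 2 + α * β - 1) * hmul
  rw [e]
  linear_combination mul_inv_cancel₀ h0

end RatioForm

section Conjugates

variable {K : Type*} [Field K] {A α β ρ : K}

theorem prod_form_of_odd (m : ℕ) (hsum : α + β = A) (hmul : α * β = -1)
    (hfrob : α ^ (2 * (2 * m + 1) + 1) = β) (hD : A ^ 2 + 4 ≠ 0)
    (hρ : IsPrimitiveRoot ρ (2 * m + 1)) (s : ℕ → K) (hs : ∀ a < 2 * m + 1, s a ^ 2 = ρ ^ a)
    (hprod : (∏ a ∈ Finset.range (2 * m + 1), s a) ^ (2 * (2 * m + 1)) = 1)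
    (u : K) (hu : (α - β) * u = α ^ (2 * m + 2) - β ^ (2 * m + 2)) :
    2 * ∏ a ∈ Finset.range (2 * m + 1), ∏ b ∈ Finset.range (2 * m + 1),
        (s a ^ 2 - A * s a * s b - s b ^ 2) = (-A ^ 2 - 4) ^ (m + 1) * u := by
  rw [prod_form_eq A ρ _ s (hρ.ne_zero (by omega)) hs hprod, Nat.add_sub_cancel,
    prod_range_pow_of_symm_odd _ _ fun d hd => ratioForm_symm A hρ.pow_eq_one hd, ← mul_pow]
  have hα : α ≠ 0 := left_ne_zero_of_mul (hmul.trans_ne (neg_ne_zero.2 one_ne_zero))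
  have hW := hρ.pow_sub_one_eq_prod_range (by omega) (α ^ 2)
  rw [prod_range_eq_pairs_odd, Finset.prod_congr rfl fun d hd =>
    sub_mul_sub_eq_ratioForm hsum hmul hρ.pow_eq_one (by have := Finset.mem_range.1 hd; omega),
    Finset.prod_mul_distrib, Finset.prod_const, Finset.card_range, pow_zero] at hW
  generalize ∏ d ∈ Finset.range m, ratioForm A ρ (d + 1) = P at hW ⊢
  have hab : α ^ (2 * m + 1) * β ^ (2 * m + 1) = -1 := by
    rw [← mul_pow, hmul, Odd.neg_one_pow ⟨m, rfl⟩]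
  have hβ : α * (α ^ (2 * m + 1)) ^ 2 = β := by rw [← hfrob]; ring
  have hu' : (α - β) * u = α * α ^ (2 * m + 1) - β * β ^ (2 * m + 1) := by rw [hu]; ring
  have hW' : α ^ (2 * m + 1) * (A * P) = (α ^ (2 * m + 1)) ^ 2 - 1 := by
    have h1 : α ^ 2 - 1 = α * A := by rw [← hsum]; linear_combination -hmul
    rw [h1] at hW
    rw [← pow_mul, mul_comm _ 2, pow_mul, hW]
    ring
  have ha0 : α ^ (2 * m + 1) ≠ 0 := pow_ne_zero _ hα
  generalize α ^ (2 * m + 1) = a at *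
  generalize β ^ (2 * m + 1) = b at *
  have hWab : A * P = a + b := by
    apply mul_left_cancel₀ ha0
    rw [hW']
    linear_combination -hab
  have hb : b = α ^ 2 * a := by
    apply mul_left_cancel₀ ha0
    rw [hab, ← hmul, ← hβ]; ring
  have ha : a = β ^ 2 * b := by
    rw [hb]; linear_combination (-a * (α * β - 1)) * hmul
  have hDu : (A ^ 2 + 4) * u = 2 * (a + b) := by
    have : (A ^ 2 + 4) * u = (α - β) * ((α - β) * u) := by
      rw [← hsum]; linear_combination 4 * u * hmul
    rw [this, hu']
    linear_combination (-(a + b)) * hmul - hb - ha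
  have hWsq : (a + b) ^ 2 = -A ^ 2 - 4 := by
    have ha2 : a ^ 2 = -β ^ 2 := by linear_combination a ^ 2 * hmul - β * hβ
    have hb2 : b ^ 2 = -α ^ 2 := by
      rw [hb]; linear_combination α ^ 4 * ha2 - α ^ 2 * (α * β - 1) * hmul
    rw [← hsum]
    linear_combination ha2 + hb2 + 2 * hab + 2 * hmul
  have hWu : (a + b) * u = -2 := by
    have h0 : a + b ≠ 0 := by
      intro h
      rw [h] at hWsq
      apply hD
      linear_combination hWsq
    apply mul_left_cancel₀ h0
    linear_combination u * hWsq - hDu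
  rw [neg_mul, hWab, Odd.neg_pow ⟨m, rfl⟩, ← hWsq, ← pow_mul]
  linear_combination -(a + b) ^ (2 * m + 1) * hWu

theorem prod_form_of_even (k : ℕ) (hsum : α + β = A) (hmul : α * β = -1)
    (hfrob : α ^ (2 * (2 * k + 2) + 1) = β) (hD : A ^ 2 + 4 ≠ 0)
    (hρ : IsPrimitiveRoot ρ (2 * k + 2)) (s : ℕ → K) (hs : ∀ a < 2 * k + 2, s a ^ 2 = ρ ^ a)
    (hprod : (∏ a ∈ Finset.range (2 * k + 2), s a) ^ (2 * (2 * k + 2)) = 1) :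
    ∏ a ∈ Finset.range (2 * k + 2), ∏ b ∈ Finset.range (2 * k + 2),
        (s a ^ 2 - A * s a * s b - s b ^ 2) = (-A ^ 2 - 4) ^ (k + 1) := by
  have hhalf : ρ ^ (k + 1) = -1 :=
    (hρ.pow (by omega) (show 2 * k + 2 = (k + 1) * 2 by ring)).eq_neg_one_of_two_right
  have hmid : ratioForm A ρ (k + 1) = A ^ 2 + 4 := by
    rw [ratioForm, hhalf, inv_neg, inv_one]; ring
  rw [prod_form_eq A ρ _ s (hρ.ne_zero (by omega)) hs hprod,
    show 2 * k + 2 - 1 = 2 * k + 1 by omega,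
    prod_range_pow_of_symm_even _ _ fun d hd => ratioForm_symm A hρ.pow_eq_one hd, ← mul_assoc,
    ← mul_pow, hmid]
  have hα : α ≠ 0 := left_ne_zero_of_mul (hmul.trans_ne (neg_ne_zero.2 one_ne_zero))
  have hW := hρ.pow_sub_one_eq_prod_range (by omega) (α ^ 2)
  rw [prod_range_eq_pairs_even, Finset.prod_congr rfl fun d hd =>
    sub_mul_sub_eq_ratioForm hsum hmul hρ.pow_eq_one (by have := Finset.mem_range.1 hd; omega),
    Finset.prod_mul_distrib, Finset.prod_const, Finset.card_range, pow_zero, hhalf] at hW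
  generalize ∏ d ∈ Finset.range k, ratioForm A ρ (d + 1) = P at hW ⊢
  have hβ : α * (α ^ (2 * k + 2)) ^ 2 = β := by rw [← hfrob]; ring
  have hW' : α ^ (2 * k + 2) * ((α - β) * (A * P)) = (α ^ (2 * k + 2)) ^ 2 - 1 := by
    have h1 : α ^ 2 - 1 = α * A := by rw [← hsum]; linear_combination -hmul
    have h2 : α ^ 2 - -1 = α * (α - β) := by linear_combination hmul
    rw [h1, h2] at hW
    rw [← pow_mul, mul_comm _ 2, pow_mul, hW]
    ring
  have ha0 : α ^ (2 * k + 2) ≠ 0 := pow_ne_zero _ hα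
  generalize α ^ (2 * k + 2) = a at *
  have hWsq : (A * P) ^ 2 = -1 := by
    have ha2 : a ^ 2 = -β ^ 2 := by linear_combination a ^ 2 * hmul - β * hβ
    have hsq : a ^ 2 * ((A ^ 2 + 4) * (A * P) ^ 2) = a ^ 2 * (-(A ^ 2 + 4)) := by
      have e : a ^ 2 * ((A ^ 2 + 4) * (A * P) ^ 2) = (a * ((α - β) * (A * P))) ^ 2 := by
        rw [← hsum]
        linear_combination (4 * a ^ 2 * ((α + β) * P) ^ 2) * hmul
      rw [e, hW', ha2, ← hsum]
      linear_combination (-2 * β ^ 2 - α * β + 1) * hmul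
    have := mul_left_cancel₀ (pow_ne_zero 2 ha0) hsq
    apply mul_left_cancel₀ hD
    rw [this]; ring
  rw [neg_mul, show 2 * k + 2 = 2 * (k + 1) by ring, pow_mul, neg_sq, hWsq, ← mul_pow]
  ring

end Conjugates

theorem sub_mul_lucasU {K : Type*} [Field K] {A : ℤ} {α β : K} (hsum : α + β = A)
    (hmul : α * β = -1) (n : ℕ) : (α - β) * (lucasU A n : K) = α ^ n - β ^ n := by
  induction n using Nat.twoStepInduction with
  | zero => simp [lucasU]
  | one => simp [lucasU]
  | more n h0 h1 =>
    rw [lucasU]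
    push_cast
    rw [← hsum]
    linear_combination (α + β) * h1 + h0 + (α ^ n - β ^ n) * hmul

/-- Up to sign, the integers `1, …, (p - 1) / 2` are the powers of a primitive root modulo `p`. -/
theorem exists_half_system_enumeration (p n : ℕ) [Fact p.Prime] (hp : p = 2 * n + 1) :
    ∃ (ρ : ZMod p) (s : ℕ → ℕ), IsPrimitiveRoot ρ n ∧ (∀ a, (s a : ZMod p) ^ 2 = ρ ^ a) ∧
      Set.InjOn s (Finset.range n : Set ℕ) ∧ (Finset.range n).image s = Finset.Icc 1 n := by
  have hpp : p.Prime := Fact.out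
  have hn : 0 < n := by have := hpp.two_le; omega
  obtain ⟨g, hg⟩ := IsCyclic.exists_ofOrder_eq_natCard (α := (ZMod p)ˣ)
  rw [Nat.card_eq_fintype_card, ZMod.card_units, show p - 1 = 2 * n by omega] at hg
  have hγ : IsPrimitiveRoot (g : ZMod p) (2 * n) :=
    IsPrimitiveRoot.coe_units_iff.2 (hg ▸ IsPrimitiveRoot.orderOf g)
  have hρ : IsPrimitiveRoot ((g : ZMod p) ^ 2) n := hγ.pow (by omega) rfl
  have hsq : ∀ a, ((((g : ZMod p) ^ a).valMinAbs.natAbs : ℕ) : ZMod p) ^ 2 =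
      ((g : ZMod p) ^ 2) ^ a := fun a => by
    have h : ((((g : ZMod p) ^ a).valMinAbs.natAbs : ℕ) : ZMod p) ^ 2 =
        (((((g : ZMod p) ^ a).valMinAbs.natAbs : ℤ) ^ 2 : ℤ) : ZMod p) := by
      rw [Int.cast_pow, Int.cast_natCast]
    rw [h, Int.natAbs_sq, Int.cast_pow, ZMod.coe_valMinAbs, ← pow_mul, ← pow_mul, mul_comm]
  have hinj : Set.InjOn (fun a => ((g : ZMod p) ^ a).valMinAbs.natAbs)
      (Finset.range n : Set ℕ) := fun a ha b hb hab => by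
    refine hρ.pow_inj (Finset.mem_range.1 ha) (Finset.mem_range.1 hb) ?_
    rw [← hsq, ← hsq]
    exact congrArg (fun x : ℕ => (x : ZMod p) ^ 2) hab
  refine ⟨_, _, hρ, hsq, hinj, Finset.eq_of_subset_of_card_le ?_ ?_⟩
  · intro x hx
    obtain ⟨a, -, rfl⟩ := Finset.mem_image.1 hx
    rw [Finset.mem_Icc]
    constructor
    · rw [Nat.one_le_iff_ne_zero, Ne, Int.natAbs_eq_zero, ZMod.valMinAbs_eq_zero]
      exact pow_ne_zero _ g.ne_zero
    · have := ZMod.natAbs_valMinAbs_le ((g : ZMod p) ^ a)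
      omega
  · rw [Finset.card_image_of_injOn hinj, Finset.card_range, Nat.card_Icc, Nat.add_sub_cancel]

/-- If `A² + 4` is a nonresidue modulo `p`, the roots of `x² - A x - 1` are Frobenius
conjugates. -/
theorem exists_frobenius_conjugate_roots (p : ℕ) [Fact p.Prime] (hodd : Odd p) (A : ℤ)
    (hleg : legendreSym p (A ^ 2 + 4) = -1) :
    ∃ α β : AlgebraicClosure (ZMod p), α + β = A ∧ α * β = -1 ∧ α ^ p = β := by
  have hpp : p.Prime := Fact.out
  have hcast : ∀ z : ℤ, (z : AlgebraicClosure (ZMod p)) ^ p = z := fun z => by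
    have h := congrArg (algebraMap (ZMod p) (AlgebraicClosure (ZMod p)))
      (ZMod.pow_card (z : ZMod p))
    rwa [map_pow, map_intCast] at h
  have h2 : (2 : AlgebraicClosure (ZMod p)) ≠ 0 := by
    intro h
    have h' : ((2 : ℕ) : AlgebraicClosure (ZMod p)) = 0 := by exact_mod_cast h
    rw [CharP.cast_eq_zero_iff _ p, Nat.prime_dvd_prime_iff_eq hpp Nat.prime_two] at h'
    subst h'
    exact absurd hodd (by decide)
  have hD : ((A : AlgebraicClosure (ZMod p)) ^ 2 + 4) ^ (p / 2) = -1 := by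
    have h := congrArg (algebraMap (ZMod p) (AlgebraicClosure (ZMod p)))
      (legendreSym.eq_pow p (A ^ 2 + 4))
    rw [hleg, map_pow, map_intCast, map_intCast] at h
    push_cast at h
    exact h.symm
  obtain ⟨δ, hδ⟩ := IsAlgClosed.exists_pow_nat_eq ((A : AlgebraicClosure (ZMod p)) ^ 2 + 4) two_pos
  have hδp : δ ^ p = -δ := by
    obtain ⟨n, hn⟩ := hodd
    rw [show p / 2 = n by omega, ← hδ, ← pow_mul] at hD
    rw [show δ ^ p = δ ^ (2 * n + 1) from congrArg _ hn, pow_succ, hD, neg_one_mul]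
  refine ⟨(A + δ) / 2, (A - δ) / 2, by field_simp; ring,
    by field_simp; linear_combination -hδ, ?_⟩
  have h2p := hcast 2
  push_cast at h2p
  rw [div_pow, add_pow_char, hcast, hδp, h2p, sub_eq_add_neg]

/-- Theorem 1.4(iii): let `p` be an odd prime and `A` an integer with `((A²+4)/p) = -1`, and
`T_p(1,-A,-1) = ∏_{1 ≤ i,j ≤ (p-1)/2, p ∤ i²-Aij-j²} (i² - Aij - j²)`.
If `p ≡ 1 (mod 4)` then `T_p(1,-A,-1) ≡ (-A²-4)^{(p-1)/4} (mod p)`;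
if `p ≡ 3 (mod 4)` then `2·T_p(1,-A,-1) ≡ (-A²-4)^{(p+1)/4}·u_{(p+1)/2}(A) (mod p)`. -/
theorem statement13 (p : ℕ) [Fact p.Prime] (hodd : Odd p) (A : ℤ)
    (hleg : legendreSym p (A ^ 2 + 4) = -1) :
    (p % 4 = 1 →
      (∏ i ∈ Finset.Icc 1 ((p - 1) / 2), ∏ j ∈ Finset.Icc 1 ((p - 1) / 2),
          if (p : ℤ) ∣ ((i : ℤ) ^ 2 - A * (i : ℤ) * (j : ℤ) - (j : ℤ) ^ 2) then 1
          else (i : ℤ) ^ 2 - A * (i : ℤ) * (j : ℤ) - (j : ℤ) ^ 2)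
        ≡ (-A ^ 2 - 4) ^ ((p - 1) / 4) [ZMOD (p : ℤ)]) ∧
    (p % 4 = 3 →
      2 * (∏ i ∈ Finset.Icc 1 ((p - 1) / 2), ∏ j ∈ Finset.Icc 1 ((p - 1) / 2),
          if (p : ℤ) ∣ ((i : ℤ) ^ 2 - A * (i : ℤ) * (j : ℤ) - (j : ℤ) ^ 2) then 1
          else (i : ℤ) ^ 2 - A * (i : ℤ) * (j : ℤ) - (j : ℤ) ^ 2)
        ≡ (-A ^ 2 - 4) ^ ((p + 1) / 4) * lucasU A ((p + 1) / 2) [ZMOD (p : ℤ)]) := by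
  have hpp : p.Prime := Fact.out
  obtain ⟨n, hn⟩ := hodd
  obtain ⟨α, β, hsum, hmul, hfrob⟩ := exists_frobenius_conjugate_roots p ⟨n, hn⟩ A hleg
  obtain ⟨ρ, s, hρ, hs, hinj, himg⟩ := exists_half_system_enumeration p n hn
  have hn2 : (p - 1) / 2 = n := by omega
  have hnsq : ¬ IsSquare ((A : ZMod p) ^ 2 + 4) := by
    simpa using legendreSym.eq_neg_one_iff p |>.1 hleg
  have hD : (A : AlgebraicClosure (ZMod p)) ^ 2 + 4 ≠ 0 := fun h => by
    refine hnsq ⟨0, ?_⟩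
    apply (algebraMap (ZMod p) (AlgebraicClosure (ZMod p))).injective
    simpa [map_ofNat] using h
  have hρ' := hρ.map_of_injective (algebraMap (ZMod p) (AlgebraicClosure (ZMod p))).injective
  have hs' : ∀ a < n, (s a : AlgebraicClosure (ZMod p)) ^ 2 =
      (algebraMap (ZMod p) (AlgebraicClosure (ZMod p)) ρ) ^ a := fun a _ => by
    simpa using congrArg (algebraMap (ZMod p) (AlgebraicClosure (ZMod p))) (hs a)
  have hprod : (∏ a ∈ Finset.range n, (s a : AlgebraicClosure (ZMod p))) ^ (2 * n) = 1 := by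
    have h0 : ∏ a ∈ Finset.range n, (s a : ZMod p) ≠ 0 := Finset.prod_ne_zero_iff.2 fun a _ h => by
      have h' := hs a
      rw [h, zero_pow two_ne_zero] at h'
      exact pow_ne_zero a (hρ.ne_zero (by have := hpp.two_le; omega)) h'.symm
    have h := congrArg (algebraMap (ZMod p) (AlgebraicClosure (ZMod p)))
      (ZMod.pow_card_sub_one_eq_one h0)
    rw [show p - 1 = 2 * n by omega] at h
    simpa using h
  have hndvd : ∀ i ∈ Finset.Icc 1 n, ∀ j ∈ Finset.Icc 1 n,
      ¬ (p : ℤ) ∣ ((i : ℤ) ^ 2 - A * (i : ℤ) * (j : ℤ) - (j : ℤ) ^ 2) := by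
    intro i _ j hj h
    rw [← ZMod.intCast_zmod_eq_zero_iff_dvd] at h
    push_cast at h
    have hj0 : (j : ZMod p) ≠ 0 := by
      rw [Ne, ZMod.natCast_eq_zero_iff]
      intro hd
      have := Finset.mem_Icc.1 hj
      have := Nat.le_of_dvd (by omega) hd
      omega
    refine hnsq ⟨(2 * i - A * j) / j, ?_⟩
    field_simp
    linear_combination (-4) * h
  have hT : ((∏ i ∈ Finset.Icc 1 ((p - 1) / 2), ∏ j ∈ Finset.Icc 1 ((p - 1) / 2),
          if (p : ℤ) ∣ ((i : ℤ) ^ 2 - A * (i : ℤ) * (j : ℤ) - (j : ℤ) ^ 2) then 1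
          else (i : ℤ) ^ 2 - A * (i : ℤ) * (j : ℤ) - (j : ℤ) ^ 2 : ℤ) :
        AlgebraicClosure (ZMod p)) =
      ∏ a ∈ Finset.range n, ∏ b ∈ Finset.range n,
        ((s a : AlgebraicClosure (ZMod p)) ^ 2 - A * s a * s b - (s b) ^ 2) := by
    rw [hn2, Finset.prod_congr rfl fun i hi => Finset.prod_congr rfl fun j hj =>
      if_neg (hndvd i hi j hj), ← himg]
    simp only [Finset.prod_image hinj]
    push_cast
    rfl
  constructor
  · intro hp4
    obtain ⟨k, rfl⟩ : ∃ k, n = 2 * k + 2 := ⟨p / 4 - 1, by have := hpp.two_le; omega⟩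
    rw [Int.modEq_iff_dvd, ← CharP.intCast_eq_zero_iff (AlgebraicClosure (ZMod p)) p, Int.cast_sub,
      hT, prod_form_of_even k hsum hmul (by rw [← hn, hfrob]) hD hρ' _ hs' hprod,
      show (p - 1) / 4 = k + 1 by omega]
    push_cast
    ring
  · intro hp4
    obtain ⟨m, rfl⟩ : ∃ m, n = 2 * m + 1 := ⟨p / 4, by omega⟩
    rw [Int.modEq_iff_dvd, ← CharP.intCast_eq_zero_iff (AlgebraicClosure (ZMod p)) p, Int.cast_sub,
      Int.cast_mul 2, hT, Int.cast_ofNat, prod_form_of_odd m hsum hmul (by rw [← hn, hfrob]) hD hρ' _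
        hs' hprod _ (sub_mul_lucasU hsum hmul _),
      show (p + 1) / 4 = m + 1 by omega, show (p + 1) / 2 = 2 * m + 2 by omega]
    push_cast
    ring
end

section
/- Let p be an odd prime with p ≠ 5. Then T_p(1, −1, −1) ≡ −5^{(p−1)/4} (mod p) if p ≡ 1, 9 (mod 20); T_p(1, −1, −1) ≡ (−5)^{(p−1)/4} (mod p) if p ≡ 13, 17 (mod 20); T_p(1, −1, −1) ≡ (−1)^{⌊(p−10)/20⌋} (mod p) if p ≡ 3, 7 (mod 20); and T_p(1, −1, −1) ≡ (−1)^{⌊(p−5)/10⌋} (mod p) if p ≡ 11, 19 (mod 20). -/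
namespace GoldenForm

open Finset

/-- The residues `1, …, ⌊p/2⌋` modulo `p`. -/
def half (p : ℕ) : Finset (ZMod p) := (Icc 1 (p / 2)).image Nat.cast

theorem injOn_cast_Icc {p : ℕ} [Fact p.Prime] :
    Set.InjOn (Nat.cast : ℕ → ZMod p) (Icc 1 (p / 2) : Finset ℕ) := by
  intro a ha b hb hab
  have hp := (Fact.out : p.Prime).pos
  simp only [coe_Icc, Set.mem_Icc] at ha hb
  have := congrArg ZMod.val hab
  rwa [ZMod.val_natCast_of_lt (by omega), ZMod.val_natCast_of_lt (by omega)] at this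

theorem mem_half {p : ℕ} [Fact p.Prime] {x : ZMod p} :
    x ∈ half p ↔ x ≠ 0 ∧ x.val ≤ p / 2 := by
  have hp := (Fact.out : p.Prime).pos
  simp only [half, mem_image, mem_Icc]
  constructor
  · rintro ⟨a, ha, rfl⟩
    have h := ZMod.val_natCast_of_lt (show a < p by omega)
    refine ⟨?_, by omega⟩
    rw [Ne, ← ZMod.val_eq_zero]
    omega
  · rintro ⟨h0, h⟩
    have := mt (ZMod.val_eq_zero x).1 h0
    exact ⟨x.val, by omega, ZMod.natCast_zmod_val x⟩

theorem card_half {p : ℕ} [Fact p.Prime] : #(half p) = p / 2 := by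
  rw [half, card_image_of_injOn injOn_cast_Icc, Nat.card_Icc]
  omega

theorem neg_mem_half {p : ℕ} [Fact p.Prime] (hodd : Odd p) {x : ZMod p} (hx : x ≠ 0) :
    -x ∈ half p ↔ x ∉ half p := by
  obtain ⟨k, hk⟩ := hodd
  have h0 := mt (ZMod.val_eq_zero x).1 hx
  have hlt := ZMod.val_lt x
  simp only [mem_half, ZMod.neg_val, if_neg hx, neg_ne_zero]
  simp only [hx, ne_eq, not_false_eq_true, true_and]
  omega

theorem ne_zero_of_mem_half {p : ℕ} [Fact p.Prime] {x : ZMod p} (hx : x ∈ half p) : x ≠ 0 :=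
  (mem_half.1 hx).1

theorem prod_erase_zero {p : ℕ} [Fact p.Prime] : ∏ x ∈ univ.erase (0 : ZMod p), x = -1 := by
  have h := FiniteField.prod_univ_units_id_eq_neg_one (K := ZMod p)
  have h2 := congrArg (Units.val) h
  rw [Units.coe_prod] at h2
  push_cast at h2
  rw [← h2]
  symm
  refine prod_bij (fun u _ => (u : ZMod p)) (by simp) (by simp [Units.val_inj]) ?_ (by simp)
  intro b hb
  exact ⟨Units.mk0 b (ne_of_mem_erase hb), by simp⟩

theorem prod_half_sq {p : ℕ} [Fact p.Prime] (hodd : Odd p) :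
    ∏ i ∈ half p, i ^ 2 = -(-1) ^ (p / 2) := by
  have h : ∏ x ∈ univ.erase (0 : ZMod p), x = (∏ i ∈ half p, i) * ∏ i ∈ half p, -i := by
    rw [← prod_filter_mul_prod_filter_not _ (· ∈ half p)]
    congr 1
    · refine prod_congr ?_ fun _ _ => rfl
      ext x
      simp only [mem_filter, mem_erase, mem_univ, and_true]
      exact ⟨fun h => h.2, fun h => ⟨ne_zero_of_mem_half h, h⟩⟩
    · refine prod_nbij' (fun x => -x) (fun x => -x) ?_ ?_ (by simp) (by simp) (by simp)
      · intro x hx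
        simp only [mem_filter, mem_erase, mem_univ, and_true] at hx
        exact (neg_mem_half hodd hx.1).2 hx.2
      · intro x hx
        have h0 := ne_zero_of_mem_half hx
        simp only [mem_filter, mem_erase, mem_univ, and_true]
        refine ⟨neg_ne_zero.2 h0, fun h => (neg_mem_half hodd h0).1 h hx⟩
  rw [prod_erase_zero, prod_neg, card_half] at h
  rw [prod_pow]
  have h1 : ((-1 : ZMod p) ^ (p / 2)) ^ 2 = 1 := by
    rw [← pow_mul, mul_comm, pow_mul]; simp
  linear_combination (-(-1 : ZMod p) ^ (p / 2)) * h - (∏ i ∈ half p, i) ^ 2 * h1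

/-- The quadratic form `a² - ab - b²`. -/
def form {R : Type*} [CommRing R] (a b : R) : R := a ^ 2 - a * b - b ^ 2

/-- The form `a² - ab - b²`, with the value `0` replaced by `1`. -/
def unitForm {p : ℕ} (a b : ZMod p) : ZMod p := if form a b = 0 then 1 else form a b

/-- The product of the nonzero values of the form over pairs in the half system with ratio `x`. -/
def slopeProd {p : ℕ} (x : ZMod p) : ZMod p :=
  ∏ j ∈ half p, if x * j ∈ half p then unitForm (x * j) j else 1

theorem cast_prod_eq {p : ℕ} [Fact p.Prime] (hodd : Odd p) :
    ((∏ i ∈ Icc 1 ((p - 1) / 2), ∏ j ∈ Icc 1 ((p - 1) / 2),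
      if (p : ℤ) ∣ ((i : ℤ) ^ 2 - (i : ℤ) * (j : ℤ) - (j : ℤ) ^ 2) then 1
      else (i : ℤ) ^ 2 - (i : ℤ) * (j : ℤ) - (j : ℤ) ^ 2 : ℤ) : ZMod p) =
    ∏ x ∈ univ.erase (0 : ZMod p), slopeProd x := by
  have hn : (p - 1) / 2 = p / 2 := by
    obtain ⟨k, hk⟩ := hodd
    omega
  have h1 : ((∏ i ∈ Icc 1 ((p - 1) / 2), ∏ j ∈ Icc 1 ((p - 1) / 2),
      if (p : ℤ) ∣ ((i : ℤ) ^ 2 - (i : ℤ) * (j : ℤ) - (j : ℤ) ^ 2) then 1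
      else (i : ℤ) ^ 2 - (i : ℤ) * (j : ℤ) - (j : ℤ) ^ 2 : ℤ) : ZMod p) =
      ∏ i ∈ half p, ∏ j ∈ half p, unitForm i j := by
    rw [hn, half, prod_image injOn_cast_Icc, Int.cast_prod]
    refine prod_congr rfl fun i _ => ?_
    rw [prod_image injOn_cast_Icc, Int.cast_prod]
    refine prod_congr rfl fun j _ => ?_
    have h := ZMod.intCast_zmod_eq_zero_iff_dvd
      ((i : ℤ) ^ 2 - (i : ℤ) * (j : ℤ) - (j : ℤ) ^ 2) p
    push_cast at h
    simp only [unitForm, form, h]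
    split_ifs <;> push_cast <;> rfl
  rw [h1, prod_comm]
  simp only [slopeProd]
  symm
  rw [prod_comm]
  symm
  refine prod_congr rfl fun j hj => ?_
  have hj0 := ne_zero_of_mem_half hj
  rw [← prod_filter]
  refine prod_nbij' (fun i => i * j⁻¹) (fun x => x * j) ?_ ?_ ?_ ?_ ?_
  · intro i hi
    have := ne_zero_of_mem_half hi
    simp [hi, hj0, this]
  · intro x hx
    exact (mem_filter.1 hx).2
  · intro i _
    simp [hj0]
  · intro x _
    simp [hj0]
  · intro i _
    simp [hj0]

theorem slopeProd_of_form_eq_zero {p : ℕ} {x : ZMod p} (h : form x 1 = 0) :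
    slopeProd x = 1 := by
  refine prod_eq_one fun j _ => ?_
  have : form (x * j) j = 0 := by
    unfold form at *
    linear_combination j ^ 2 * h
  simp [unitForm, this]

theorem prod_gauss_sign {p : ℕ} [Fact p.Prime] (hodd : Odd p) {x : ZMod p} (hx : x ≠ 0) :
    ∏ i ∈ half p, (if x * i ∈ half p then (1 : ZMod p) else -1) = x ^ (p / 2) := by
  have h : ∏ i ∈ half p, (if x * i ∈ half p then (1 : ZMod p) else -1) * (x * i) =
      ∏ i ∈ half p, i := by
    have hmem : ∀ i ∈ half p, (if x * i ∈ half p then (1 : ZMod p) else -1) * (x * i) ∈ half p := by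
      intro i hi
      have h0 := mul_ne_zero hx (ne_zero_of_mem_half hi)
      split_ifs with h
      · simpa using h
      · simpa using (neg_mem_half hodd h0).2 h
    have hinj : Set.InjOn (fun i => (if x * i ∈ half p then (1 : ZMod p) else -1) * (x * i))
        (half p) := by
      intro i hi j hj hij
      have hi' : i ∈ half p := hi
      have hj' : j ∈ half p := hj
      have key : i = j ∨ i = -j := by
        simp only at hij
        split_ifs at hij
        · left; simpa [hx] using hij
        · right; apply mul_left_cancel₀ hx; linear_combination hij
        · right; apply mul_left_cancel₀ hx; linear_combination -hij
        · left; simpa [hx] using hij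
      rcases key with h | h
      · exact h
      · rw [h] at hi'
        exact absurd hj' ((neg_mem_half hodd (ne_zero_of_mem_half hj')).1 hi')
    exact prod_nbij _ hmem hinj (surjOn_of_injOn_of_card_le _ hmem hinj le_rfl) (fun _ _ => rfl)
  rw [prod_mul_distrib, prod_mul_distrib, prod_const, card_half] at h
  have hne : ∏ i ∈ half p, i ≠ 0 := prod_ne_zero_iff.2 fun _ => ne_zero_of_mem_half
  have hx2 : (x ^ (p / 2)) ^ 2 = 1 := by
    obtain ⟨k, hk⟩ := hodd
    rw [← pow_mul, show p / 2 * 2 = p - 1 by omega, ZMod.pow_card_sub_one_eq_one hx]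
  have h' := mul_right_cancel₀ hne (show (∏ i ∈ half p, (if x * i ∈ half p then (1 : ZMod p) else -1))
    * x ^ (p / 2) * ∏ i ∈ half p, i = 1 * ∏ i ∈ half p, i by linear_combination h)
  linear_combination x ^ (p / 2) * h' -
    (∏ i ∈ half p, (if x * i ∈ half p then (1 : ZMod p) else -1)) * hx2

/-- Reindexing the products over `j` with `-x⁻¹ * j` in the half system by `j = -(x * i)`. -/
theorem slopeProd_neg_inv {p : ℕ} [Fact p.Prime] (hodd : Odd p) {x : ZMod p} (hx : x ≠ 0) :
    slopeProd (-x⁻¹) =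
      ∏ i ∈ half p, if x * i ∈ half p then 1 else unitForm i (-(x * i)) := by
  have hnot : ∀ i, (if x * i ∈ half p then (1 : ZMod p) else unitForm i (-(x * i))) =
      if ¬ x * i ∈ half p then unitForm i (-(x * i)) else 1 := fun i => by
    split_ifs <;> simp_all
  simp only [slopeProd, hnot]
  rw [← prod_filter, ← prod_filter]
  refine prod_nbij' (fun j => -x⁻¹ * j) (fun i => -(x * i)) ?_ ?_ ?_ ?_ ?_
  · intro j hj
    rw [mem_filter] at hj ⊢
    refine ⟨hj.2, ?_⟩
    rw [show x * (-x⁻¹ * j) = -j by field_simp]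
    exact fun h => (neg_mem_half hodd (ne_zero_of_mem_half hj.1)).1 h hj.1
  · intro i hi
    rw [mem_filter] at hi ⊢
    refine ⟨(neg_mem_half hodd (mul_ne_zero hx (ne_zero_of_mem_half hi.1))).2 hi.2, ?_⟩
    rw [show -x⁻¹ * -(x * i) = i by field_simp]
    exact hi.1
  · intro j _
    field_simp
  · intro i _
    field_simp
  · intro j _
    rw [show -(x * (-x⁻¹ * j)) = j by field_simp]

theorem slopeProd_mul_slopeProd {p : ℕ} [Fact p.Prime] (hodd : Odd p) {x : ZMod p} (hx : x ≠ 0)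
    (hq : form x 1 ≠ 0) :
    slopeProd x * slopeProd (-x⁻¹) = -(-1) ^ (p / 2) * (x * form x 1) ^ (p / 2) := by
  rw [slopeProd_neg_inv hodd hx, slopeProd, ← prod_mul_distrib]
  calc _ = ∏ i ∈ half p, (i ^ 2 * form x 1 * if x * i ∈ half p then 1 else -1) := by
        refine prod_congr rfl fun i hi => ?_
        have h1 : form (x * i) i = i ^ 2 * form x 1 := by unfold form; ring
        have h2 : form i (-(x * i)) = -(i ^ 2 * form x 1) := by unfold form; ring
        have h3 : i ^ 2 * form x 1 ≠ 0 := mul_ne_zero (pow_ne_zero _ (ne_zero_of_mem_half hi)) hq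
        simp only [unitForm, h1, h2, neg_eq_zero, h3, if_false]
        split_ifs <;> ring
    _ = _ := by
        rw [prod_mul_distrib, prod_mul_distrib, prod_gauss_sign hodd hx, prod_half_sq hodd,
          prod_const, card_half, mul_pow]
        ring

theorem prod_half_eq_of_sq_eq_neg_one {M : Type*} [CommMonoid M] {p : ℕ} [Fact p.Prime]
    (hodd : Odd p) {x : ZMod p} (hx : x ^ 2 = -1) (f : ZMod p → M) :
    ∏ i ∈ half p, f i = ∏ i ∈ half p with x * i ∈ half p, f i * f (x * i) := by
  have hx0 : x ≠ 0 := by rintro rfl; simp at hx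
  rw [← prod_filter_mul_prod_filter_not _ (fun i => x * i ∈ half p), prod_mul_distrib]
  congr 1
  symm
  refine prod_nbij' (fun i => x * i) (fun j => -(x * j)) ?_ ?_ ?_ ?_ (fun _ _ => rfl)
  · intro i hi
    rw [mem_filter] at hi ⊢
    refine ⟨hi.2, ?_⟩
    rw [show x * (x * i) = -i by linear_combination i * hx]
    exact fun h => (neg_mem_half hodd (ne_zero_of_mem_half hi.1)).1 h hi.1
  · intro i hi
    rw [mem_filter] at hi ⊢
    refine ⟨(neg_mem_half hodd (mul_ne_zero hx0 (ne_zero_of_mem_half hi.1))).2 hi.2, ?_⟩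
    rw [show x * -(x * i) = i by linear_combination -i * hx]
    exact hi.1
  · intro i _
    linear_combination -i * hx
  · intro i _
    linear_combination -i * hx

theorem slopeProd_mul_slopeProd_of_sq_eq_neg_one {p : ℕ} [Fact p.Prime]
    (h5 : (5 : ZMod p) ≠ 0) (h4 : p % 4 = 1) {x : ZMod p} (hx : x ^ 2 = -1) :
    slopeProd x * slopeProd (-x) = -5 ^ (p / 4) := by
  have hodd : Odd p := Nat.odd_iff.2 (by omega)
  have hx0 : x ≠ 0 := by rintro rfl; simp at hx
  have hinv : -(-x)⁻¹ = -x := by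
    rw [inv_neg, neg_neg]
    exact inv_eq_of_mul_eq_one_right (by linear_combination -hx)
  have hcard : #{i ∈ half p | x * i ∈ half p} = p / 4 := by
    have h := prod_half_eq_of_sq_eq_neg_one hodd hx (fun _ => 2)
    simp only [prod_const, card_half, ← pow_two, ← pow_mul] at h
    have := Nat.pow_right_injective (le_refl 2) h
    omega
  have hsq := prod_half_eq_of_sq_eq_neg_one hodd hx (fun i => i ^ 2)
  rw [prod_half_sq hodd, Even.neg_one_pow (Nat.even_iff.2 (by omega))] at hsq
  rw [← hinv, slopeProd_neg_inv hodd (neg_ne_zero.2 hx0), slopeProd, ← prod_mul_distrib]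
  have hne : (-2 - x) * (2 - x) ≠ 0 := by
    rw [show (-2 - x) * (2 - x) = -5 by linear_combination hx]
    exact neg_ne_zero.2 h5
  calc _ = ∏ i ∈ half p with x * i ∈ half p, (5 * (i ^ 2 * (x * i) ^ 2)) := by
        rw [prod_filter]
        refine prod_congr rfl fun i hi => ?_
        have hi0 := ne_zero_of_mem_half hi
        have hmem : -x * i ∈ half p ↔ x * i ∉ half p := by
          rw [neg_mul]
          exact neg_mem_half hodd (mul_ne_zero hx0 hi0)
        have h1 : form (x * i) i = i ^ 2 * (-2 - x) := by
          unfold form; linear_combination i ^ 2 * hx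
        have h2 : form i (-(-x * i)) = i ^ 2 * (2 - x) := by
          unfold form; linear_combination -i ^ 2 * hx
        have h3 := mul_ne_zero (pow_ne_zero 2 hi0) (left_ne_zero_of_mul hne)
        have h4 := mul_ne_zero (pow_ne_zero 2 hi0) (right_ne_zero_of_mul hne)
        simp only [hmem]
        by_cases h : x * i ∈ half p
        · simp only [h, not_true, if_true, if_false, unitForm, h1, h2, h3, h4]
          linear_combination (-4 * i ^ 4) * hx
        · simp [h]
    _ = _ := by
        rw [prod_mul_distrib, ← hsq, prod_const, hcard]
        ring

/-- A fixed-point-free involution splits a finite set of residues into two halves. -/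
theorem exists_half_of_involution {p : ℕ} [Fact p.Prime] (s : Finset (ZMod p))
    (σ : ZMod p → ZMod p) (hs : ∀ x ∈ s, σ x ∈ s) (hσ : ∀ x ∈ s, σ (σ x) = x)
    (hne : ∀ x ∈ s, σ x ≠ x) :
    ∃ t ⊆ s, 2 * #t = #s ∧ ∀ f : ZMod p → ZMod p, ∏ x ∈ s, f x = ∏ x ∈ t, f x * f (σ x) := by
  have key : ∀ {M : Type} [CommMonoid M] (f : ZMod p → M),
      ∏ x ∈ s, f x = ∏ x ∈ s with x.val < (σ x).val, f x * f (σ x) := by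
    intro M _ f
    rw [← prod_filter_mul_prod_filter_not _ (fun x => x.val < (σ x).val), prod_mul_distrib]
    congr 1
    refine prod_nbij' σ σ ?_ ?_ ?_ ?_ ?_
    · intro x hx
      rw [mem_filter] at hx ⊢
      refine ⟨hs x hx.1, ?_⟩
      rw [hσ x hx.1]
      exact lt_of_le_of_ne (not_lt.1 hx.2) fun h => hne x hx.1 (ZMod.val_injective p h)
    · intro x hx
      rw [mem_filter] at hx ⊢
      refine ⟨hs x hx.1, ?_⟩
      rw [hσ x hx.1]
      exact hx.2.not_gt
    · exact fun x hx => hσ x (mem_filter.1 hx).1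
    · exact fun x hx => hσ x (mem_filter.1 hx).1
    · intro x hx
      rw [hσ x (mem_filter.1 hx).1]
  refine ⟨_, filter_subset _ s, ?_, key⟩
  have h := key (fun _ => 2)
  simp only [prod_const, ← pow_two, ← pow_mul] at h
  exact (Nat.pow_right_injective (le_refl 2) h).symm

theorem two_ne_zero_of_odd {p : ℕ} [Fact p.Prime] (hodd : Odd p) : (2 : ZMod p) ≠ 0 := by
  intro h
  have h2 : ((2 : ℕ) : ZMod p) = 0 := by exact_mod_cast h
  rw [ZMod.natCast_eq_zero_iff, Nat.prime_dvd_prime_iff_eq Fact.out Nat.prime_two] at h2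
  subst h2
  exact absurd hodd (by decide)

theorem prod_form_ne_zero_eq {M : Type*} [CommMonoid M] {p : ℕ} [Fact p.Prime] (hodd : Odd p)
    (h5 : (5 : ZMod p) ≠ 0) {x : ZMod p} (hx : x ^ 2 = -1) (f : ZMod p → M) :
    ∏ y with form y 1 ≠ 0, f y =
      f 0 * (f x * (f (-x) * ∏ y with y ≠ 0 ∧ y ^ 2 ≠ -1 ∧ form y 1 ≠ 0, f y)) := by
  have hx0 : x ≠ 0 := by rintro rfl; simp at hx
  have h2 := two_ne_zero_of_odd hodd
  have hxx : x ≠ -x := fun h => mul_ne_zero h2 hx0 (by linear_combination h)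
  rw [← prod_insert, ← prod_insert, ← prod_insert]
  · refine prod_congr ?_ fun _ _ => rfl
    ext y
    simp only [mem_filter, mem_univ, true_and, mem_insert]
    constructor
    · intro h
      by_cases hy0 : y = 0
      · exact Or.inl hy0
      by_cases hy : y ^ 2 = -1
      · have : (y - x) * (y + x) = 0 := by linear_combination hy - hx
        rcases mul_eq_zero.1 this with h | h
        · exact Or.inr (Or.inl (sub_eq_zero.1 h))
        · exact Or.inr (Or.inr (Or.inl (eq_neg_of_add_eq_zero_left h)))
      · exact Or.inr (Or.inr (Or.inr ⟨hy0, hy, h⟩))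
    · have hprod : form x 1 * form (-x) 1 = 5 := by
        unfold form; linear_combination (x ^ 2 - 4) * hx
      rintro (rfl | rfl | rfl | h)
      · simp [form]
      · exact left_ne_zero_of_mul (hprod ▸ h5)
      · exact right_ne_zero_of_mul (hprod ▸ h5)
      · exact h.2.2
  · simp [hx0.symm, hx0]
  · simp [hxx, hx]
  · simp [hx]

theorem form_neg_inv {p : ℕ} [Fact p.Prime] {x : ZMod p} (hx : x ≠ 0) :
    form (-x⁻¹) 1 = -form x 1 / x ^ 2 := by
  unfold form; field_simp; ring

theorem exists_sqrt_of_mod_four_eq_one {p : ℕ} [Fact p.Prime] (h5 : (5 : ZMod p) ≠ 0)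
    (h4 : p % 4 = 1) {ι : ZMod p} (hι : ι ^ 2 = -1) :
    ∃ (k : ℕ) (w : ZMod p),
      2 * k = #{y : ZMod p | y ≠ 0 ∧ y ^ 2 ≠ -1 ∧ form y 1 ≠ 0} ∧
      w ^ 2 = ∏ y : ZMod p with y ≠ 0 ∧ y ^ 2 ≠ -1 ∧ form y 1 ≠ 0, form y 1 / y ∧
      ∏ x ∈ univ.erase (0 : ZMod p), slopeProd x = -5 ^ (p / 4) * ((-1) ^ k * w ^ (p / 2)) := by
  have hodd : Odd p := Nat.odd_iff.2 (by omega)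
  set s : Finset (ZMod p) := {y : ZMod p | y ≠ 0 ∧ y ^ 2 ≠ -1 ∧ form y 1 ≠ 0} with hs
  have hmem : ∀ {y}, y ∈ s ↔ y ≠ 0 ∧ y ^ 2 ≠ -1 ∧ form y 1 ≠ 0 := by simp [hs]
  obtain ⟨t, hts, hcard, ht⟩ := exists_half_of_involution s (fun y => -y⁻¹)
    (by
      intro y hy
      obtain ⟨h0, h1, h2⟩ := hmem.1 hy
      refine hmem.2 ⟨by simpa using h0, ?_, ?_⟩
      · intro h
        apply h1
        field_simp at h
        linear_combination h
      · rw [form_neg_inv h0]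
        exact div_ne_zero (neg_ne_zero.2 h2) (pow_ne_zero _ h0))
    (by intro y _; simp)
    (by
      intro y hy h
      obtain ⟨h0, h1, h2⟩ := hmem.1 hy
      apply h1
      field_simp at h
      linear_combination -h)
  refine ⟨#t, ∏ y ∈ t, form y 1 / y, hcard, ?_, ?_⟩
  · rw [ht, ← prod_pow]
    refine prod_congr rfl fun y hy => ?_
    have h0 := (hmem.1 (hts hy)).1
    rw [form_neg_inv h0]
    field_simp
  · have h1 : ∏ x ∈ univ.erase (0 : ZMod p), slopeProd x =
        slopeProd ι * (slopeProd (-ι) * ∏ y ∈ s, slopeProd y) := by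
      have h := prod_form_ne_zero_eq hodd h5 hι (fun y : ZMod p => if y = 0 then 1 else slopeProd y)
      have hι0 : ι ≠ 0 := by rintro rfl; simp at hι
      simp only [if_true, one_mul, hι0, neg_eq_zero, if_false] at h
      rw [prod_congr rfl fun y hy => (if_neg (hmem.1 hy).1).symm, ← h, prod_filter,
        ← prod_erase_mul _ _ (mem_univ (0 : ZMod p))]
      rw [if_pos rfl, ite_self, mul_one]
      refine prod_congr rfl fun y hy => ?_
      rw [if_neg (ne_of_mem_erase hy)]
      split_ifs with h
      · rfl
      · exact slopeProd_of_form_eq_zero (not_not.1 h)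
    rw [h1, ← mul_assoc, slopeProd_mul_slopeProd_of_sq_eq_neg_one h5 h4 hι, ht, ← prod_const,
      ← prod_pow, ← prod_mul_distrib]
    congr 1
    refine prod_congr rfl fun y hy => ?_
    obtain ⟨h0, -, h2⟩ := hmem.1 (hts hy)
    rw [slopeProd_mul_slopeProd hodd h0 h2, Even.neg_one_pow (Nat.even_iff.2 (by omega))]
    have hy2 : y ^ (p / 2) * y ^ (p / 2) = 1 := by
      rw [← pow_add, show p / 2 + p / 2 = p - 1 by omega, ZMod.pow_card_sub_one_eq_one h0]
    rw [mul_pow, div_pow, div_eq_mul_inv, ← eq_inv_of_mul_eq_one_left hy2]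
    ring

open Polynomial in
theorem prod_X_sub_C_eq_X_pow_sub_one {F : Type*} [Field F] {n : ℕ} (hn : 0 < n) (s : Finset F)
    (hs : ∀ x ∈ s, x ^ n = 1) (hcard : #s = n) : ∏ x ∈ s, (X - C x) = X ^ n - 1 := by
  have hle : s.val ≤ (X ^ n - 1 : F[X]).roots := by
    rw [Multiset.le_iff_subset s.nodup]
    intro x hx
    rw [← C_1, mem_roots (X_pow_sub_C_ne_zero hn 1)]
    simp [hs x hx]
  have hdeg : (X ^ n - 1 : F[X]).natDegree = n := by rw [← C_1, natDegree_X_pow_sub_C]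
  have heq := Multiset.eq_of_le_of_card_le hle ((card_roots' _).trans (by simp [hdeg, hcard]))
  have h := prod_multiset_X_sub_C_of_monic_of_roots_card_eq (p := (X ^ n - 1 : F[X]))
    (by rw [← C_1]; exact monic_X_pow_sub_C 1 hn.ne') (by simp [← heq, hdeg, hcard])
  rw [← h, ← heq]
  rfl

open Polynomial in
theorem prod_sub_algebraMap_eq_pow_sub_one {F K : Type*} [Field F] [Field K] [Algebra F K] {n : ℕ}
    (hn : 0 < n) (s : Finset F) (hs : ∀ x ∈ s, x ^ n = 1) (hcard : #s = n) (u : K) :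
    ∏ x ∈ s, (u - algebraMap F K x) = u ^ n - 1 := by
  have h := congrArg (aeval u) (prod_X_sub_C_eq_X_pow_sub_one hn s hs hcard)
  simpa [map_prod] using h

/-- The polynomial identity `∏ (X - x) = X ^ p - X` evaluated in an extension. -/
theorem prod_sub_algebraMap {p : ℕ} [Fact p.Prime] {K : Type*} [Field K] [Algebra (ZMod p) K]
    (u : K) : ∏ x : ZMod p, (u - algebraMap (ZMod p) K x) = u ^ p - u := by
  have hp := (Fact.out : p.Prime).two_le
  rw [← prod_erase_mul _ _ (mem_univ (0 : ZMod p)), prod_sub_algebraMap_eq_pow_sub_one (n := p - 1)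
    (by omega) _ (fun x hx => ZMod.pow_card_sub_one_eq_one (ne_of_mem_erase hx))
    (by rw [card_erase_of_mem (mem_univ _), card_univ, ZMod.card]), map_zero, sub_zero, sub_mul,
    ← pow_succ, Nat.sub_add_cancel (by omega), one_mul]

theorem prod_form_of_not_square {p : ℕ} [Fact p.Prime] (hodd : Odd p)
    (h : (5 : ZMod p) ^ (p / 2) = -1) : ∏ x : ZMod p, form x 1 = -5 := by
  obtain ⟨r, hr⟩ := IsAlgClosed.exists_pow_nat_eq (5 : AlgebraicClosure (ZMod p)) (n := 2) two_pos
  have h2 := two_ne_zero_of_odd hodd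
  have h2' : (2 : AlgebraicClosure (ZMod p)) ≠ 0 := by
    rw [← map_ofNat (algebraMap (ZMod p) (AlgebraicClosure (ZMod p))) 2]
    exact (map_ne_zero _).2 h2
  have hrp : r ^ p = -r := by
    have h' := congrArg (algebraMap (ZMod p) (AlgebraicClosure (ZMod p))) h
    simp only [map_pow, map_ofNat, map_neg, map_one] at h'
    obtain ⟨k, hk⟩ := hodd
    calc r ^ p = r ^ (2 * (p / 2) + 1) := by congr 1; omega
      _ = -r := by rw [pow_succ, pow_mul, hr, h', neg_one_mul]
  have := charP_of_injective_algebraMap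
    (algebraMap (ZMod p) (AlgebraicClosure (ZMod p))).injective p
  have h2p : (2 : AlgebraicClosure (ZMod p)) ^ p = 2 := by
    rw [← map_ofNat (algebraMap (ZMod p) (AlgebraicClosure (ZMod p))) 2, ← map_pow, ZMod.pow_card]
  have h3 : ((1 + r) / 2) ^ p = (1 - r) / 2 := by
    rw [div_pow, add_pow_char, hrp, one_pow, h2p, sub_eq_add_neg]
  have h4 : ((1 - r) / 2) ^ p = (1 + r) / 2 := by
    rw [div_pow, sub_pow_char, hrp, one_pow, h2p, sub_neg_eq_add]
  apply (algebraMap (ZMod p) (AlgebraicClosure (ZMod p))).injective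
  rw [map_prod]
  calc _ = ∏ x : ZMod p, (((1 + r) / 2 - algebraMap (ZMod p) (AlgebraicClosure (ZMod p)) x) *
        ((1 - r) / 2 - algebraMap (ZMod p) (AlgebraicClosure (ZMod p)) x)) := by
        refine prod_congr rfl fun x _ => ?_
        simp only [form, map_sub, map_pow, map_mul, map_one]
        field_simp
        linear_combination hr
    _ = _ := by
        rw [prod_mul_distrib, prod_sub_algebraMap, prod_sub_algebraMap, h3, h4]
        simp only [map_neg, map_ofNat]
        field_simp
        linear_combination (-4) * hr

theorem form_ne_zero_of_not_square {p : ℕ} [Fact p.Prime] (hodd : Odd p)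
    (h : (5 : ZMod p) ^ (p / 2) = -1) (x : ZMod p) : form x 1 ≠ 0 := by
  intro hx
  have h2 := two_ne_zero_of_odd hodd
  have h5 : (2 * x - 1) ^ 2 = 5 := by unfold form at hx; linear_combination 4 * hx
  obtain ⟨k, hk⟩ := hodd
  rw [← h5, ← pow_mul, show 2 * (p / 2) = p - 1 by omega] at h
  have h0 : 2 * x - 1 ≠ 0 := by
    intro h0
    rw [h0, zero_pow (by have := (Fact.out : p.Prime).two_le; omega)] at h
    exact one_ne_zero (neg_eq_zero.1 h.symm)
  rw [ZMod.pow_card_sub_one_eq_one h0] at h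
  exact h2 (by linear_combination h)

theorem prod_slopeProd_of_not_square {p : ℕ} [Fact p.Prime] (h5 : (5 : ZMod p) ≠ 0)
    (h4 : p % 4 = 1) (h : (5 : ZMod p) ^ (p / 2) = -1) :
    ∏ x ∈ univ.erase (0 : ZMod p), slopeProd x = (-5) ^ (p / 4) := by
  have hodd : Odd p := Nat.odd_iff.2 (by omega)
  obtain ⟨i, hi'⟩ := (ZMod.exists_sq_eq_neg_one_iff (p := p)).2 (by omega)
  have hi : i ^ 2 = -1 := by rw [pow_two, hi']
  have hall := form_ne_zero_of_not_square hodd h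
  obtain ⟨k, w, hk, hw, hT⟩ := exists_sqrt_of_mod_four_eq_one h5 h4 hi
  have hcard := prod_form_ne_zero_eq hodd h5 hi (fun _ => 2)
  have hform := prod_form_ne_zero_eq hodd h5 hi (fun x => form x 1)
  have hid := prod_form_ne_zero_eq hodd h5 hi (fun x => if x = 0 then 1 else x)
  have hi0 : i ≠ 0 := by rintro rfl; simp at hi
  simp only [prod_const, ← hk, ← pow_succ'] at hcard
  simp only [hall, ne_eq, not_false_eq_true, filter_true, and_true] at hcard hform hid hw
  have hcard' := Nat.pow_right_injective (le_refl 2) hcard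
  rw [card_univ, ZMod.card] at hcard'
  rw [prod_form_of_not_square hodd h] at hform
  have hid' : ∏ x : ZMod p, (if x = 0 then 1 else x) = -1 := by
    rw [← prod_erase_mul _ _ (mem_univ (0 : ZMod p)), if_pos rfl, mul_one, ← prod_erase_zero]
    exact prod_congr rfl fun x hx => if_neg (ne_of_mem_erase hx)
  rw [hid', if_pos trivial, if_neg hi0, if_neg (neg_ne_zero.2 hi0),
    prod_congr rfl fun x hx => if_neg (mem_filter.1 hx).2.1] at hid
  rw [prod_div_distrib] at hw
  set A := ∏ x : ZMod p with ¬x = 0 ∧ ¬x ^ 2 = -1, form x 1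
  set B := ∏ x : ZMod p with ¬x = 0 ∧ ¬x ^ 2 = -1, x
  have hA : A = 1 := by
    apply mul_left_cancel₀ h5
    unfold form at hform
    linear_combination hform - (i ^ 2 - 4) * A * hi
  have hB : B = -1 := by linear_combination -hid + B * hi
  rw [hA, hB] at hw
  rw [hT, show p / 2 = 2 * (p / 4) by omega, pow_mul, hw, Odd.neg_one_pow (Nat.odd_iff.2 (by omega)),
    neg_pow 5]
  norm_num
  ring

theorem prod_filter_form_of_sq_eq_five {p : ℕ} [Fact p.Prime]
    {M : Type*} [CommMonoid M] {a : ZMod p}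
    (ha : form a 1 = 0) (hne : a ≠ 1 - a) (f : ZMod p → M) :
    ∏ x, f x = f a * (f (1 - a) * ∏ x with form x 1 ≠ 0, f x) := by
  rw [← prod_insert, ← prod_insert]
  · refine prod_congr ?_ fun _ _ => rfl
    ext x
    simp only [mem_univ, mem_insert, mem_filter, true_and, true_iff]
    by_cases h : form x 1 = 0
    · have : (x - a) * (x - (1 - a)) = 0 := by
        unfold form at *
        linear_combination h - ha
      rcases mul_eq_zero.1 this with h | h
      · exact Or.inl (sub_eq_zero.1 h)
      · exact Or.inr (Or.inl (sub_eq_zero.1 h))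
    · exact Or.inr (Or.inr h)
  · simp [hne, ha]
  · simp only [mem_filter, mem_univ, true_and, not_not]
    unfold form at *
    linear_combination ha

theorem prod_form_of_sq_eq_five {p : ℕ} [Fact p.Prime]
    {a : ZMod p} (ha : form a 1 = 0) (hne : a ≠ 1 - a) :
    5 * ∏ x : ZMod p with form x 1 ≠ 0, form x 1 = -1 := by
  have hW : ∀ c : ZMod p, ∏ x : ZMod p, (if x = c then 1 else x - c) = -1 := fun c => by
    rw [← prod_erase_zero, ← Equiv.prod_comp (Equiv.addRight c),
      ← prod_erase_mul _ _ (mem_univ (0 : ZMod p))]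
    simp only [Equiv.coe_addRight, zero_add, if_true, mul_one, add_sub_cancel_right, add_eq_right]
    exact prod_congr rfl fun x hx => if_neg (ne_of_mem_erase hx)
  have h1 := hW a
  have h2 := hW (1 - a)
  rw [prod_filter_form_of_sq_eq_five ha hne] at h1 h2
  rw [if_pos rfl, one_mul, if_neg hne.symm] at h1
  rw [if_pos rfl, one_mul, if_neg hne] at h2
  have h3 : ∏ x : ZMod p with form x 1 ≠ 0, form x 1 =
      (∏ x : ZMod p with form x 1 ≠ 0, (if x = a then 1 else x - a)) *
      ∏ x : ZMod p with form x 1 ≠ 0, (if x = 1 - a then 1 else x - (1 - a)) := by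
    rw [← prod_mul_distrib]
    refine prod_congr rfl fun x hx => ?_
    have hx' := (mem_filter.1 hx).2
    have ha' : form (1 - a) 1 = 0 := by unfold form at *; linear_combination ha
    rw [if_neg (by rintro rfl; exact hx' ha), if_neg (by rintro rfl; exact hx' ha')]
    unfold form at *
    linear_combination ha
  rw [h3]
  set A := ∏ x : ZMod p with form x 1 ≠ 0, (if x = a then 1 else x - a)
  set B := ∏ x : ZMod p with form x 1 ≠ 0, (if x = 1 - a then 1 else x - (1 - a))
  unfold form at ha
  linear_combination (-4 * A * B) * ha - (2 * a - 1) * B * h1 + h2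

theorem prod_slopeProd_of_sq_eq_five {p : ℕ} [Fact p.Prime] (h5 : (5 : ZMod p) ≠ 0)
    (h4 : p % 4 = 1) {r : ZMod p} (hr : r ^ 2 = 5) :
    ∏ x ∈ univ.erase (0 : ZMod p), slopeProd x = -5 ^ (p / 4) := by
  have hodd : Odd p := Nat.odd_iff.2 (by omega)
  have h2 := two_ne_zero_of_odd hodd
  have hr0 : r ≠ 0 := by rintro rfl; exact h5 (by rw [← hr]; ring)
  obtain ⟨i, hi'⟩ := (ZMod.exists_sq_eq_neg_one_iff (p := p)).2 (by omega)
  have hi : i ^ 2 = -1 := by rw [pow_two, hi']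
  have hi0 : i ≠ 0 := by rintro rfl; simp at hi
  obtain ⟨a, ha2⟩ : ∃ a : ZMod p, 2 * a = 1 + r := ⟨(1 + r) / 2, by field_simp⟩
  have ha : form a 1 = 0 := by
    apply mul_left_cancel₀ (mul_ne_zero h2 h2)
    unfold form
    linear_combination (2 * a - 1 + r) * ha2 + hr
  have hne : a ≠ 1 - a := fun h => hr0 (by linear_combination h - ha2)
  have ha0 : a ≠ 0 := by rintro rfl; simp [form] at ha
  have ha1 : 1 - a ≠ 0 := by
    intro h
    rw [← sub_eq_zero.1 h] at ha
    simp [form] at ha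
  obtain ⟨k, w, hk, hw, hT⟩ := exists_sqrt_of_mod_four_eq_one h5 h4 hi
  have hcard := prod_filter_form_of_sq_eq_five ha hne (fun _ => 2)
  rw [prod_form_ne_zero_eq hodd h5 hi] at hcard
  simp only [prod_const, ← hk, ← pow_succ'] at hcard
  have hcard' := Nat.pow_right_injective (le_refl 2) hcard
  rw [card_univ, ZMod.card] at hcard'
  have hform := prod_form_of_sq_eq_five ha hne
  rw [prod_form_ne_zero_eq hodd h5 hi] at hform
  have hid := prod_filter_form_of_sq_eq_five ha hne (fun x => if x = 0 then 1 else x)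
  have hid' : ∏ x : ZMod p, (if x = 0 then 1 else x) = -1 := by
    rw [← prod_erase_mul _ _ (mem_univ (0 : ZMod p)), if_pos rfl, mul_one, ← prod_erase_zero]
    exact prod_congr rfl fun x hx => if_neg (ne_of_mem_erase hx)
  rw [prod_form_ne_zero_eq hodd h5 hi, hid', if_pos rfl, if_neg hi0, if_neg (neg_ne_zero.2 hi0),
    if_neg ha0, if_neg ha1, prod_congr rfl fun x hx => if_neg (mem_filter.1 hx).2.1] at hid
  rw [prod_div_distrib] at hw
  set A := ∏ x : ZMod p with x ≠ 0 ∧ x ^ 2 ≠ -1 ∧ form x 1 ≠ 0, form x 1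
  set B := ∏ x : ZMod p with x ≠ 0 ∧ x ^ 2 ≠ -1 ∧ form x 1 ≠ 0, x
  unfold form at ha hform
  have hA : 25 * A = 1 := by linear_combination -hform - 5 * (i ^ 2 - 4) * A * hi
  have hB : B = 1 := by linear_combination hid - a * (1 - a) * B * hi - B * ha
  rw [hB, div_one] at hw
  have h5n : (5 : ZMod p) ^ (p / 2) = 1 := by
    rw [← hr, ← pow_mul, show 2 * (p / 2) = p - 1 by omega, ZMod.pow_card_sub_one_eq_one hr0]
  have hwn : w ^ (p / 2) = 1 := by
    have hpe : p / 2 = 2 * (p / 4) := by omega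
    rw [hpe] at h5n ⊢
    calc w ^ (2 * (p / 4)) = 5 ^ (2 * (p / 4)) * w ^ (2 * (p / 4)) := by rw [h5n, one_mul]
      _ = (5 ^ 2 * A) ^ (p / 4) := by rw [← mul_pow, pow_mul, mul_pow, hw]
      _ = 1 := by rw [show (5 : ZMod p) ^ 2 * A = 1 by linear_combination hA, one_pow]
  rw [hT, hwn, Even.neg_one_pow (Nat.even_iff.2 (by omega)), mul_one, mul_one]

theorem prod_erase_zero_eq_prod_squares {M : Type*} [CommMonoid M] {p : ℕ} [Fact p.Prime]
    (h4 : p % 4 = 3) (f : ZMod p → M) :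
    ∏ x ∈ univ.erase (0 : ZMod p), f x = ∏ x : ZMod p with x ^ (p / 2) = 1, f x * f (-x⁻¹) := by
  have hodd : Odd p := Nat.odd_iff.2 (by omega)
  have hodd2 : Odd (p / 2) := Nat.odd_iff.2 (by omega)
  have h2 := two_ne_zero_of_odd hodd
  have hn : p / 2 ≠ 0 := by omega
  rw [← prod_filter_mul_prod_filter_not _ (fun x : ZMod p => x ^ (p / 2) = 1), prod_mul_distrib]
  congr 1
  · refine prod_congr ?_ fun _ _ => rfl
    ext x
    simp only [mem_filter, mem_erase, mem_univ, and_true, true_and, and_iff_right_iff_imp]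
    rintro h rfl
    simp [hn] at h
  · refine prod_nbij' (fun x => -x⁻¹) (fun x => -x⁻¹) ?_ ?_ (by simp) (by simp) (by simp)
    · intro x hx
      simp only [mem_filter, mem_erase, mem_univ, and_true, true_and] at hx ⊢
      rcases ZMod.pow_div_two_eq_neg_one_or_one p hx.1 with h | h
      · exact absurd h hx.2
      · rw [hodd2.neg_pow, inv_pow, h]
        norm_num
    · intro x hx
      simp only [mem_filter, mem_erase, mem_univ, and_true, true_and] at hx ⊢
      refine ⟨?_, ?_⟩
      · refine neg_ne_zero.2 (inv_ne_zero ?_)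
        rintro rfl
        simp [hn] at hx
      · rw [hodd2.neg_pow, inv_pow, hx, inv_one]
        exact fun h => h2 (by linear_combination -h)

theorem card_squares {p : ℕ} [Fact p.Prime] (h4 : p % 4 = 3) :
    #{x : ZMod p | x ^ (p / 2) = 1} = p / 2 := by
  have h := prod_erase_zero_eq_prod_squares h4 (fun _ => 2)
  simp only [prod_const, ← pow_two, ← pow_mul] at h
  have h' := Nat.pow_right_injective (le_refl 2) h
  rw [card_erase_of_mem (mem_univ _), card_univ, ZMod.card] at h'
  omega

theorem prod_slopeProd_of_mod_four_eq_three {p : ℕ} [Fact p.Prime] (h4 : p % 4 = 3) :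
    ∏ x ∈ univ.erase (0 : ZMod p), slopeProd x =
      (∏ x : ZMod p with x ^ (p / 2) = 1 ∧ form x 1 ≠ 0, form x 1) ^ (p / 2) := by
  have hodd : Odd p := Nat.odd_iff.2 (by omega)
  have hodd2 : Odd (p / 2) := Nat.odd_iff.2 (by omega)
  rw [prod_erase_zero_eq_prod_squares h4, ← filter_filter,
    prod_filter (fun x : ZMod p => form x 1 ≠ 0), ← prod_pow]
  refine prod_congr rfl fun x hx => ?_
  have hx1 : x ^ (p / 2) = 1 := (mem_filter.1 hx).2
  have hx0 : x ≠ 0 := by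
    rintro rfl
    rw [zero_pow (by omega)] at hx1
    exact zero_ne_one hx1
  by_cases h : form x 1 = 0
  · have h' : form (-x⁻¹) 1 = 0 := by rw [form_neg_inv hx0, h]; simp
    rw [slopeProd_of_form_eq_zero h, slopeProd_of_form_eq_zero h']
    simp [h]
  · rw [slopeProd_mul_slopeProd hodd hx0 h, hodd2.neg_one_pow, mul_pow, hx1, if_pos h]
    ring

open Polynomial in
theorem prod_form_mul_eq_one {p : ℕ} [Fact p.Prime] (h4 : p % 4 = 3) {a : ZMod p}
    (ha : form a 1 = 0) (han : a ^ (p / 2) = 1) :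
    (∏ x : ZMod p with x ^ (p / 2) = 1 ∧ form x 1 ≠ 0, form x 1) * (a * (1 - 2 * a)) = 1 := by
  have hodd : Odd p := Nat.odd_iff.2 (by omega)
  have hodd2 : Odd (p / 2) := Nat.odd_iff.2 (by omega)
  have h2 := two_ne_zero_of_odd hodd
  have hb : (1 - a) ^ (p / 2) = -1 := by
    have h : (a * (1 - a)) ^ (p / 2) = -1 := by
      rw [show a * (1 - a) = -1 by unfold form at ha; linear_combination -ha, hodd2.neg_one_pow]
    rwa [mul_pow, han, one_mul] at h
  have hins : (univ.filter fun x : ZMod p => x ^ (p / 2) = 1) =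
      insert a (univ.filter fun x : ZMod p => x ^ (p / 2) = 1 ∧ form x 1 ≠ 0) := by
    ext x
    simp only [mem_filter, mem_univ, true_and, mem_insert]
    constructor
    · intro hx
      by_cases h : form x 1 = 0
      · have : (x - a) * (x - (1 - a)) = 0 := by
          unfold form at *
          linear_combination h - ha
        rcases mul_eq_zero.1 this with h | h
        · exact Or.inl (sub_eq_zero.1 h)
        · rw [sub_eq_zero.1 h, hb] at hx
          exact absurd (by linear_combination -hx) h2
      · exact Or.inr ⟨hx, h⟩
    · rintro (rfl | h)
      · exact han
      · exact h.1
  have hpoly := prod_X_sub_C_eq_X_pow_sub_one (n := p / 2) (by omega)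
    (univ.filter fun x : ZMod p => x ^ (p / 2) = 1) (fun x hx => (mem_filter.1 hx).2)
    (card_squares h4)
  rw [hins, prod_insert (by simp [ha])] at hpoly
  have hderiv := congrArg (fun P => eval a (derivative P)) hpoly
  have hevalb := congrArg (eval (1 - a)) hpoly
  simp only [derivative_mul, derivative_sub, derivative_X, derivative_C, derivative_X_pow,
    derivative_one, eval_add, eval_mul, eval_sub, eval_X, eval_C, eval_pow, eval_prod, eval_one,
    sub_self, zero_mul, add_zero, sub_zero, one_mul, hb] at hderiv hevalb
  have h2n : (2 : ZMod p) * (p / 2 : ℕ) = -1 := by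
    have h : ((2 * (p / 2) + 1 : ℕ) : ZMod p) = 0 := by
      rw [show 2 * (p / 2) + 1 = p by omega, ZMod.natCast_self]
    push_cast at h
    linear_combination h
  have hsplit : ∏ x : ZMod p with x ^ (p / 2) = 1 ∧ form x 1 ≠ 0, form x 1 =
      (∏ x : ZMod p with x ^ (p / 2) = 1 ∧ form x 1 ≠ 0, (a - x)) *
      ∏ x : ZMod p with x ^ (p / 2) = 1 ∧ form x 1 ≠ 0, (1 - a - x) := by
    rw [← prod_mul_distrib]
    refine prod_congr rfl fun x _ => ?_
    unfold form at *
    linear_combination ha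
  have hpow : a ^ (p / 2 - 1) * a = 1 := by
    rw [← pow_succ, Nat.sub_add_cancel (by omega), han]
  rw [hsplit, hderiv]
  linear_combination (↑(p / 2) * a ^ (p / 2 - 1) * a) * hevalb - h2n * a ^ (p / 2 - 1) * a + hpow

theorem prod_slopeProd_of_root {p : ℕ} [Fact p.Prime] (h5 : (5 : ZMod p) ≠ 0) (h4 : p % 4 = 3)
    {ψ : ZMod p} (hψ : ψ ^ 2 + ψ = 1) :
    ∏ x ∈ univ.erase (0 : ZMod p), slopeProd x = ((-1 - 2 * ψ) * ψ) ^ (p / 2) := by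
  have hodd2 : Odd (p / 2) := Nat.odd_iff.2 (by omega)
  have hψ0 : ψ ≠ 0 := by rintro rfl; simp at hψ
  have hr0 : -1 - 2 * ψ ≠ 0 := fun h =>
    h5 (by linear_combination -4 * hψ + (-1 - 2 * ψ) * h)
  have hsq : ((-1 - 2 * ψ) ^ (p / 2)) ^ 2 = 1 := by
    rcases ZMod.pow_div_two_eq_neg_one_or_one p hr0 with h | h <;> rw [h] <;> norm_num
  rw [prod_slopeProd_of_mod_four_eq_three h4, mul_pow]
  set w := ∏ x : ZMod p with x ^ (p / 2) = 1 ∧ form x 1 ≠ 0, form x 1 with hwdef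
  rcases ZMod.pow_div_two_eq_neg_one_or_one p hψ0 with h | h
  · have ha : (1 + ψ) ^ (p / 2) = 1 := by
      have h' : (ψ * (1 + ψ)) ^ (p / 2) = 1 := by
        rw [show ψ * (1 + ψ) = 1 by linear_combination hψ, one_pow]
      rwa [mul_pow, h, one_mul] at h'
    have hw := congrArg (· ^ (p / 2)) (prod_form_mul_eq_one h4 (a := 1 + ψ)
      (by unfold form; linear_combination hψ) ha)
    simp only [← hwdef, mul_pow, ha, one_mul, one_pow, show 1 - 2 * (1 + ψ) = -1 - 2 * ψ by ring] at hw
    rw [h]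
    linear_combination (-1 - 2 * ψ) ^ (p / 2) * hw - w ^ (p / 2) * hsq
  · have ha : (-ψ) ^ (p / 2) = 1 := by rw [hodd2.neg_pow, h, neg_neg]
    have hw := congrArg (· ^ (p / 2)) (prod_form_mul_eq_one h4 (a := -ψ)
      (by unfold form; linear_combination hψ) ha)
    simp only [← hwdef, mul_pow, ha, one_mul, one_pow, show 1 - 2 * -ψ = -(-1 - 2 * ψ) by ring,
      hodd2.neg_pow (-1 - 2 * ψ)] at hw
    rw [h]
    linear_combination -(-1 - 2 * ψ) ^ (p / 2) * hw - w ^ (p / 2) * hsq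

theorem prod_slopeProd_of_not_square_of_mod_four_eq_three {p : ℕ} [Fact p.Prime]
    (h4 : p % 4 = 3) (h : (5 : ZMod p) ^ (p / 2) = -1) {K : Type*} [Field K] [Algebra (ZMod p) K]
    {ψ : K} (hψ : ψ ^ 2 + ψ = 1) {e : ZMod p} (he : e = 1 ∨ e = -1)
    (hpow : ((-1 - 2 * ψ) * ψ) ^ (p / 2) = algebraMap (ZMod p) K e * (-1 - ψ)) :
    ∏ x ∈ univ.erase (0 : ZMod p), slopeProd x = e * (-1) ^ (p / 4) := by
  have hodd : Odd p := Nat.odd_iff.2 (by omega)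
  have hodd2 : Odd (p / 2) := Nat.odd_iff.2 (by omega)
  have hr : (-1 - 2 * ψ) ^ 2 = algebraMap (ZMod p) K 5 := by
    rw [map_ofNat]
    linear_combination 4 * hψ
  have hK : algebraMap (ZMod p) K 5 ^ (p / 2) = -1 := by rw [← map_pow, h, map_neg, map_one]
  have hr0 : -1 - 2 * ψ ≠ 0 := by
    intro h0
    rw [← hr, h0, ← pow_mul, zero_pow (by omega)] at hK
    exact neg_ne_zero.2 one_ne_zero hK.symm
  have heK : algebraMap (ZMod p) K e ^ 2 = 1 := by rcases he with rfl | rfl <;> simp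
  have hall := form_ne_zero_of_not_square hodd h
  rw [prod_slopeProd_of_mod_four_eq_three h4]
  simp only [ne_eq, hall, not_false_eq_true, and_true]
  set w := ∏ x : ZMod p with x ^ (p / 2) = 1, form x 1
  have hw : algebraMap (ZMod p) K w = ψ ^ (p / 2) + (-1 - ψ) ^ (p / 2) := by
    have hprod : ψ ^ (p / 2) * (-1 - ψ) ^ (p / 2) = -1 := by
      rw [← mul_pow, show ψ * (-1 - ψ) = -1 by linear_combination -hψ, hodd2.neg_one_pow]
    have hfac := prod_sub_algebraMap_eq_pow_sub_one (K := K) (n := p / 2) (by omega)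
      (univ.filter fun x : ZMod p => x ^ (p / 2) = 1) (fun x hx => (mem_filter.1 hx).2)
      (card_squares h4)
    calc algebraMap (ZMod p) K w
        = (∏ x : ZMod p with x ^ (p / 2) = 1, (-ψ - algebraMap (ZMod p) K x)) *
          ∏ x : ZMod p with x ^ (p / 2) = 1, (-(-1 - ψ) - algebraMap (ZMod p) K x) := by
          rw [← prod_mul_distrib, map_prod]
          refine prod_congr rfl fun x _ => ?_
          simp only [form, map_sub, map_mul, map_pow, map_one]
          linear_combination hψ
      _ = _ := by
          rw [hfac, hfac, hodd2.neg_pow, hodd2.neg_pow]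
          linear_combination hprod
  have hconj : ((-1 - 2 * ψ) * (-1 - ψ)) ^ (p / 2) = -algebraMap (ZMod p) K e * ψ := by
    have h1 : ((-1 - 2 * ψ) * ψ) ^ (p / 2) * ((-1 - 2 * ψ) * (-1 - ψ)) ^ (p / 2) = 1 := by
      rw [← mul_pow, show (-1 - 2 * ψ) * ψ * ((-1 - 2 * ψ) * (-1 - ψ)) =
        -((-1 - 2 * ψ) ^ 2) by linear_combination -(-1 - 2 * ψ) ^ 2 * hψ, hr, hodd2.neg_pow, hK,
        neg_neg]
    rw [hpow] at h1
    set c := ((-1 - 2 * ψ) * (-1 - ψ)) ^ (p / 2)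
    linear_combination -algebraMap (ZMod p) K e * ψ * h1 - c * ψ * (ψ + 1) * heK - c * hψ
  have h5w : 5 ^ (p / 4) * w = e := by
    apply (algebraMap (ZMod p) K).injective
    apply mul_left_cancel₀ hr0
    rw [map_mul, map_pow, ← hr, ← pow_mul, ← mul_assoc, ← pow_succ',
      show 2 * (p / 4) + 1 = p / 2 by omega, hw, mul_add, ← mul_pow, ← mul_pow, hpow, hconj]
    ring
  have hen : e ^ (p / 2) = e := by
    rcases he with rfl | rfl
    · exact one_pow _
    · exact hodd2.neg_one_pow
  have h1 := congrArg (· ^ (p / 2)) h5w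
  simp only [mul_pow, hen] at h1
  rw [← pow_mul, mul_comm (p / 4), pow_mul, h] at h1
  have h2 : ((-1 : ZMod p) ^ (p / 4)) ^ 2 = 1 := by rw [← pow_mul, mul_comm, pow_mul]; norm_num
  linear_combination (-1) ^ (p / 4) * h1 - w ^ (p / 2) * h2

open Polynomial in
theorem exists_golden_pow {p : ℕ} [Fact p.Prime] (hodd : Odd p) (h5 : (5 : ZMod p) ≠ 0) :
    ∃ ψ : AlgebraicClosure (ZMod p), ψ ^ 2 + ψ = 1 ∧
      (p % 5 = 1 → ψ ^ p = ψ ∧ ((-1 - 2 * ψ) * ψ) ^ (p / 2) = 1) ∧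
      (p % 5 = 2 → ((-1 - 2 * ψ) * ψ) ^ (p / 2) = -1 - ψ) ∧
      (p % 5 = 3 → ((-1 - 2 * ψ) * ψ) ^ (p / 2) = 1 + ψ) ∧
      (p % 5 = 4 → ψ ^ p = ψ ∧ ((-1 - 2 * ψ) * ψ) ^ (p / 2) = -1) := by
  have : Fact (Nat.Prime 5) := ⟨Nat.prime_five⟩
  have : CharP (AlgebraicClosure (ZMod p)) p :=
    charP_of_injective_algebraMap (algebraMap (ZMod p) _).injective p
  obtain ⟨ζ, hζ⟩ := IsAlgClosed.exists_root (cyclotomic 5 (AlgebraicClosure (ZMod p)))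
    (by rw [degree_cyclotomic]; decide)
  rw [IsRoot, cyclotomic_prime] at hζ
  simp only [sum_range_succ, range_zero, sum_empty, eval_add, eval_zero, eval_pow, eval_X] at hζ
  have hζ5 : ζ ^ 5 = 1 := by linear_combination (ζ - 1) * hζ
  have hψ : (ζ + ζ ^ 4) ^ 2 + (ζ + ζ ^ 4) = 1 := by
    linear_combination hζ + (ζ ^ 3 + 2) * hζ5
  have h5K : (5 : AlgebraicClosure (ZMod p)) ≠ 0 := by
    rw [← map_ofNat (algebraMap (ZMod p) (AlgebraicClosure (ZMod p))) 5]
    exact (_root_.map_ne_zero _).2 h5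
  have hr : (ζ - ζ ^ 4) * (ζ ^ 2 - ζ ^ 3) = -1 - 2 * (ζ + ζ ^ 4) := by
    linear_combination hζ + (ζ ^ 2 - ζ) * hζ5
  have hβ : (ζ ^ 2 - ζ ^ 3) ^ 2 = (-1 - 2 * (ζ + ζ ^ 4)) * (ζ + ζ ^ 4) := by
    linear_combination 2 * hψ + (ζ - 2) * hζ5
  have hβα : ζ ^ 2 - ζ ^ 3 = (ζ - ζ ^ 4) * (ζ + ζ ^ 4) := by
    linear_combination ζ ^ 3 * hζ5
  have hne : (ζ - ζ ^ 4) * (ζ ^ 2 - ζ ^ 3) ≠ 0 := by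
    rw [hr]
    exact fun h0 => h5K (by linear_combination -4 * hψ + (-1 - 2 * (ζ + ζ ^ 4)) * h0)
  have hα0 := left_ne_zero_of_mul hne
  have hβ0 := right_ne_zero_of_mul hne
  have hψp : (ζ + ζ ^ 4) ^ p = ζ ^ p + (ζ ^ p) ^ 4 := by
    rw [add_pow_char, ← pow_mul, ← pow_mul, mul_comm 4]
  have hβp : (ζ ^ 2 - ζ ^ 3) * ((-1 - 2 * (ζ + ζ ^ 4)) * (ζ + ζ ^ 4)) ^ (p / 2) =
      (ζ ^ p) ^ 2 - (ζ ^ p) ^ 3 := by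
    have hp : 2 * (p / 2) + 1 = p := by have := Nat.odd_iff.1 hodd; omega
    rw [← hβ, ← pow_mul, ← pow_succ', hp, sub_pow_char, ← pow_mul, ← pow_mul, ← pow_mul,
      ← pow_mul, mul_comm 2, mul_comm 3]
  rw [pow_eq_pow_mod p hζ5] at hψp hβp
  refine ⟨ζ + ζ ^ 4, hψ, fun h => ⟨?_, ?_⟩, fun h => ?_, fun h => ?_, fun h => ⟨?_, ?_⟩⟩
  all_goals rw [h] at hψp hβp
  · rw [hψp]; ring
  · apply mul_left_cancel₀ hβ0
    linear_combination hβp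
  · apply mul_left_cancel₀ hβ0
    linear_combination hβp - ζ * hζ5 - (-1 - (ζ + ζ ^ 4)) * hβα + (ζ - ζ ^ 4) * hψ
  · apply mul_left_cancel₀ hβ0
    linear_combination hβp + (ζ - ζ ^ 4) * hζ5 - (1 + (ζ + ζ ^ 4)) * hβα - (ζ - ζ ^ 4) * hψ
  · rw [hψp]
    linear_combination (ζ ^ 11 + ζ ^ 6 + ζ) * hζ5
  · apply mul_left_cancel₀ hβ0
    linear_combination hβp + (ζ ^ 3 - ζ ^ 7 - ζ ^ 2) * hζ5

theorem exists_algebraMap_eq_of_pow_card_eq_self {p : ℕ} [Fact p.Prime]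
    {K : Type*} [Field K] [Algebra (ZMod p) K]
    {ψ : K} (h : ψ ^ p = ψ) : ∃ x : ZMod p, algebraMap (ZMod p) K x = ψ := by
  have h0 := prod_sub_algebraMap (p := p) ψ
  rw [h, sub_self, prod_eq_zero_iff] at h0
  obtain ⟨x, -, hx⟩ := h0
  exact ⟨x, (sub_eq_zero.1 hx).symm⟩

theorem prod_slopeProd_of_pow_card_eq_self {p : ℕ} [Fact p.Prime]
    (h5 : (5 : ZMod p) ≠ 0) (h4 : p % 4 = 3)
    {K : Type*} [Field K] [Algebra (ZMod p) K] {ψ : K} (hψ : ψ ^ 2 + ψ = 1) (hp : ψ ^ p = ψ)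
    {e : ZMod p} (he : ((-1 - 2 * ψ) * ψ) ^ (p / 2) = algebraMap (ZMod p) K e) :
    ∏ x ∈ univ.erase (0 : ZMod p), slopeProd x = e := by
  obtain ⟨x, rfl⟩ := exists_algebraMap_eq_of_pow_card_eq_self hp
  have hinj := (algebraMap (ZMod p) K).injective
  rw [prod_slopeProd_of_root h5 h4 (ψ := x) (hinj (by simpa using hψ))]
  exact hinj (by simpa [map_ofNat] using he)

theorem five_ne_zero_of_ne {p : ℕ} [Fact p.Prime] (hp5 : p ≠ 5) : (5 : ZMod p) ≠ 0 := by
  intro h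
  have h' : ((5 : ℕ) : ZMod p) = 0 := by exact_mod_cast h
  rw [ZMod.natCast_eq_zero_iff, Nat.prime_dvd_prime_iff_eq Fact.out Nat.prime_five] at h'
  exact hp5 h'

theorem isSquare_five_iff {p : ℕ} [Fact p.Prime] (hodd : Odd p) :
    IsSquare (5 : ZMod p) ↔ IsSquare ((p % 5 : ℕ) : ZMod 5) := by
  have : Fact (Nat.Prime 5) := ⟨Nat.prime_five⟩
  have h := ZMod.exists_sq_eq_prime_iff_of_mod_four_eq_one (p := 5) (q := p) (by norm_num)
    (by rintro rfl; exact absurd hodd (by decide))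
  rw [ZMod.natCast_mod]
  exact_mod_cast h.symm

theorem exists_sq_eq_five {p : ℕ} [Fact p.Prime] (hodd : Odd p) (h : p % 5 = 1 ∨ p % 5 = 4) :
    ∃ r : ZMod p, r ^ 2 = 5 := by
  have hs : IsSquare (5 : ZMod p) := by
    rw [isSquare_five_iff hodd]
    rcases h with h | h <;> rw [h] <;> decide
  obtain ⟨r, hr⟩ := hs
  exact ⟨r, by rw [hr, pow_two]⟩

theorem five_pow_eq_neg_one {p : ℕ} [Fact p.Prime] (hodd : Odd p)
    (h : p % 5 = 2 ∨ p % 5 = 3) : (5 : ZMod p) ^ (p / 2) = -1 := by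
  have h5 : (5 : ZMod p) ≠ 0 := five_ne_zero_of_ne (by rintro rfl; simp at h)
  have hs : ¬ IsSquare (5 : ZMod p) := by
    rw [isSquare_five_iff hodd]
    rcases h with h | h <;> rw [h] <;> decide
  rw [ZMod.euler_criterion p h5] at hs
  exact (ZMod.pow_div_two_eq_neg_one_or_one p h5).resolve_left hs

end GoldenForm

/-- Theorem 1.5(i): let `p` be an odd prime, `p ≠ 5`, and let
`T_p(1,-1,-1) = ∏_{1 ≤ i,j ≤ (p-1)/2, p ∤ i²-ij-j²} (i² - ij - j²)`. Then, modulo `p`,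
`T_p(1,-1,-1)` is `-5^{(p-1)/4}` if `p ≡ 1, 9 (mod 20)`; `(-5)^{(p-1)/4}` if
`p ≡ 13, 17 (mod 20)`; `(-1)^{⌊(p-10)/20⌋}` if `p ≡ 3, 7 (mod 20)`; and
`(-1)^{⌊(p-5)/10⌋}` if `p ≡ 11, 19 (mod 20)`. -/
theorem statement14 (p : ℕ) [Fact p.Prime] (hodd : Odd p) (hp5 : p ≠ 5) :
    (p % 20 = 1 ∨ p % 20 = 9 →
      ((∏ i ∈ Finset.Icc 1 ((p - 1) / 2), ∏ j ∈ Finset.Icc 1 ((p - 1) / 2),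
          if (p : ℤ) ∣ ((i : ℤ) ^ 2 - (i : ℤ) * (j : ℤ) - (j : ℤ) ^ 2) then 1
          else (i : ℤ) ^ 2 - (i : ℤ) * (j : ℤ) - (j : ℤ) ^ 2 : ℤ) : ZMod p)
        = -(5 : ZMod p) ^ ((p - 1) / 4)) ∧
    (p % 20 = 13 ∨ p % 20 = 17 →
      ((∏ i ∈ Finset.Icc 1 ((p - 1) / 2), ∏ j ∈ Finset.Icc 1 ((p - 1) / 2),
          if (p : ℤ) ∣ ((i : ℤ) ^ 2 - (i : ℤ) * (j : ℤ) - (j : ℤ) ^ 2) then 1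
          else (i : ℤ) ^ 2 - (i : ℤ) * (j : ℤ) - (j : ℤ) ^ 2 : ℤ) : ZMod p)
        = (-5 : ZMod p) ^ ((p - 1) / 4)) ∧
    (p % 20 = 3 ∨ p % 20 = 7 →
      ((∏ i ∈ Finset.Icc 1 ((p - 1) / 2), ∏ j ∈ Finset.Icc 1 ((p - 1) / 2),
          if (p : ℤ) ∣ ((i : ℤ) ^ 2 - (i : ℤ) * (j : ℤ) - (j : ℤ) ^ 2) then 1
          else (i : ℤ) ^ 2 - (i : ℤ) * (j : ℤ) - (j : ℤ) ^ 2 : ℤ) : ZMod p)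
        = (-1 : ZMod p) ^ ((((p : ℤ) - 10) / 20 : ℤ))) ∧
    (p % 20 = 11 ∨ p % 20 = 19 →
      ((∏ i ∈ Finset.Icc 1 ((p - 1) / 2), ∏ j ∈ Finset.Icc 1 ((p - 1) / 2),
          if (p : ℤ) ∣ ((i : ℤ) ^ 2 - (i : ℤ) * (j : ℤ) - (j : ℤ) ^ 2) then 1
          else (i : ℤ) ^ 2 - (i : ℤ) * (j : ℤ) - (j : ℤ) ^ 2 : ℤ) : ZMod p)
        = (-1 : ZMod p) ^ ((((p : ℤ) - 5) / 10 : ℤ))) := by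
  have h5 := GoldenForm.five_ne_zero_of_ne hp5
  have hp4 : p % 2 = 1 := Nat.odd_iff.1 hodd
  rw [GoldenForm.cast_prod_eq hodd, show (p - 1) / 4 = p / 4 by omega]
  obtain ⟨ψ, hψ, h1, h2, h3, h4⟩ := GoldenForm.exists_golden_pow hodd h5
  refine ⟨fun h => ?_, fun h => ?_, ?_, ?_⟩
  · obtain ⟨r, hr⟩ := GoldenForm.exists_sq_eq_five hodd (by omega)
    exact GoldenForm.prod_slopeProd_of_sq_eq_five h5 (by omega) hr
  · exact GoldenForm.prod_slopeProd_of_not_square h5 (by omega)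
      (GoldenForm.five_pow_eq_neg_one hodd (by omega))
  · rintro (h | h)
    · rw [GoldenForm.prod_slopeProd_of_not_square_of_mod_four_eq_three (by omega)
        (GoldenForm.five_pow_eq_neg_one hodd (by omega)) hψ (Or.inr rfl)
        (by rw [h3 (by omega), map_neg, map_one]; ring)]
      rcases Nat.even_or_odd (p / 4) with he | he
      · rw [he.neg_one_pow, Odd.neg_one_zpow (by rw [Int.odd_iff]; rw [Nat.even_iff] at he; omega),
          mul_one]
      · rw [he.neg_one_pow, Even.neg_one_zpow (by rw [Int.even_iff]; rw [Nat.odd_iff] at he; omega)]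
        norm_num
    · rw [GoldenForm.prod_slopeProd_of_not_square_of_mod_four_eq_three (by omega)
        (GoldenForm.five_pow_eq_neg_one hodd (by omega)) hψ (Or.inl rfl)
        (by rw [h2 (by omega), map_one, one_mul]), one_mul]
      rcases Nat.even_or_odd (p / 4) with he | he
      · rw [he.neg_one_pow, Even.neg_one_zpow (by rw [Int.even_iff]; rw [Nat.even_iff] at he; omega)]
      · rw [he.neg_one_pow, Odd.neg_one_zpow (by rw [Int.odd_iff]; rw [Nat.odd_iff] at he; omega)]
  · rintro (h | h)
    · obtain ⟨hp, he⟩ := h1 (by omega)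
      rw [GoldenForm.prod_slopeProd_of_pow_card_eq_self h5 (by omega) hψ hp (he.trans (map_one _).symm),
        Even.neg_one_zpow (by rw [Int.even_iff]; omega)]
    · obtain ⟨hp, he⟩ := h4 (by omega)
      rw [GoldenForm.prod_slopeProd_of_pow_card_eq_self (e := -1) h5 (by omega) hψ hp (by simpa using he),
        Odd.neg_one_zpow (by rw [Int.odd_iff]; omega)]
end

section
/- Let p be an odd prime. Then T_p(1, −2, −1) ≡ −2^{(p−1)/4} (mod p) if p ≡ 1 (mod 8); T_p(1, −2, −1) ≡ 2^{(p−1)/4} (mod p) if p ≡ 5 (mod 8); T_p(1, −2, −1) ≡ (−1)^{(p−3)/8} (mod p) if p ≡ 3 (mod 8); and T_p(1, −2, −1) ≡ (−1)^{(p−7)/8} (mod p) if p ≡ 7 (mod 8). -/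
/-- A set of representatives for the nonzero elements of `K` up to sign. -/
structure IsHalfSystem {K : Type*} [Field K] (H : Finset K) : Prop where
  zero_notMem : (0 : K) ∉ H
  mem_iff : ∀ x : K, x ≠ 0 → (x ∈ H ↔ -x ∉ H)

/-- The representative of `x` up to sign in the half system `H`. -/
def signRep {K : Type*} [Field K] [DecidableEq K] (H : Finset K) (x : K) : K :=
  if x ∈ H then x else -x

/-- The value of `i² - 2ij - j²`, with `0` replaced by `1`. -/
def formValue {K : Type*} [Field K] [DecidableEq K] (i j : K) : K :=
  if i ^ 2 - 2 * i * j - j ^ 2 = 0 then 1 else i ^ 2 - 2 * i * j - j ^ 2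

/-- The product of the values of the form over the pairs `(i, j)` in `H` with `i = ± x * j`. -/
def ratioProd {K : Type*} [Field K] [DecidableEq K] (H : Finset K) (x : K) : K :=
  ∏ j ∈ H, formValue (signRep H (x * j)) j

/-- The nonzero `s ≠ -1` such that `s` and `s + 1` are both squares. -/
def squarePairs (K : Type*) [Field K] [Fintype K] [DecidableEq K] : Finset K :=
  {s | s ≠ 0 ∧ s ≠ -1 ∧ IsSquare s ∧ IsSquare (s + 1)}

theorem Finset.prod_of_involution {ι M : Type*} [DecidableEq ι] [CommMonoid M] (S : Finset ι)
    (σ : ι → ι) (f : ι → M) (c : M) (hmem : ∀ x ∈ S, σ x ∈ S) (hinv : ∀ x ∈ S, σ (σ x) = x)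
    (hne : ∀ x ∈ S, σ x ≠ x) (hf : ∀ x ∈ S, f x * f (σ x) = c) :
    ∏ x ∈ S, f x = c ^ (S.card / 2) := by
  induction S using Finset.strongInduction with
  | H S ih =>
    rcases S.eq_empty_or_nonempty with rfl | ⟨x, hx⟩
    · simp
    · have hσ : σ x ∈ S.erase x := Finset.mem_erase.2 ⟨hne x hx, hmem x hx⟩
      have hsub : (S.erase x).erase (σ x) ⊂ S :=
        (Finset.erase_ssubset hσ).trans (Finset.erase_ssubset hx)
      have key := ih _ hsub
        (fun y hy => by
          simp only [Finset.mem_erase] at hy ⊢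
          refine ⟨fun h => hy.2.1 ?_, fun h => hy.1 ?_, hmem y hy.2.2⟩
          · rw [← hinv y hy.2.2, h, hinv x hx]
          · rw [← hinv y hy.2.2, h])
        (fun y hy => hinv y (Finset.mem_of_mem_erase (Finset.mem_of_mem_erase hy)))
        (fun y hy => hne y (Finset.mem_of_mem_erase (Finset.mem_of_mem_erase hy)))
        (fun y hy => hf y (Finset.mem_of_mem_erase (Finset.mem_of_mem_erase hy)))
      rw [← Finset.mul_prod_erase S f hx, ← Finset.mul_prod_erase _ f hσ, key, ← mul_assoc,
        hf x hx, ← pow_succ']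
      have h1 := Finset.card_erase_add_one hx
      have h2 := Finset.card_erase_add_one hσ
      congr 1
      omega

theorem formValue_mul_swap {K : Type*} [Field K] [DecidableEq K] {i j s : K} (hi : i ≠ 0)
    (hj : j ≠ 0) (h2 : (2 : K) ≠ 0) (h : (i ^ 2 - j ^ 2) ^ 2 = 4 * s * (i * j) ^ 2) (hs : s ≠ 1) :
    formValue i j * formValue j i = -4 * (i * j) ^ 2 * (s - 1) := by
  have key : (i ^ 2 - 2 * i * j - j ^ 2) * (j ^ 2 - 2 * j * i - i ^ 2) =
      -4 * (i * j) ^ 2 * (s - 1) := by linear_combination -h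
  have hne : (i ^ 2 - 2 * i * j - j ^ 2) * (j ^ 2 - 2 * j * i - i ^ 2) ≠ 0 := by
    rw [key]
    have h4 : (-4 : K) ≠ 0 := by
      rw [show (-4 : K) = -(2 * 2) by norm_num]
      exact neg_ne_zero.2 (mul_ne_zero h2 h2)
    exact mul_ne_zero (mul_ne_zero h4 (pow_ne_zero _ (mul_ne_zero hi hj))) (sub_ne_zero.2 hs)
  rw [formValue, formValue, if_neg (left_ne_zero_of_mul hne), if_neg (right_ne_zero_of_mul hne),
    key]

theorem formValue_mul_swap_of_isotropic {K : Type*} [Field K] [DecidableEq K] {i j : K}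
    (hi : i ≠ 0) (hj : j ≠ 0) (h2 : (2 : K) ≠ 0) (h : (i ^ 2 - j ^ 2) ^ 2 = 4 * (i * j) ^ 2) :
    formValue i j * formValue j i = -4 * (i * j) := by
  have h4 : -4 * (i * j) ≠ 0 := by
    rw [show -4 * (i * j) = -(2 * 2 * (i * j)) by ring]
    exact neg_ne_zero.2 (mul_ne_zero (mul_ne_zero h2 h2) (mul_ne_zero hi hj))
  have key : (i ^ 2 - 2 * i * j - j ^ 2) * (j ^ 2 - 2 * j * i - i ^ 2) = 0 := by
    linear_combination -h
  rcases mul_eq_zero.1 key with h0 | h0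
  · have h' : j ^ 2 - 2 * j * i - i ^ 2 = -4 * (i * j) := by linear_combination -h0
    rw [formValue, formValue, if_pos h0, h', if_neg h4, one_mul]
  · have h' : i ^ 2 - 2 * i * j - j ^ 2 = -4 * (i * j) := by linear_combination -h0
    rw [formValue, formValue, if_pos h0, h', if_neg h4, mul_one]

namespace IsHalfSystem

variable {K : Type*} [Field K] {H : Finset K}

theorem ne_zero (hH : IsHalfSystem H) {x : K} (hx : x ∈ H) : x ≠ 0 :=
  fun h => hH.zero_notMem (h ▸ hx)

theorem two_ne_zero (hH : IsHalfSystem H) : (2 : K) ≠ 0 := by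
  intro h
  have h1 := hH.mem_iff 1 one_ne_zero
  rw [show (-1 : K) = 1 by linear_combination -h] at h1
  tauto

variable [DecidableEq K]

theorem signRep_eq_or (x : K) : signRep H x = x ∨ signRep H x = -x := by
  unfold signRep
  split_ifs <;> simp

theorem signRep_sq (x : K) : signRep H x ^ 2 = x ^ 2 := by
  rcases signRep_eq_or (H := H) x with h | h <;> rw [h]
  ring

theorem signRep_mem (hH : IsHalfSystem H) {x : K} (hx : x ≠ 0) : signRep H x ∈ H := by
  unfold signRep
  split_ifs with h
  · exact h
  · by_contra h'
    exact h ((hH.mem_iff x hx).2 h')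

theorem signRep_of_mem {x : K} (hx : x ∈ H) : signRep H x = x := if_pos hx

theorem signRep_neg (hH : IsHalfSystem H) {x : K} (hx : x ≠ 0) :
    signRep H (-x) = signRep H x := by
  have := hH.mem_iff x hx
  unfold signRep
  split_ifs <;> simp_all

theorem signRep_mul_signRep (hH : IsHalfSystem H) {a x : K} (ha : a ≠ 0) (hx : x ≠ 0) :
    signRep H (a * signRep H x) = signRep H (a * x) := by
  rcases signRep_eq_or (H := H) x with h | h <;> rw [h]
  rw [mul_neg, hH.signRep_neg (mul_ne_zero ha hx)]

theorem signRep_inv_mul_signRep (hH : IsHalfSystem H) {a x : K} (ha : a ≠ 0) (hx : x ∈ H) :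
    signRep H (a⁻¹ * signRep H (a * x)) = x := by
  rw [hH.signRep_mul_signRep (inv_ne_zero ha) (mul_ne_zero ha (hH.ne_zero hx)),
    inv_mul_cancel_left₀ ha, signRep_of_mem hx]

theorem signRep_mul_signRep_inv (hH : IsHalfSystem H) {a x : K} (ha : a ≠ 0) (hx : x ∈ H) :
    signRep H (a * signRep H (a⁻¹ * x)) = x := by
  simpa using hH.signRep_inv_mul_signRep (inv_ne_zero ha) hx

theorem eq_signRep_iff (hH : IsHalfSystem H) {x a : K} (ha : a ≠ 0) (hx : x ∈ H) :
    x = signRep H a ↔ x = a ∨ x = -a := by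
  constructor
  · rintro rfl
    exact signRep_eq_or a
  · rintro (rfl | rfl)
    · exact (signRep_of_mem hx).symm
    · rw [← hH.signRep_neg ha, signRep_of_mem hx]

theorem filter_sq_eq (hH : IsHalfSystem H) {a b : K} (ha : a ≠ 0) (hb : a ^ 2 = b) :
    {x ∈ H | x ^ 2 = b} = {signRep H a} := by
  ext x
  simp only [Finset.mem_filter, Finset.mem_singleton]
  constructor
  · rintro ⟨hx, h⟩
    exact (hH.eq_signRep_iff ha hx).2 (sq_eq_sq_iff_eq_or_eq_neg.1 (h.trans hb.symm))
  · rintro rfl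
    exact ⟨hH.signRep_mem ha, (signRep_sq a).trans hb⟩

theorem prod_signRep_mul {M : Type*} [CommMonoid M] (hH : IsHalfSystem H) {a : K} (ha : a ≠ 0)
    (g : K → M) : ∏ j ∈ H, g (signRep H (a * j)) = ∏ j ∈ H, g j :=
  Finset.prod_nbij' (fun j => signRep H (a * j)) (fun j => signRep H (a⁻¹ * j))
    (fun _ hj => hH.signRep_mem (mul_ne_zero ha (hH.ne_zero hj)))
    (fun _ hj => hH.signRep_mem (mul_ne_zero (inv_ne_zero ha) (hH.ne_zero hj)))
    (fun _ hj => hH.signRep_inv_mul_signRep ha hj)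
    (fun _ hj => hH.signRep_mul_signRep_inv ha hj) (fun _ _ => rfl)

theorem prod_formValue_eq_prod_ratioProd (hH : IsHalfSystem H) :
    ∏ i ∈ H, ∏ j ∈ H, formValue i j = ∏ x ∈ H, ratioProd H x := by
  unfold ratioProd
  rw [Finset.prod_comm, Finset.prod_comm (s := H) (t := H)
    (f := fun x j => formValue (signRep H (x * j)) j)]
  refine Finset.prod_congr rfl fun j hj => ?_
  simp_rw [mul_comm _ j]
  exact (hH.prod_signRep_mul (hH.ne_zero hj) fun i => formValue i j).symm

theorem ratioProd_signRep (hH : IsHalfSystem H) {x : K} (hx : x ≠ 0) :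
    ratioProd H (signRep H x) = ratioProd H x := by
  rcases signRep_eq_or (H := H) x with h | h <;> rw [h]
  refine Finset.prod_congr rfl fun j hj => ?_
  rw [neg_mul, hH.signRep_neg (mul_ne_zero hx (hH.ne_zero hj))]

theorem ratioProd_mul_ratioProd_inv (hH : IsHalfSystem H) {x : K} (hx : x ≠ 0) :
    ratioProd H x * ratioProd H x⁻¹ =
      ∏ j ∈ H, formValue (signRep H (x * j)) j * formValue j (signRep H (x * j)) := by
  rw [Finset.prod_mul_distrib]
  congr 1
  unfold ratioProd
  rw [← hH.prod_signRep_mul hx fun j => formValue (signRep H (x⁻¹ * j)) j]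
  refine Finset.prod_congr rfl fun j hj => ?_
  rw [hH.signRep_inv_mul_signRep hx hj]

theorem fiber_eq (hH : IsHalfSystem H) {x s : K} (hx : x ∈ H)
    (h : (x ^ 2 - 1) ^ 2 = 4 * s * x ^ 2) :
    {y ∈ H | ((y ^ 2 - 1) / (2 * y)) ^ 2 = s} = {x, signRep H x⁻¹} := by
  have h2 := hH.two_ne_zero
  have hx0 := hH.ne_zero hx
  have hiff (y : K) (hy0 : y ≠ 0) :
      ((y ^ 2 - 1) / (2 * y)) ^ 2 = s ↔ (y ^ 2 - 1) ^ 2 = 4 * s * y ^ 2 := by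
    rw [div_pow, div_eq_iff (pow_ne_zero _ (mul_ne_zero h2 hy0))]
    constructor <;> intro h <;> linear_combination h
  ext y
  simp only [Finset.mem_filter, Finset.mem_insert, Finset.mem_singleton]
  constructor
  · rintro ⟨hy, hys⟩
    rw [hiff y (hH.ne_zero hy)] at hys
    have hprod : ((y - x) * (y + x)) * ((x * y + 1) * (x * y - 1)) = 0 := by
      linear_combination x ^ 2 * hys - y ^ 2 * h
    rw [hH.eq_signRep_iff (inv_ne_zero hx0) hy]
    rcases mul_eq_zero.1 hprod with h' | h' <;> rcases mul_eq_zero.1 h' with h' | h'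
    · exact .inl (sub_eq_zero.1 h')
    · have := hH.mem_iff x hx0
      rw [← eq_neg_of_add_eq_zero_left h'] at this
      tauto
    · refine .inr (.inr ?_)
      field_simp
      linear_combination h'
    · refine .inr (.inl ?_)
      field_simp
      linear_combination h'
  · rintro (rfl | rfl)
    · exact ⟨hx, (hiff y hx0).2 h⟩
    · have hm := hH.signRep_mem (inv_ne_zero hx0)
      refine ⟨hm, (hiff _ (hH.ne_zero hm)).2 ?_⟩
      rw [signRep_sq]
      field_simp
      linear_combination h

variable [Fintype K]

theorem univ_erase_zero (hH : IsHalfSystem H) :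
    Finset.univ.erase (0 : K) = H.disjUnion (H.map (Equiv.neg K).toEmbedding) (by
      rw [Finset.disjoint_left]
      intro x hx hx'
      simp only [Finset.mem_map_equiv, Equiv.neg_symm, Equiv.neg_apply] at hx'
      exact (hH.mem_iff x (hH.ne_zero hx)).1 hx hx') := by
  ext x
  simp only [Finset.mem_erase, Finset.mem_univ, and_true, Finset.mem_disjUnion,
    Finset.mem_map_equiv, Equiv.neg_symm, Equiv.neg_apply]
  constructor
  · intro hx
    have := hH.mem_iff x hx
    tauto
  · rintro (h | h)
    · exact hH.ne_zero h
    · exact neg_ne_zero.1 (hH.ne_zero h)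

theorem card_eq (hH : IsHalfSystem H) : Fintype.card K = 2 * H.card + 1 := by
  rw [← Finset.card_univ, ← Finset.card_erase_add_one (Finset.mem_univ (0 : K)),
    hH.univ_erase_zero, Finset.card_disjUnion, Finset.card_map]
  ring

theorem prod_sq (hH : IsHalfSystem H) : ∏ x ∈ H, x ^ 2 = (-1 : K) ^ (H.card + 1) := by
  have h1 : ∏ x ∈ Finset.univ.erase (0 : K), x = -1 := by
    have h := congrArg (Units.coeHom K) (FiniteField.prod_univ_units_id_eq_neg_one (K := K))
    rw [map_prod] at h
    rw [← Units.coe_neg_one]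
    refine Eq.trans (Eq.symm ?_) h
    exact Finset.prod_bij (fun u _ => (u : K)) (fun u _ => by simp) (fun _ _ _ _ h => Units.ext h)
      (fun x hx => ⟨Units.mk0 x (Finset.ne_of_mem_erase hx), Finset.mem_univ _, rfl⟩)
      (fun _ _ => rfl)
  rw [hH.univ_erase_zero, Finset.prod_disjUnion, Finset.prod_map] at h1
  simp only [Equiv.coe_toEmbedding, Equiv.neg_apply] at h1
  rw [Finset.prod_neg] at h1
  rw [Finset.prod_pow]
  have h2 : ((-1 : K) ^ H.card) * (-1) ^ H.card = 1 := by rw [← mul_pow]; simp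
  linear_combination (-1 : K) ^ H.card * h1 - (∏ x ∈ H, x) ^ 2 * h2

theorem pow_card_mul_two (hH : IsHalfSystem H) {a : K} (ha : a ≠ 0) : a ^ (2 * H.card) = 1 := by
  have := FiniteField.pow_card_sub_one_eq_one a ha
  rwa [hH.card_eq, Nat.add_sub_cancel] at this

theorem isSquare_iff_pow_card (hH : IsHalfSystem H) {a : K} (ha : a ≠ 0) :
    IsSquare a ↔ a ^ H.card = 1 := by
  have hc : ringChar K ≠ 2 := by
    intro h
    have := ringChar.Nat.cast_ringChar (R := K)
    rw [h] at this
    exact hH.two_ne_zero (by exact_mod_cast this)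
  rw [FiniteField.isSquare_iff hc ha, hH.card_eq]
  congr! 2
  omega

theorem neg_four_pow_card (hH : IsHalfSystem H) : (-4 : K) ^ H.card = (-1) ^ H.card := by
  rw [show (-4 : K) = -1 * 2 ^ 2 by norm_num, mul_pow, ← pow_mul,
    hH.pow_card_mul_two hH.two_ne_zero, mul_one]

theorem ratioProd_one (hH : IsHalfSystem H) : ratioProd H 1 = -2 ^ H.card := by
  have : ratioProd H 1 = ∏ j ∈ H, -2 * j ^ 2 := by
    refine Finset.prod_congr rfl fun j hj => ?_
    have h : j ^ 2 - 2 * j * j - j ^ 2 = -2 * j ^ 2 := by ring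
    have h0 : -2 * j ^ 2 ≠ 0 :=
      mul_ne_zero (neg_ne_zero.2 hH.two_ne_zero) (pow_ne_zero _ (hH.ne_zero hj))
    rw [one_mul, signRep_of_mem hj, formValue, h, if_neg h0]
  rw [this, Finset.prod_mul_distrib, hH.prod_sq, Finset.prod_const,
    show (-2 : K) = -1 * 2 by norm_num, mul_pow, pow_succ]
  have h2 : ((-1 : K) ^ H.card) * (-1) ^ H.card = 1 := by rw [← mul_pow]; simp
  linear_combination -2 ^ H.card * h2

theorem ratioProd_of_sq_eq_neg_one (hH : IsHalfSystem H) {x : K} (hx : x ^ 2 = -1) :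
    ratioProd H x = (-1) ^ (H.card + 1) * 8 ^ (H.card / 2) := by
  have hx0 : x ≠ 0 := by
    rintro rfl
    simp at hx
  have h2 := hH.two_ne_zero
  have hσ0 (j) (hj : j ∈ H) : signRep H (x * j) ∈ H :=
    hH.signRep_mem (mul_ne_zero hx0 (hH.ne_zero hj))
  have hσ2 (j : K) : signRep H (x * j) ^ 2 = -j ^ 2 := by
    rw [signRep_sq, mul_pow, hx, neg_one_mul]
  have hinv (j) (hj : j ∈ H) : signRep H (x * signRep H (x * j)) = j := by
    rw [hH.signRep_mul_signRep hx0 (mul_ne_zero hx0 (hH.ne_zero hj)), ← mul_assoc, ← sq, hx,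
      neg_one_mul, hH.signRep_neg (hH.ne_zero hj), signRep_of_mem hj]
  have key := Finset.prod_of_involution H (fun j => signRep H (x * j))
    (fun j => formValue (signRep H (x * j)) j / j ^ 2) 8 hσ0 hinv
    (fun j hj h => by
      have h' := hσ2 j
      rw [h] at h'
      exact mul_ne_zero h2 (pow_ne_zero 2 (hH.ne_zero hj)) (by linear_combination h'))
    (fun j hj => by
      have hj0 := hH.ne_zero hj
      have hi0 := hH.ne_zero (hσ0 j hj)
      have hs : (-1 : K) ≠ 1 := fun h => h2 (by linear_combination -h)
      have := formValue_mul_swap (s := -1) hi0 hj0 h2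
        (by rw [mul_pow, hσ2]; ring) hs
      simp only [hinv j hj]
      rw [div_mul_div_comm, this]
      field_simp
      norm_num)
  rw [Finset.prod_div_distrib, hH.prod_sq, div_eq_iff (by simp)] at key
  rw [ratioProd, key, mul_comm]

theorem ratioProd_mul_ratioProd_inv_of_ne_one (hH : IsHalfSystem H) {x s : K} (hx : x ≠ 0)
    (h : (x ^ 2 - 1) ^ 2 = 4 * s * x ^ 2) (hs : s ≠ 1) :
    ratioProd H x * ratioProd H x⁻¹ = (-(s - 1)) ^ H.card := by
  have hj (j) (hj : j ∈ H) :
      formValue (signRep H (x * j)) j * formValue j (signRep H (x * j)) =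
        4 * x ^ 2 * -(s - 1) * (j ^ 2) ^ 2 := by
    have hj0 := hH.ne_zero hj
    rw [formValue_mul_swap (hH.ne_zero (hH.signRep_mem (mul_ne_zero hx hj0))) hj0 hH.two_ne_zero
      (by rw [mul_pow, signRep_sq]; linear_combination j ^ 4 * h) hs, mul_pow, signRep_sq]
    ring
  rw [hH.ratioProd_mul_ratioProd_inv hx, Finset.prod_congr rfl hj, Finset.prod_mul_distrib,
    Finset.prod_const, Finset.prod_pow, hH.prod_sq, mul_pow,
    show (4 : K) * x ^ 2 = (2 * x) ^ 2 by ring, ← pow_mul,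
    hH.pow_card_mul_two (mul_ne_zero hH.two_ne_zero hx), ← pow_mul, mul_comm _ 2, pow_mul (-1 : K)]
  simp

theorem ratioProd_mul_ratioProd_inv_of_isotropic (hH : IsHalfSystem H) {x : K} (hx : x ≠ 0)
    (h : (x ^ 2 - 1) ^ 2 = 4 * x ^ 2) : ratioProd H x * ratioProd H x⁻¹ = -1 := by
  have hj (j) (hj : j ∈ H) :
      formValue (signRep H (x * j)) j * formValue j (signRep H (x * j)) =
        -4 * (signRep H (x * j) * j) := by
    have hj0 := hH.ne_zero hj
    exact formValue_mul_swap_of_isotropic (hH.ne_zero (hH.signRep_mem (mul_ne_zero hx hj0))) hj0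
      hH.two_ne_zero (by rw [mul_pow, signRep_sq]; linear_combination j ^ 4 * h)
  rw [hH.ratioProd_mul_ratioProd_inv hx, Finset.prod_congr rfl hj, Finset.prod_mul_distrib,
    Finset.prod_const, Finset.prod_mul_distrib, hH.prod_signRep_mul hx fun j => j,
    ← Finset.prod_mul_distrib, hH.neg_four_pow_card]
  simp_rw [← sq]
  rw [hH.prod_sq, ← pow_add, ← add_assoc, pow_succ, ← two_mul, pow_mul]
  simp

theorem exists_fiber_eq (hH : IsHalfSystem H) {s : K} (hs : s ∈ squarePairs K) :
    ∃ x ∈ H, (x ^ 2 - 1) ^ 2 = 4 * s * x ^ 2 ∧ x ≠ signRep H x⁻¹ ∧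
      {y ∈ {y ∈ H | y ^ 2 ≠ 1 ∧ y ^ 2 ≠ -1} | ((y ^ 2 - 1) / (2 * y)) ^ 2 = s} =
        {x, signRep H x⁻¹} := by
  obtain ⟨hs0, hs1, ⟨a, ha⟩, ⟨b, hb⟩⟩ : s ≠ 0 ∧ s ≠ -1 ∧ IsSquare s ∧ IsSquare (s + 1) := by
    simpa [squarePairs] using hs
  have h2 := hH.two_ne_zero
  have h4 : (4 : K) ≠ 0 := by
    rw [show (4 : K) = 2 * 2 by norm_num]
    exact mul_ne_zero h2 h2
  have hab : (a + b) * (b - a) = 1 := by linear_combination ha - hb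
  have hab0 : a + b ≠ 0 := left_ne_zero_of_mul_eq_one hab
  have hmem := hH.signRep_mem hab0
  have heq : (signRep H (a + b) ^ 2 - 1) ^ 2 = 4 * s * signRep H (a + b) ^ 2 := by
    rw [signRep_sq, ha]
    linear_combination ((a + b) ^ 2 - 1 + 2 * a * (a + b)) * hab
  generalize signRep H (a + b) = x at hmem heq
  have hx0 := hH.ne_zero hmem
  have hne (y : K) (hy : (y ^ 2 - 1) ^ 2 = 4 * s * y ^ 2) : y ^ 2 ≠ 1 ∧ y ^ 2 ≠ -1 := by
    constructor <;> intro h <;> rw [h] at hy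
    · exact mul_ne_zero h4 hs0 (by linear_combination -hy)
    · exact mul_ne_zero h4 (sub_ne_zero.2 hs1) (by linear_combination hy)
  refine ⟨x, hmem, heq, fun h => ?_, ?_⟩
  · rw [hH.eq_signRep_iff (inv_ne_zero hx0) hmem] at h
    rcases h with h | h
    · exact (hne x heq).1 (by rw [sq]; nth_rw 2 [h]; exact mul_inv_cancel₀ hx0)
    · exact (hne x heq).2 (by rw [sq]; nth_rw 2 [h]; rw [mul_neg, mul_inv_cancel₀ hx0])
  · rw [← hH.fiber_eq hmem heq, Finset.filter_filter]
    refine Finset.filter_congr fun y hy => ⟨fun h => h.2, fun h => ⟨hne y ?_, h⟩⟩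
    rw [div_pow, div_eq_iff (pow_ne_zero _ (mul_ne_zero h2 (hH.ne_zero hy)))] at h
    linear_combination h

theorem mapsTo_squarePairs (hH : IsHalfSystem H) {x : K}
    (hx : x ∈ ({y ∈ H | y ^ 2 ≠ 1 ∧ y ^ 2 ≠ -1} : Finset K)) :
    ((x ^ 2 - 1) / (2 * x)) ^ 2 ∈ squarePairs K := by
  obtain ⟨hx, h1, h1'⟩ := Finset.mem_filter.1 hx
  have h2 := hH.two_ne_zero
  have hx0 := hH.ne_zero hx
  have hadd : ((x ^ 2 - 1) / (2 * x)) ^ 2 + 1 = ((x ^ 2 + 1) / (2 * x)) ^ 2 := by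
    field_simp
    ring
  simp only [squarePairs, Finset.mem_filter, Finset.mem_univ, true_and]
  refine ⟨?_, fun h => ?_, IsSquare.sq _, hadd ▸ IsSquare.sq _⟩
  · exact pow_ne_zero _ (div_ne_zero (sub_ne_zero.2 h1) (mul_ne_zero h2 hx0))
  · rw [← add_eq_zero_iff_eq_neg, hadd] at h
    refine pow_ne_zero 2 (div_ne_zero (fun h => h1' ?_) (mul_ne_zero h2 hx0)) h
    exact eq_neg_of_add_eq_zero_left h

theorem card_filter_eq (hH : IsHalfSystem H) :
    ({y ∈ H | y ^ 2 ≠ 1 ∧ y ^ 2 ≠ -1} : Finset K).card = 2 * (squarePairs K).card := by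
  rw [Finset.card_eq_sum_card_fiberwise (f := fun y => ((y ^ 2 - 1) / (2 * y)) ^ 2)
    (t := squarePairs K) fun x hx => hH.mapsTo_squarePairs hx, mul_comm, ← smul_eq_mul]
  refine Finset.sum_const_nat fun s hs => ?_
  obtain ⟨x, -, -, hne, hfib⟩ := hH.exists_fiber_eq hs
  rw [hfib, Finset.card_pair hne]

theorem prod_filter_ratioProd (hH : IsHalfSystem H) :
    ∏ x ∈ H with x ^ 2 ≠ 1 ∧ x ^ 2 ≠ -1, ratioProd H x =
      ∏ s ∈ squarePairs K, if s = 1 then -1 else (-(s - 1)) ^ H.card := by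
  rw [← Finset.prod_fiberwise_of_maps_to (g := fun y => ((y ^ 2 - 1) / (2 * y)) ^ 2)
    (t := squarePairs K) fun x hx => hH.mapsTo_squarePairs hx]
  refine Finset.prod_congr rfl fun s hs => ?_
  obtain ⟨x, hx, heq, hne, hfib⟩ := hH.exists_fiber_eq hs
  have hx0 := hH.ne_zero hx
  rw [hfib, Finset.prod_pair hne, hH.ratioProd_signRep (inv_ne_zero hx0)]
  split_ifs with h
  · exact hH.ratioProd_mul_ratioProd_inv_of_isotropic hx0 (by rw [heq, h, mul_one])
  · exact hH.ratioProd_mul_ratioProd_inv_of_ne_one hx0 heq h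

theorem one_mem_squarePairs (hH : IsHalfSystem H) :
    (1 : K) ∈ squarePairs K ↔ (2 : K) ^ H.card = 1 := by
  have h2 := hH.two_ne_zero
  rw [← hH.isSquare_iff_pow_card h2]
  simp only [squarePairs, Finset.mem_filter, Finset.mem_univ, true_and]
  rw [one_add_one_eq_two]
  have : (1 : K) ≠ -1 := fun h => h2 (by linear_combination h)
  simp [this]

theorem inv_mem_squarePairs_erase_one {s : K} (hs : s ∈ (squarePairs K).erase 1) :
    s⁻¹ ∈ (squarePairs K).erase 1 ∧ s⁻¹ ≠ s := by
  simp only [squarePairs, Finset.mem_erase, Finset.mem_filter, Finset.mem_univ, true_and] at hs ⊢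
  obtain ⟨hs1, hs0, hs1', hsq, hsq'⟩ := hs
  have hs : s⁻¹ + 1 = s⁻¹ * (s + 1) := by rw [mul_add, inv_mul_cancel₀ hs0, mul_one, add_comm]
  refine ⟨⟨by simpa using hs1, inv_ne_zero hs0, fun h => hs1' ?_, hsq.inv,
    hs ▸ hsq.inv.mul hsq'⟩, fun h => ?_⟩
  · rw [← inv_inv s, h]
    norm_num
  · have := mul_inv_cancel₀ hs0
    rw [h] at this
    rcases mul_self_eq_one_iff.1 this with h | h
    · exact hs1 h
    · exact hs1' h

theorem even_card_squarePairs_erase_one : Even ((squarePairs K).erase 1).card := by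
  have h := Finset.prod_of_involution ((squarePairs K).erase 1) (fun s => s⁻¹)
    (fun _ => (-1 : ℤ)) 1 (fun s hs => (inv_mem_squarePairs_erase_one hs).1)
    (fun s _ => inv_inv s) (fun s hs => (inv_mem_squarePairs_erase_one hs).2)
    (fun _ _ => by norm_num)
  rw [Finset.prod_const, one_pow] at h
  exact (neg_one_pow_eq_one_iff_even (by norm_num)).1 h

theorem prod_squarePairs_erase_one (hH : IsHalfSystem H) :
    ∏ s ∈ (squarePairs K).erase 1, (-(s - 1)) ^ H.card =
      ((-1 : K) ^ H.card) ^ (((squarePairs K).erase 1).card / 2) := by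
  refine Finset.prod_of_involution _ (fun s => s⁻¹) _ _
    (fun s hs => (inv_mem_squarePairs_erase_one hs).1) (fun s _ => inv_inv s)
    (fun s hs => (inv_mem_squarePairs_erase_one hs).2) fun s hs => ?_
  simp only [squarePairs, Finset.mem_erase, Finset.mem_filter, Finset.mem_univ, true_and] at hs
  obtain ⟨hs1, hs0, -, hsq, -⟩ := hs
  have hsi : (s⁻¹) ^ H.card = 1 := (hH.isSquare_iff_pow_card (inv_ne_zero hs0)).1 hsq.inv
  have : -(s - 1) * -(s⁻¹ - 1) = -1 * (s - 1) ^ 2 * s⁻¹ := by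
    field_simp
    ring
  rw [← mul_pow, this, mul_pow, mul_pow, hsi, ← pow_mul,
    hH.pow_card_mul_two (sub_ne_zero.2 hs1), mul_one, mul_one]

theorem prod_squarePairs (hH : IsHalfSystem H) :
    ∏ s ∈ squarePairs K, (if s = 1 then -1 else (-(s - 1)) ^ H.card) =
      (if (2 : K) ^ H.card = 1 then -1 else 1) *
        ((-1 : K) ^ H.card) ^ (((squarePairs K).erase 1).card / 2) := by
  rw [← hH.prod_squarePairs_erase_one]
  have herase : ∏ s ∈ (squarePairs K).erase 1, (if s = 1 then -1 else (-(s - 1)) ^ H.card) =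
      ∏ s ∈ (squarePairs K).erase 1, (-(s - 1)) ^ H.card :=
    Finset.prod_congr rfl fun s hs => if_neg (Finset.ne_of_mem_erase hs)
  rw [← herase]
  split_ifs with h
  · rw [← Finset.mul_prod_erase _ _ (hH.one_mem_squarePairs.2 h), if_pos rfl]
  · rw [Finset.erase_eq_of_notMem (mt hH.one_mem_squarePairs.1 h), one_mul]

theorem two_pow_card_eq_or (hH : IsHalfSystem H) :
    (2 : K) ^ H.card = 1 ∨ (2 : K) ^ H.card = -1 := by
  have := hH.pow_card_mul_two hH.two_ne_zero
  rw [mul_comm, pow_mul] at this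
  rwa [sq, mul_self_eq_one_iff] at this

theorem prod_formValue_of_even (hH : IsHalfSystem H) (heven : Even H.card) :
    ∏ i ∈ H, ∏ j ∈ H, formValue i j = -(2 : K) ^ H.card * 2 ^ (H.card / 2) := by
  have h2 := hH.two_ne_zero
  obtain ⟨x, hx⟩ : IsSquare (-1 : K) := by
    rw [hH.isSquare_iff_pow_card (neg_ne_zero.2 one_ne_zero), heven.neg_one_pow]
  rw [← sq] at hx
  have hx0 : x ≠ 0 := by
    rintro rfl
    simp at hx
  have hne : (1 : K) ≠ -1 := fun h => h2 (by linear_combination h)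
  have h8 : (8 : K) ^ (H.card / 2) = 2 ^ H.card * 2 ^ (H.card / 2) := by
    obtain ⟨m, hm⟩ := heven
    rw [show H.card / 2 = m by omega, hm, ← pow_add, show (8 : K) = 2 ^ 3 by norm_num, ← pow_mul]
    congr 1
    omega
  have hfilter : {y ∈ {y ∈ H | y ^ 2 ≠ 1} | ¬ y ^ 2 ≠ -1} = {signRep H x} := by
    rw [← hH.filter_sq_eq hx0 hx.symm, Finset.filter_filter]
    refine Finset.filter_congr fun y _ => ?_
    rw [not_not]
    exact ⟨fun h => h.2, fun h => ⟨h ▸ hne.symm, h⟩⟩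
  rw [hH.prod_formValue_eq_prod_ratioProd, ← Finset.prod_filter_mul_prod_filter_not H (· ^ 2 = 1),
    hH.filter_sq_eq one_ne_zero (one_pow 2),
    ← Finset.prod_filter_mul_prod_filter_not {y ∈ H | ¬ y ^ 2 = 1} (· ^ 2 ≠ -1), hfilter,
    Finset.filter_filter, hH.prod_filter_ratioProd, hH.prod_squarePairs, Finset.prod_singleton,
    Finset.prod_singleton, hH.ratioProd_signRep one_ne_zero, hH.ratioProd_one,
    hH.ratioProd_signRep hx0, hH.ratioProd_of_sq_eq_neg_one hx.symm, pow_succ,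
    heven.neg_one_pow, one_pow, h8]
  rcases hH.two_pow_card_eq_or with h | h <;> rw [h]
  · simp
  · simp [hne.symm]

theorem prod_formValue_of_odd (hH : IsHalfSystem H) (hodd : Odd H.card) :
    ∏ i ∈ H, ∏ j ∈ H, formValue i j = (-1 : K) ^ (H.card / 4) := by
  have h2 := hH.two_ne_zero
  have hne : (1 : K) ≠ -1 := fun h => h2 (by linear_combination h)
  have hfilter : {y ∈ H | ¬ y ^ 2 = 1} = {y ∈ H | y ^ 2 ≠ 1 ∧ y ^ 2 ≠ -1} := by
    refine Finset.filter_congr fun y _ => ⟨fun h => ⟨h, fun h' => hne ?_⟩, fun h => h.1⟩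
    have : IsSquare (-1 : K) := h' ▸ IsSquare.sq y
    rw [hH.isSquare_iff_pow_card (neg_ne_zero.2 one_ne_zero), hodd.neg_one_pow] at this
    exact this.symm
  have hcard : 2 * (squarePairs K).card + 1 = H.card := by
    rw [← hH.card_filter_eq, ← hfilter, add_comm,
      ← Finset.card_filter_add_card_filter_not (s := H) (· ^ 2 = 1),
      hH.filter_sq_eq one_ne_zero (one_pow 2), Finset.card_singleton]
  rw [hH.prod_formValue_eq_prod_ratioProd, ← Finset.prod_filter_mul_prod_filter_not H (· ^ 2 = 1),
    hH.filter_sq_eq one_ne_zero (one_pow 2), hfilter, hH.prod_filter_ratioProd,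
    hH.prod_squarePairs, Finset.prod_singleton, hH.ratioProd_signRep one_ne_zero,
    hH.ratioProd_one, hodd.neg_one_pow]
  have heven := even_card_squarePairs_erase_one (K := K)
  rcases hH.two_pow_card_eq_or with h | h
  · have hc := Finset.card_erase_add_one (hH.one_mem_squarePairs.2 h)
    rw [h, if_pos rfl, neg_one_mul, neg_one_mul, neg_neg]
    congr 1
    grind
  · have hc := Finset.erase_eq_of_notMem (mt hH.one_mem_squarePairs.1 (h ▸ hne.symm))
    rw [h, if_neg hne.symm, neg_neg, one_mul, one_mul, hc]
    congr 1
    omega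

end IsHalfSystem

theorem ZMod.natCast_injOn_Icc (p : ℕ) [Fact p.Prime] :
    Set.InjOn (Nat.cast : ℕ → ZMod p) (Finset.Icc 1 ((p - 1) / 2)) := by
  have hp := (Fact.out : p.Prime).two_le
  intro i hi j hj h
  rw [Finset.mem_coe, Finset.mem_Icc] at hi hj
  rw [← ZMod.val_cast_of_lt (show i < p by omega), h, ZMod.val_cast_of_lt (by omega)]

theorem ZMod.isHalfSystem_Icc (p : ℕ) [Fact p.Prime] (hodd : Odd p) :
    IsHalfSystem ((Finset.Icc 1 ((p - 1) / 2)).image (Nat.cast : ℕ → ZMod p)) := by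
  have hp := (Fact.out : p.Prime).two_le
  have hmem (x : ZMod p) : x ∈ (Finset.Icc 1 ((p - 1) / 2)).image (Nat.cast : ℕ → ZMod p) ↔
      1 ≤ x.val ∧ x.val ≤ (p - 1) / 2 := by
    simp only [Finset.mem_image, Finset.mem_Icc]
    constructor
    · rintro ⟨i, hi, rfl⟩
      rwa [ZMod.val_cast_of_lt (by omega)]
    · exact fun h => ⟨x.val, h, ZMod.natCast_zmod_val x⟩
  refine ⟨by simp [hmem], fun x hx => ?_⟩
  have : NeZero x := ⟨hx⟩
  rw [hmem, hmem, ZMod.val_neg_of_ne_zero]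
  have h1 := ZMod.val_lt x
  have h2 := (ZMod.val_pos (a := x)).2 hx
  obtain ⟨m, rfl⟩ := hodd
  omega

theorem ZMod.intCast_prod_form (p : ℕ) [Fact p.Prime] :
    ((∏ i ∈ Finset.Icc 1 ((p - 1) / 2), ∏ j ∈ Finset.Icc 1 ((p - 1) / 2),
        if (p : ℤ) ∣ ((i : ℤ) ^ 2 - 2 * (i : ℤ) * (j : ℤ) - (j : ℤ) ^ 2) then 1
        else (i : ℤ) ^ 2 - 2 * (i : ℤ) * (j : ℤ) - (j : ℤ) ^ 2 : ℤ) : ZMod p) =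
      ∏ i ∈ (Finset.Icc 1 ((p - 1) / 2)).image (Nat.cast : ℕ → ZMod p),
        ∏ j ∈ (Finset.Icc 1 ((p - 1) / 2)).image (Nat.cast : ℕ → ZMod p), formValue i j := by
  rw [Finset.prod_image (ZMod.natCast_injOn_Icc p)]
  simp_rw [Finset.prod_image (ZMod.natCast_injOn_Icc p)]
  rw [Int.cast_prod]
  refine Finset.prod_congr rfl fun i _ => ?_
  rw [Int.cast_prod]
  refine Finset.prod_congr rfl fun j _ => ?_
  simp_rw [formValue, ← ZMod.intCast_zmod_eq_zero_iff_dvd]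
  push_cast
  rfl

/-- Theorem 1.5(ii): let `p` be an odd prime and let
`T_p(1,-2,-1) = ∏_{1 ≤ i,j ≤ (p-1)/2, p ∤ i²-2ij-j²} (i² - 2ij - j²)`. Then, modulo `p`,
`T_p(1,-2,-1)` is `-2^{(p-1)/4}` if `p ≡ 1 (mod 8)`; `2^{(p-1)/4}` if `p ≡ 5 (mod 8)`;
`(-1)^{(p-3)/8}` if `p ≡ 3 (mod 8)`; and `(-1)^{(p-7)/8}` if `p ≡ 7 (mod 8)`. -/
theorem statement15 (p : ℕ) [Fact p.Prime] (hodd : Odd p) :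
    (p % 8 = 1 →
      (∏ i ∈ Finset.Icc 1 ((p - 1) / 2), ∏ j ∈ Finset.Icc 1 ((p - 1) / 2),
          if (p : ℤ) ∣ ((i : ℤ) ^ 2 - 2 * (i : ℤ) * (j : ℤ) - (j : ℤ) ^ 2) then 1
          else (i : ℤ) ^ 2 - 2 * (i : ℤ) * (j : ℤ) - (j : ℤ) ^ 2)
        ≡ -2 ^ ((p - 1) / 4) [ZMOD (p : ℤ)]) ∧
    (p % 8 = 5 →
      (∏ i ∈ Finset.Icc 1 ((p - 1) / 2), ∏ j ∈ Finset.Icc 1 ((p - 1) / 2),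
          if (p : ℤ) ∣ ((i : ℤ) ^ 2 - 2 * (i : ℤ) * (j : ℤ) - (j : ℤ) ^ 2) then 1
          else (i : ℤ) ^ 2 - 2 * (i : ℤ) * (j : ℤ) - (j : ℤ) ^ 2)
        ≡ 2 ^ ((p - 1) / 4) [ZMOD (p : ℤ)]) ∧
    (p % 8 = 3 →
      (∏ i ∈ Finset.Icc 1 ((p - 1) / 2), ∏ j ∈ Finset.Icc 1 ((p - 1) / 2),
          if (p : ℤ) ∣ ((i : ℤ) ^ 2 - 2 * (i : ℤ) * (j : ℤ) - (j : ℤ) ^ 2) then 1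
          else (i : ℤ) ^ 2 - 2 * (i : ℤ) * (j : ℤ) - (j : ℤ) ^ 2)
        ≡ (-1) ^ ((p - 3) / 8) [ZMOD (p : ℤ)]) ∧
    (p % 8 = 7 →
      (∏ i ∈ Finset.Icc 1 ((p - 1) / 2), ∏ j ∈ Finset.Icc 1 ((p - 1) / 2),
          if (p : ℤ) ∣ ((i : ℤ) ^ 2 - 2 * (i : ℤ) * (j : ℤ) - (j : ℤ) ^ 2) then 1
          else (i : ℤ) ^ 2 - 2 * (i : ℤ) * (j : ℤ) - (j : ℤ) ^ 2)
        ≡ (-1) ^ ((p - 7) / 8) [ZMOD (p : ℤ)]) := by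
  have hH := ZMod.isHalfSystem_Icc p hodd
  have hcard : ((Finset.Icc 1 ((p - 1) / 2)).image (Nat.cast : ℕ → ZMod p)).card = (p - 1) / 2 := by
    rw [Finset.card_image_of_injOn (ZMod.natCast_injOn_Icc p), Nat.card_Icc, Nat.add_sub_cancel]
  have heven := hH.prod_formValue_of_even
  have hodd' := hH.prod_formValue_of_odd
  have hsq := hH.isSquare_iff_pow_card hH.two_ne_zero
  have hor := hH.two_pow_card_eq_or
  rw [ZMod.exists_sq_eq_two_iff (by rintro rfl; revert hodd; decide)] at hsq
  rw [← ZMod.intCast_prod_form, hcard, Nat.div_div_eq_div_mul] at heven hodd'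
  rw [hcard] at hsq hor
  refine ⟨fun h => ?_, fun h => ?_, fun h => ?_, fun h => ?_⟩ <;>
    rw [← ZMod.intCast_eq_intCast_iff]
  · rw [heven (Nat.even_iff.2 (by omega)), hsq.1 (.inl h)]
    push_cast
    ring
  · rw [heven (Nat.even_iff.2 (by omega)), hor.resolve_left fun h' => by have := hsq.2 h'; omega]
    push_cast
    ring
  · rw [hodd' (Nat.odd_iff.2 (by omega)), show (p - 1) / (2 * 4) = (p - 3) / 8 by omega]
    push_cast
    rfl
  · rw [hodd' (Nat.odd_iff.2 (by omega)), show (p - 1) / (2 * 4) = (p - 7) / 8 by omega]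
    push_cast
    rfl
end

section
/- Let p > 3 be a prime with p ≡ 1 (mod 4) and let δ ∈ {1, −1}. Then T_p(2, 5δ, 2) ≡ (−1)^{⌊(p+11)/12⌋} (mod p). -/
open Finset

theorem prod_Icc_two_mul {M : Type*} [CommMonoid M] (n : ℕ) (f : ℕ → M) :
    ∏ k ∈ Icc 1 (2 * n), f k = ∏ k ∈ Icc 1 n, f k * f (2 * n + 1 - k) := by
  have hdisj : Disjoint (Icc 1 n) (Icc (n + 1) (2 * n)) := by
    rw [Finset.disjoint_left]
    intro a ha hb
    simp only [mem_Icc] at ha hb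
    omega
  have hunion : Icc 1 (2 * n) = Icc 1 n ∪ Icc (n + 1) (2 * n) := by
    ext a
    simp only [mem_union, mem_Icc]
    omega
  rw [hunion, prod_union hdisj, prod_mul_distrib]
  congr 1
  refine prod_bij' (fun k _ => 2 * n + 1 - k) (fun k _ => 2 * n + 1 - k) ?_ ?_ ?_ ?_ ?_
  all_goals
    intro a ha
    simp only [mem_Icc] at ha ⊢
  · omega
  · omega
  · omega
  · omega
  · congr 1
    omega

theorem prod_Icc_reflect {M : Type*} [CommMonoid M] (n : ℕ) (f : ℕ → M) :
    ∏ k ∈ Icc 1 n, f (n + 1 - k) = ∏ k ∈ Icc 1 n, f k := by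
  refine prod_bij' (fun k _ => n + 1 - k) (fun k _ => n + 1 - k) ?_ ?_ ?_ ?_ fun _ _ => rfl
  all_goals
    intro a ha
    simp only [mem_Icc] at ha ⊢
    omega

/-- The element itself if it is nonzero, and `1` otherwise. -/
def orOne {F : Type*} [Zero F] [One F] [DecidableEq F] (x : F) : F := if x = 0 then 1 else x

section Field

variable {F : Type*} [Field F] [DecidableEq F]

theorem orOne_of_ne_zero {x : F} (hx : x ≠ 0) : orOne x = x := if_neg hx

theorem orOne_neg_sq (x : F) : orOne (-x) ^ 2 = orOne x ^ 2 := by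
  unfold orOne
  by_cases hx : x = 0 <;> simp [hx]

/-- The product of the nonzero values of `2i² + 5δij + 2j²` over `1 ≤ i, j ≤ n`. -/
def formProd (n : ℕ) (δ : F) : F :=
  ∏ i ∈ Icc 1 n, ∏ j ∈ Icc 1 n,
    orOne (2 * (i : F) ^ 2 + 5 * δ * (i : F) * (j : F) + 2 * (j : F) ^ 2)

theorem formProd_mul_prod_zeros {n : ℕ} (hn : Even n) {δ : F} (hδ : δ ^ 2 = 1)
    (h3 : (3 : F) ≠ 0) (h0 : ∀ i ∈ Icc 1 n, (i : F) ≠ 0) :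
    formProd n δ * ∏ i ∈ Icc 1 n, ∏ j ∈ Icc 1 n,
        (if 2 * (i : F) + δ * j = 0 then 9 * (i : F) ^ 2 else 1) =
      ∏ i ∈ Icc 1 n, ∏ j ∈ Icc 1 n, orOne (2 * (i : F) + δ * j) ^ 2 := by
  have hδ0 : δ ≠ 0 := by
    rintro rfl
    simp at hδ
  set u : ℕ → ℕ → F := fun i j => 2 * (i : F) + δ * j with hu
  have key : ∀ i ∈ Icc 1 n, ∀ j ∈ Icc 1 n,
      orOne (2 * (i : F) ^ 2 + 5 * δ * (i : F) * (j : F) + 2 * (j : F) ^ 2) *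
          ((if u i j = 0 then -3 * (i : F) else 1) * (if u j i = 0 then -3 * (j : F) else 1)) * δ =
        orOne (u i j) * orOne (u j i) := by
    intro i hi j hj
    have hfac : 2 * (i : F) ^ 2 + 5 * δ * (i : F) * (j : F) + 2 * (j : F) ^ 2 =
        δ * (u i j * u j i) := by
      simp only [hu]
      linear_combination (-(2 * (i : F) ^ 2 + 2 * (j : F) ^ 2) - δ * i * j) * hδ
    rw [hfac]
    by_cases h1 : u i j = 0
    · have hw : u j i = -3 * (i : F) * δ := by
        simp only [hu] at h1 ⊢
        linear_combination 2 * δ * h1 - 2 * (j : F) * hδ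
      have hw0 : u j i ≠ 0 := by
        rw [hw]
        exact mul_ne_zero (mul_ne_zero (neg_ne_zero.mpr h3) (h0 i hi)) hδ0
      rw [orOne_of_ne_zero hw0, h1, zero_mul, mul_zero, if_pos rfl, if_neg hw0, hw]
      simp [orOne]
    · by_cases h2 : u j i = 0
      · have hw : u i j = -3 * (j : F) * δ := by
          simp only [hu] at h2 ⊢
          linear_combination 2 * δ * h2 - 2 * (i : F) * hδ
        rw [orOne_of_ne_zero h1, h2, mul_zero, mul_zero, if_pos rfl, if_neg h1, hw]
        simp [orOne]
      · rw [orOne_of_ne_zero (mul_ne_zero hδ0 (mul_ne_zero h1 h2)), orOne_of_ne_zero h1,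
          orOne_of_ne_zero h2, if_neg h1, if_neg h2]
        linear_combination u i j * u j i * hδ
  have hprod := prod_congr rfl fun i hi => prod_congr rfl (key i hi)
  have hδn : δ ^ n = 1 := by
    obtain ⟨k, rfl⟩ := hn
    rw [← two_mul, pow_mul, hδ, one_pow]
  simp only [prod_mul_distrib, prod_const, Nat.card_Icc, Nat.add_sub_cancel, hδn, mul_one] at hprod
  rw [prod_comm (f := fun i j => if u j i = 0 then -3 * (j : F) else 1),
    prod_comm (f := fun i j => orOne (u j i))] at hprod
  have hsq : ∀ i j, (if u i j = 0 then 9 * (i : F) ^ 2 else 1) =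
      (if u i j = 0 then -3 * (i : F) else 1) ^ 2 := by
    intro i j
    split_ifs <;> ring
  change formProd n δ * ∏ i ∈ Icc 1 n, ∏ j ∈ Icc 1 n, (if u i j = 0 then 9 * (i : F) ^ 2 else 1) =
    ∏ i ∈ Icc 1 n, ∏ j ∈ Icc 1 n, orOne (u i j) ^ 2
  simp only [hsq, prod_pow]
  rw [pow_two, pow_two]
  exact hprod

end Field

section ZMod

variable {p : ℕ} [Fact p.Prime]

theorem prod_Ico_natCast {M : Type*} [CommMonoid M] (h : ZMod p → M) :
    ∏ k ∈ Ico 1 p, h k = ∏ x ∈ univ.erase (0 : ZMod p), h x := by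
  refine prod_bij' (fun k _ => (k : ZMod p)) (fun x _ => x.val) ?_ ?_ ?_ ?_ ?_
  · intro k hk
    simp only [mem_Ico] at hk
    simp only [mem_erase, mem_univ, and_true, ne_eq, ZMod.natCast_eq_zero_iff]
    exact Nat.not_dvd_of_pos_of_lt (by omega) (by omega)
  · intro x hx
    have hlt := ZMod.val_lt x
    have hpos : x.val ≠ 0 := by
      rw [ne_eq, ZMod.val_eq_zero]
      exact (mem_erase.mp hx).1
    simp only [mem_Ico]
    omega
  · intro k hk
    simp only [mem_Ico] at hk
    exact ZMod.val_cast_of_lt (by omega)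
  · intro x _
    exact ZMod.natCast_zmod_val x
  · intros
    rfl

theorem prod_Icc_mul_neg {M : Type*} [CommMonoid M] {n : ℕ} (hn : p = 2 * n + 1)
    (h : ZMod p → M) :
    ∏ j ∈ Icc 1 n, h j * h (-j) = ∏ x ∈ univ.erase (0 : ZMod p), h x := by
  have hIco : Ico 1 p = Icc 1 (2 * n) := by
    ext k
    simp only [mem_Ico, mem_Icc]
    omega
  rw [← prod_Ico_natCast, hIco, prod_Icc_two_mul]
  refine prod_congr rfl fun k hk => ?_
  rw [← hn, Nat.cast_sub (by simp only [mem_Icc] at hk; omega), ZMod.natCast_self, zero_sub]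

theorem prod_erase_zero : ∏ x ∈ univ.erase (0 : ZMod p), x = -1 := by
  rw [← ZMod.prod_Ico_one_prime p, prod_Ico_natCast fun x => x]

theorem prod_univ_orOne : ∏ x : ZMod p, orOne x = -1 := by
  rw [← mul_prod_erase univ _ (mem_univ (0 : ZMod p)), orOne, if_pos rfl, one_mul,
    ← prod_erase_zero (p := p)]
  exact prod_congr rfl fun x hx => orOne_of_ne_zero (mem_erase.mp hx).1

theorem mul_prod_erase_orOne_sub {c : ZMod p} (hc : c ≠ 0) :
    c * ∏ x ∈ univ.erase (0 : ZMod p), orOne (c - x) = -1 := by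
  have h : ∏ x : ZMod p, orOne (c - x) = -1 := by
    rw [← prod_univ_orOne, ← (Equiv.subLeft c).prod_comp orOne]
    rfl
  rwa [← mul_prod_erase univ _ (mem_univ (0 : ZMod p)), sub_zero, orOne_of_ne_zero hc] at h

theorem natCast_ne_zero_of_mem_Icc {n i : ℕ} (hn : n < p) (hi : i ∈ Icc 1 n) :
    (i : ZMod p) ≠ 0 := by
  simp only [mem_Icc] at hi
  rw [ne_eq, ZMod.natCast_eq_zero_iff]
  exact Nat.not_dvd_of_pos_of_lt (by omega) (by omega)

theorem prod_Icc_natCast_sq {n : ℕ} (hn : p = 2 * n + 1) (heven : Even n) :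
    ∏ j ∈ Icc 1 n, (j : ZMod p) ^ 2 = -1 := by
  have h := prod_Icc_mul_neg hn (fun x => x)
  rw [prod_erase_zero] at h
  simp only [mul_neg, prod_neg, Nat.card_Icc, Nat.add_sub_cancel, heven.neg_one_pow, one_mul,
    ← pow_two] at h
  exact h

theorem pow_sq_pow_eq_one {n : ℕ} (hn : p = 2 * n + 1) {a : ZMod p} (ha : a ≠ 0) :
    (a ^ 2) ^ n = 1 := by
  rw [← pow_mul, ← ZMod.pow_card_sub_one_eq_one ha]
  congr 1
  omega

theorem formProd_one_mul_formProd_neg_one {n : ℕ} (hn : p = 2 * n + 1) (heven : Even n)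
    (h2 : (2 : ZMod p) ≠ 0) (h3 : (3 : ZMod p) ≠ 0) :
    formProd n (1 : ZMod p) * formProd n (-1) = 1 := by
  have h0 : ∀ i ∈ Icc 1 n, (i : ZMod p) ≠ 0 := fun i hi =>
    natCast_ne_zero_of_mem_Icc (by omega) hi
  have hpos := formProd_mul_prod_zeros heven (δ := (1 : ZMod p)) (by ring) h3 h0
  have hneg := formProd_mul_prod_zeros heven (δ := (-1 : ZMod p)) (by ring) h3 h0
  have hmul := congrArg₂ (· * ·) hpos hneg
  simp only [one_mul, neg_one_mul] at hmul
  rw [mul_mul_mul_comm, ← prod_mul_distrib, ← prod_mul_distrib] at hmul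
  have hzeros : ∏ i ∈ Icc 1 n,
      ((∏ j ∈ Icc 1 n, if 2 * (i : ZMod p) + j = 0 then 9 * (i : ZMod p) ^ 2 else 1) *
        ∏ j ∈ Icc 1 n, if 2 * (i : ZMod p) + -j = 0 then 9 * (i : ZMod p) ^ 2 else 1) = -1 := by
    have hrow : ∀ i ∈ Icc 1 n,
        ((∏ j ∈ Icc 1 n, if 2 * (i : ZMod p) + j = 0 then 9 * (i : ZMod p) ^ 2 else 1) *
          ∏ j ∈ Icc 1 n, if 2 * (i : ZMod p) + -j = 0 then 9 * (i : ZMod p) ^ 2 else 1) =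
        3 ^ 2 * (i : ZMod p) ^ 2 := by
      intro i hi
      have h := prod_Icc_mul_neg hn
        (fun x => if 2 * (i : ZMod p) + x = 0 then 9 * (i : ZMod p) ^ 2 else 1)
      simp only [add_eq_zero_iff_neg_eq] at h ⊢
      rw [prod_mul_distrib] at h
      rw [h, prod_ite_eq, if_pos]
      · norm_num
      · simp [h2, h0 i hi]
    rw [prod_congr rfl hrow, prod_mul_distrib, prod_const, Nat.card_Icc, Nat.add_sub_cancel,
      pow_sq_pow_eq_one hn h3, prod_Icc_natCast_sq hn heven, one_mul]
  have hvalues : (∏ i ∈ Icc 1 n, (2 * (i : ZMod p)) ^ 2) * ∏ i ∈ Icc 1 n,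
      ((∏ j ∈ Icc 1 n, orOne (2 * (i : ZMod p) + j) ^ 2) *
        ∏ j ∈ Icc 1 n, orOne (2 * (i : ZMod p) + -j) ^ 2) = 1 := by
    rw [← prod_mul_distrib]
    refine prod_eq_one fun i hi => ?_
    have h := prod_Icc_mul_neg hn (fun x => orOne (2 * (i : ZMod p) - x))
    have h' := mul_prod_erase_orOne_sub (mul_ne_zero h2 (h0 i hi))
    rw [← h, prod_mul_distrib] at h'
    simp only [sub_eq_add_neg, neg_neg] at h'
    rw [prod_pow, prod_pow, mul_comm (_ ^ 2) (_ ^ 2), ← mul_pow, ← mul_pow, h', neg_one_sq]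
  have hsq : ∏ i ∈ Icc 1 n, (2 * (i : ZMod p)) ^ 2 = -1 := by
    simp only [mul_pow]
    rw [prod_mul_distrib, prod_const, Nat.card_Icc, Nat.add_sub_cancel,
      pow_sq_pow_eq_one hn h2, prod_Icc_natCast_sq hn heven, one_mul]
  rw [hsq] at hvalues
  rw [hzeros] at hmul
  linear_combination -hmul + hvalues

theorem formProd_neg_one_mul {m : ℕ} (hp : p = 4 * m + 1)
    (h2 : (2 : ZMod p) ≠ 0) (h3 : (3 : ZMod p) ≠ 0) :
    formProd (2 * m) (-1 : ZMod p) * 6 ^ (2 * m) = -1 := by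
  have hn : p = 2 * (2 * m) + 1 := by omega
  have hpz : (4 * m + 1 : ZMod p) = 0 := by
    have h := ZMod.natCast_self p
    have hcast := congrArg (Nat.cast : ℕ → ZMod p) hp
    rw [h] at hcast
    exact_mod_cast hcast.symm
  have h0 : ∀ i ∈ Icc 1 (2 * m), (i : ZMod p) ≠ 0 := fun i hi =>
    natCast_ne_zero_of_mem_Icc (by omega) hi
  have hmain := formProd_mul_prod_zeros (even_two_mul m) (δ := (-1 : ZMod p)) (by ring) h3 h0
  have hzeros : ∏ i ∈ Icc 1 (2 * m), ∏ j ∈ Icc 1 (2 * m),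
      (if 2 * (i : ZMod p) + -1 * j = 0 then 9 * (i : ZMod p) ^ 2 else 1) =
      ∏ i ∈ Icc 1 m, 9 * (i : ZMod p) ^ 2 := by
    have hfilter : Icc 1 m = {i ∈ Icc 1 (2 * m) | 2 * i ∈ Icc 1 (2 * m)} := by
      ext i
      simp only [mem_filter, mem_Icc]
      omega
    rw [hfilter, prod_filter]
    refine prod_congr rfl fun i hi => ?_
    rw [← prod_ite_eq (Icc 1 (2 * m)) (2 * i) fun _ => 9 * (i : ZMod p) ^ 2]
    refine prod_congr rfl fun j hj => ?_
    simp only [mem_Icc] at hi hj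
    have hiff : 2 * (i : ZMod p) + -1 * j = 0 ↔ 2 * i = j := by
      rw [neg_one_mul, ← sub_eq_add_neg, sub_eq_zero]
      constructor
      · intro h
        have h' : ((2 * i : ℕ) : ZMod p) = (j : ℕ) := by
          push_cast
          exact h
        rw [ZMod.natCast_eq_natCast_iff', Nat.mod_eq_of_lt (by omega),
          Nat.mod_eq_of_lt (by omega)] at h'
        exact h'
      · rintro rfl
        push_cast
        rfl
    simp only [hiff]
  have hvalues : (∏ i ∈ Icc 1 m, (2 * ((m : ZMod p) + i)) ^ 2) *
      ∏ i ∈ Icc 1 (2 * m), ∏ j ∈ Icc 1 (2 * m), orOne (2 * (i : ZMod p) + -1 * j) ^ 2 = 1 := by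
    rw [prod_Icc_two_mul, ← prod_mul_distrib]
    refine prod_eq_one fun i hi => ?_
    simp only [mem_Icc] at hi
    have hc : (2 * ((m : ZMod p) + i)) ≠ 0 :=
      mul_ne_zero h2 (by
        exact_mod_cast natCast_ne_zero_of_mem_Icc (p := p) (n := 2 * m) (i := m + i) (by omega)
          (by simp only [mem_Icc]; omega))
    have h := mul_prod_erase_orOne_sub hc
    rw [← prod_Icc_mul_neg hn, prod_mul_distrib] at h
    have hleft : ∏ j ∈ Icc 1 (2 * m), orOne (2 * (i : ZMod p) + -1 * j) ^ 2 =
        ∏ j ∈ Icc 1 (2 * m), orOne (2 * ((m : ZMod p) + i) - -j) ^ 2 := by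
      rw [← prod_Icc_reflect]
      refine prod_congr rfl fun j hj => ?_
      simp only [mem_Icc] at hj
      congr 2
      rw [Nat.cast_sub (by omega)]
      push_cast
      linear_combination -hpz
    have hright : ∏ j ∈ Icc 1 (2 * m), orOne (2 * ((2 * m + 1 - i : ℕ) : ZMod p) + -1 * j) ^ 2 =
        ∏ j ∈ Icc 1 (2 * m), orOne (2 * ((m : ZMod p) + i) - j) ^ 2 := by
      rw [← prod_Icc_reflect]
      refine prod_congr rfl fun j hj => ?_
      simp only [mem_Icc] at hj
      rw [← orOne_neg_sq]
      congr 2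
      rw [Nat.cast_sub (by omega), Nat.cast_sub (by omega)]
      push_cast
      linear_combination -hpz
    rw [hleft, hright, prod_pow, prod_pow, mul_comm ((∏ j ∈ _, _) ^ 2) _, ← mul_pow, ← mul_pow, h,
      neg_one_sq]
  have hfact : (∏ i ∈ Icc 1 m, (i : ZMod p) ^ 2) * ∏ i ∈ Icc 1 m, ((m : ZMod p) + i) ^ 2 = -1 := by
    rw [← prod_Icc_natCast_sq hn (even_two_mul m), prod_Icc_two_mul, prod_mul_distrib,
      ← prod_Icc_reflect m fun i => ((m : ZMod p) + i) ^ 2]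
    congr 1
    refine prod_congr rfl fun i hi => ?_
    simp only [mem_Icc] at hi
    rw [← Nat.cast_add]
    congr 2
    omega
  rw [hzeros, prod_mul_distrib, prod_const, Nat.card_Icc, Nat.add_sub_cancel] at hmain
  simp only [mul_pow] at hvalues
  rw [← hmain, prod_mul_distrib, prod_const, Nat.card_Icc, Nat.add_sub_cancel] at hvalues
  have h6 : (6 : ZMod p) ^ (2 * m) = 9 ^ m * (2 ^ 2) ^ m := by
    rw [pow_mul, ← mul_pow]
    norm_num
  rw [h6]
  linear_combination -hvalues + formProd (2 * m) (-1 : ZMod p) * 9 ^ m * (2 ^ 2) ^ m * hfact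

theorem six_pow_div_two {m : ℕ} (hp : p = 4 * m + 1) (hp3 : p ≠ 3) :
    (6 : ZMod p) ^ (2 * m) = -(-1) ^ ((p + 11) / 12) := by
  have : Fact (Nat.Prime 3) := ⟨Nat.prime_three⟩
  have hdvd : p % 3 ≠ 0 := fun h => by
    have h' := (Nat.prime_dvd_prime_iff_eq Nat.prime_three (Fact.out : p.Prime)).mp
      (Nat.dvd_of_mod_eq_zero h)
    exact hp3 h'.symm
  have hpow := legendreSym.eq_pow p 6
  have htwo := legendreSym.at_two (p := p) (by omega)
  have hthree : legendreSym p 3 = legendreSym 3 p :=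
    (legendreSym.quadratic_reciprocity_one_mod_four (p := p) (q := 3) (by omega) (by omega)).symm
  rw [show (6 : ℤ) = 2 * 3 by norm_num, legendreSym.mul, htwo, hthree, legendreSym.mod 3,
    ZMod.χ₈_nat_eq_if_mod_eight, show p / 2 = 2 * m by omega] at hpow
  have hmod : ((p : ℤ) % (3 : ℕ) = 1 ∨ (p : ℤ) % (3 : ℕ) = 2) := by omega
  have h31 : legendreSym 3 1 = 1 := by simp
  have h32 : legendreSym 3 2 = -1 := by
    rw [legendreSym.at_two (by norm_num)]
    rfl
  have hsix : (6 : ZMod p) ^ (2 * m) = ((2 * 3 : ℤ) : ZMod p) ^ (2 * m) := by norm_num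
  rw [hsix, ← hpow]
  have h8 : p % 8 = 1 ∨ p % 8 = 5 := by omega
  rcases hmod with h | h <;> rcases h8 with h' | h' <;>
    rw [h, if_neg (by omega : ¬p % 2 = 0)] <;> simp only [h31, h32, h']
  · rw [Odd.neg_one_pow (Nat.odd_iff.mpr (by omega))]
    norm_num
  · rw [Even.neg_one_pow (Nat.even_iff.mpr (by omega))]
    norm_num
  · rw [Even.neg_one_pow (Nat.even_iff.mpr (by omega))]
    norm_num
  · rw [Odd.neg_one_pow (Nat.odd_iff.mpr (by omega))]
    norm_num

end ZMod

/-- Theorem 1.6, (1.19): let `p > 3` be a prime with `p ≡ 1 (mod 4)` and `δ ∈ {1, -1}`.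
Then `T_p(2, 5δ, 2) ≡ (-1)^{⌊(p+11)/12⌋} (mod p)`, where
`T_p(2,5δ,2) = ∏_{1 ≤ i,j ≤ (p-1)/2, p ∤ 2i²+5δij+2j²} (2i² + 5δij + 2j²)`. -/
theorem statement16 (p : ℕ) [Fact p.Prime] (hp3 : 3 < p) (hp : p % 4 = 1)
    (δ : ℤ) (hδ : δ = 1 ∨ δ = -1) :
    (∏ i ∈ Finset.Icc 1 ((p - 1) / 2), ∏ j ∈ Finset.Icc 1 ((p - 1) / 2),
        if (p : ℤ) ∣ (2 * (i : ℤ) ^ 2 + 5 * δ * (i : ℤ) * (j : ℤ) + 2 * (j : ℤ) ^ 2) then 1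
        else 2 * (i : ℤ) ^ 2 + 5 * δ * (i : ℤ) * (j : ℤ) + 2 * (j : ℤ) ^ 2)
      ≡ (-1) ^ ((p + 11) / 12) [ZMOD (p : ℤ)] := by
  obtain ⟨m, hm⟩ : ∃ m, p = 4 * m + 1 := ⟨p / 4, by omega⟩
  have h2 : (2 : ZMod p) ≠ 0 := by
    exact_mod_cast natCast_ne_zero_of_mem_Icc (p := p) (n := 3) (i := 2) hp3 (by simp)
  have h3 : (3 : ZMod p) ≠ 0 := by
    exact_mod_cast natCast_ne_zero_of_mem_Icc (p := p) (n := 3) (i := 3) hp3 (by simp)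
  have hneg := formProd_neg_one_mul hm h2 h3
  have hpos := formProd_one_mul_formProd_neg_one (n := 2 * m) (p := p) (by omega)
    (even_two_mul m) h2 h3
  rw [six_pow_div_two hm hp3.ne'] at hneg
  have hsign : ((-1 : ZMod p) ^ ((p + 11) / 12)) ^ 2 = 1 := by
    rw [← pow_mul, mul_comm, pow_mul, neg_one_sq, one_pow]
  have hδ' : formProd (2 * m) (δ : ZMod p) = (-1) ^ ((p + 11) / 12) := by
    have hneg' : formProd (2 * m) (-1 : ZMod p) = (-1) ^ ((p + 11) / 12) := by
      linear_combination (-(-1 : ZMod p) ^ ((p + 11) / 12)) * hneg -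
        formProd (2 * m) (-1 : ZMod p) * hsign
    rcases hδ with rfl | rfl
    · rw [hneg'] at hpos
      rw [Int.cast_one]
      linear_combination (-1 : ZMod p) ^ ((p + 11) / 12) * hpos -
        formProd (2 * m) (1 : ZMod p) * hsign
    · rw [Int.cast_neg, Int.cast_one, hneg']
  rw [← ZMod.intCast_eq_intCast_iff, show (p - 1) / 2 = 2 * m by omega]
  push_cast
  rw [← hδ', formProd]
  refine prod_congr rfl fun i _ => prod_congr rfl fun j _ => ?_
  simp only [← ZMod.intCast_zmod_eq_zero_iff_dvd, orOne]
  push_cast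
  rfl
end

section
/- Let p > 3 be a prime with p ≡ 3 (mod 4) and let δ ∈ {1, −1}. Then, in ℤ/pℤ, T_p(2, 5δ, 2) = (6/p) · δ · 2^δ · 3^{−δ} · C(( p−3)/2, (p−3)/4)^{−2δ}, where C(m, k) denotes the binomial coefficient (note that 2, 3 and C((p−3)/2, (p−3)/4) are invertible modulo p). Equivalently, T_p(2, 5δ, 2) · 3^δ · C((p−3)/2, (p−3)/4)^{2δ} ≡ (6/p) · δ · 2^δ (mod p) when δ = 1, with the analogous cleared-denominators congruence when δ = −1. -/
open Finset

section NonzeroProducts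

variable {F : Type*} [Field F] [DecidableEq F]

/-- The value `x` if it is nonzero, and `1` otherwise; a product of such values is the product of
the nonzero factors. -/
def oneIfZero (x : F) : F := if x = 0 then 1 else x

lemma oneIfZero_of_ne {x : F} (h : x ≠ 0) : oneIfZero x = x := if_neg h

lemma oneIfZero_ne_zero (x : F) : oneIfZero x ≠ 0 := by
  unfold oneIfZero; split_ifs <;> simp_all

lemma prod_oneIfZero_mul_swap {ι : Type*} (s : Finset ι) (f : ι → ι → F)
    (hf : ∀ i ∈ s, ∀ j ∈ s, f i j = 0 → f j i ≠ 0) :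
    (∏ i ∈ s, ∏ j ∈ s, oneIfZero (f i j * f j i)) *
      (∏ i ∈ s, ∏ j ∈ s, if f j i = 0 then f i j else 1) ^ 2 =
      (∏ i ∈ s, ∏ j ∈ s, oneIfZero (f i j)) ^ 2 := by
  have h1 : (∏ i ∈ s, ∏ j ∈ s, oneIfZero (f i j)) = ∏ i ∈ s, ∏ j ∈ s, oneIfZero (f j i) :=
    prod_comm
  have h2 : (∏ i ∈ s, ∏ j ∈ s, if f j i = 0 then f i j else 1) =
      ∏ i ∈ s, ∏ j ∈ s, if f i j = 0 then f j i else 1 := prod_comm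
  rw [sq, sq]
  nth_rewrite 2 [h1]
  nth_rewrite 2 [h2]
  simp only [← prod_mul_distrib]
  refine prod_congr rfl fun i hi => prod_congr rfl fun j hj => ?_
  have := hf i hi j hj
  unfold oneIfZero
  by_cases h : f i j = 0 <;> by_cases h' : f j i = 0 <;> simp_all

lemma prod_oneIfZero_neg_mul_swap {ι : Type*} (s : Finset ι) (f : ι → ι → F)
    (hf : ∀ i ∈ s, ∀ j ∈ s, f i j = 0 → f j i ≠ 0) :
    (∏ i ∈ s, ∏ j ∈ s, oneIfZero (-(f i j * f j i))) =
      (-1) ^ #s * ∏ i ∈ s, ∏ j ∈ s, oneIfZero (f i j * f j i) := by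
  set g : ι → ι → F := fun i j => if f i j = 0 then 1 else -1 with hg
  have h1 : (∏ i ∈ s, ∏ j ∈ s, g i j) * (∏ i ∈ s, ∏ j ∈ s, g j i) = 1 := by
    rw [prod_comm (f := fun i j => g j i)]
    simp only [← prod_mul_distrib]
    refine prod_eq_one fun i _ => prod_eq_one fun j _ => ?_
    simp only [hg]; split_ifs <;> ring
  have h2 : (∏ i ∈ s, ∏ j ∈ s, (-1 : F)) = (-1) ^ #s := by
    simp only [prod_const]
    rcases Nat.even_or_odd #s with h | h
    · simp [h.neg_one_pow]
    · simp [h.neg_one_pow]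
  trans (∏ i ∈ s, ∏ j ∈ s, (-1 : F)) * ((∏ i ∈ s, ∏ j ∈ s, g i j) * (∏ i ∈ s, ∏ j ∈ s, g j i)) *
    ∏ i ∈ s, ∏ j ∈ s, oneIfZero (f i j * f j i)
  swap
  · rw [h1, h2, mul_one]
  simp only [← prod_mul_distrib]
  refine prod_congr rfl fun i hi => prod_congr rfl fun j hj => ?_
  have := hf i hi j hj
  simp only [hg]
  unfold oneIfZero
  by_cases h : f i j = 0 <;> by_cases h' : f j i = 0 <;> simp_all

end NonzeroProducts

lemma pow_mul_prod_range {M : Type*} [CommMonoid M] (n : ℕ) (a : M) (f : ℕ → M) :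
    a ^ n * ∏ i ∈ range n, f i = ∏ i ∈ range n, a * f i := by
  rw [prod_mul_distrib, prod_const, card_range]

section PrimeField

variable (p : ℕ) [Fact p.Prime]

/-- The image in `ZMod p` of the product of the positive integers up to `x` that are prime
to `p`. -/
def primeToFactorial (x : ℕ) : ZMod p := ∏ k ∈ range x, oneIfZero ((k + 1 : ℕ) : ZMod p)

lemma primeToFactorial_succ (x : ℕ) :
    primeToFactorial p (x + 1) = primeToFactorial p x * oneIfZero ((x + 1 : ℕ) : ZMod p) :=
  prod_range_succ _ _

lemma primeToFactorial_ne_zero (x : ℕ) : primeToFactorial p x ≠ 0 :=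
  prod_ne_zero_iff.2 fun _ _ => oneIfZero_ne_zero _

lemma natCast_ne_zero_of_lt {x : ℕ} (h0 : 0 < x) (h : x < p) : (x : ZMod p) ≠ 0 := by
  rw [Ne, ZMod.natCast_eq_zero_iff]
  exact Nat.not_dvd_of_pos_of_lt h0 h

lemma primeToFactorial_eq_factorial {x : ℕ} (h : x < p) :
    primeToFactorial p x = (x.factorial : ZMod p) := by
  induction x with
  | zero => simp [primeToFactorial]
  | succ x ih =>
    rw [primeToFactorial_succ, ih (by omega),
      oneIfZero_of_ne (natCast_ne_zero_of_lt p x.succ_pos h), Nat.factorial_succ]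
    push_cast; ring

lemma primeToFactorial_add_prime (x : ℕ) :
    primeToFactorial p (x + p) = -primeToFactorial p x := by
  have hp := (Fact.out : p.Prime).pos
  induction x with
  | zero =>
    obtain ⟨q, rfl⟩ : ∃ q, p = q + 1 := ⟨p - 1, by omega⟩
    rw [zero_add, primeToFactorial_succ, primeToFactorial_eq_factorial _ q.lt_succ_self]
    have := ZMod.wilsons_lemma (q + 1)
    rw [Nat.add_sub_cancel] at this
    rw [this, ZMod.natCast_self]
    simp [oneIfZero, primeToFactorial]
  | succ x ih =>
    rw [Nat.add_right_comm, primeToFactorial_succ, ih, primeToFactorial_succ]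
    simp

lemma primeToFactorial_mul_reflect {x y : ℕ} (h : x + y + 1 = p) :
    primeToFactorial p x * primeToFactorial p y = (-1) ^ (x + 1) := by
  induction x generalizing y with
  | zero =>
    rw [primeToFactorial_eq_factorial p (x := y) (by omega), show y = p - 1 by omega,
      ZMod.wilsons_lemma]
    simp [primeToFactorial]
  | succ x ih =>
    have h1 := ih (y := y + 1) (by omega)
    have hx := natCast_ne_zero_of_lt p (x := x + 1) (by omega) (by omega)
    have hy := natCast_ne_zero_of_lt p (x := y + 1) (by omega) (by omega)
    have hxy : ((y + 1 : ℕ) : ZMod p) = -((x + 1 : ℕ) : ZMod p) := by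
      rw [eq_neg_iff_add_eq_zero, ← Nat.cast_add, show y + 1 + (x + 1) = p by omega,
        ZMod.natCast_self]
    rw [primeToFactorial_succ, oneIfZero_of_ne hy, hxy] at h1
    rw [primeToFactorial_succ, oneIfZero_of_ne hx, pow_succ, ← h1]
    ring

lemma prod_oneIfZero_add (r n : ℕ) :
    primeToFactorial p r * ∏ j ∈ range n, oneIfZero ((r + (j + 1) : ℕ) : ZMod p) =
      primeToFactorial p (r + n) := by
  simp only [primeToFactorial, prod_range_add, add_assoc]

lemma prod_oneIfZero_add_mul_sub {n r : ℕ} (hn : p = 2 * n + 1) (hr : ¬ p ∣ (r + 1)) :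
    (∏ j ∈ range n, oneIfZero ((r + 1 + (j + 1) : ℕ) : ZMod p)) *
      (∏ j ∈ range n, oneIfZero (((r + 1 : ℕ) : ZMod p) - ((j + 1 : ℕ) : ZMod p))) *
      ((r + 1 : ℕ) : ZMod p) = -1 := by
  have h1 : (∏ j ∈ range n, oneIfZero (((r + 1 : ℕ) : ZMod p) - ((j + 1 : ℕ) : ZMod p))) =
      ∏ j ∈ range n, oneIfZero ((r + 1 + n + (j + 1) : ℕ) : ZMod p) := by
    rw [← prod_range_reflect]
    refine prod_congr rfl fun j hj => ?_
    rw [mem_range] at hj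
    congr 1
    rw [sub_eq_iff_eq_add, ← Nat.cast_add,
      show r + 1 + n + (j + 1) + (n - 1 - j + 1) = r + 1 + p by omega]
    simp
  have h2 := prod_oneIfZero_add p (r + 1) n
  have h3 := prod_oneIfZero_add p (r + 1 + n) n
  rw [show r + 1 + n + n = r + p by omega, primeToFactorial_add_prime] at h3
  have h4 := primeToFactorial_succ p r
  rw [oneIfZero_of_ne (by rwa [Ne, ZMod.natCast_eq_zero_iff])] at h4
  rw [h1]
  refine mul_left_cancel₀ (primeToFactorial_ne_zero p r) ?_
  linear_combination h3 -
    (∏ j ∈ range n, oneIfZero ((r + 1 + n + (j + 1) : ℕ) : ZMod p)) *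
    ((∏ j ∈ range n, oneIfZero ((r + 1 + (j + 1) : ℕ) : ZMod p)) * h4 - h2)

lemma prod_oneIfZero_two_mul_add {m : ℕ} (hm : p = 4 * m + 3) :
    (∏ i ∈ range (2 * m + 1), ∏ j ∈ range (2 * m + 1),
      oneIfZero (2 * ((i + 1 : ℕ) : ZMod p) + ((j + 1 : ℕ) : ZMod p))) =
      2 ^ m * (m.factorial : ZMod p) := by
  set S := ∏ i ∈ range (2 * m + 1), ∏ j ∈ range (2 * m + 1),
      oneIfZero (2 * ((i + 1 : ℕ) : ZMod p) + ((j + 1 : ℕ) : ZMod p)) with hS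
  have h1 : (∏ i ∈ range (2 * m + 1), primeToFactorial p (2 * (i + 1))) * S =
      ∏ i ∈ range (2 * m + 1), primeToFactorial p (2 * (i + 1) + (2 * m + 1)) := by
    rw [hS, ← prod_mul_distrib]
    refine prod_congr rfl fun i _ => ?_
    rw [← prod_oneIfZero_add]
    push_cast
    rfl
  set X := ∏ i ∈ range m, primeToFactorial p (2 * (i + 1)) with hX
  set W := ∏ i ∈ range m, primeToFactorial p (2 * i + 1) with hW
  have hW0 : W ≠ 0 := prod_ne_zero_iff.2 fun _ _ => primeToFactorial_ne_zero p _
  have hX0 : X ≠ 0 := prod_ne_zero_iff.2 fun _ _ => primeToFactorial_ne_zero p _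
  have hZ : ∏ k ∈ range (m + 1), primeToFactorial p (2 * k) = X := by
    rw [prod_range_succ', hX]
    simp [primeToFactorial]
  have hXW : X = W * (2 ^ m * (m.factorial : ZMod p)) := by
    rw [← prod_range_add_one_eq_factorial, Nat.cast_prod, ← card_range m, ← prod_const,
      card_range, hW, hX, ← prod_mul_distrib, ← prod_mul_distrib]
    refine prod_congr rfl fun i hi => ?_
    rw [mem_range] at hi
    rw [show 2 * (i + 1) = 2 * i + 1 + 1 by ring, primeToFactorial_succ,
      oneIfZero_of_ne (natCast_ne_zero_of_lt p (by omega) (by omega))]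
    push_cast; ring
  rw [show 2 * m + 1 = m + (m + 1) by ring, prod_range_add _ m (m + 1),
    prod_range_add _ m (m + 1)] at h1
  have hU : (∏ i ∈ range m, primeToFactorial p (2 * (i + 1) + (m + (m + 1)))) * W = 1 := by
    rw [hW, ← prod_range_reflect (fun i => primeToFactorial p (2 * i + 1)), ← prod_mul_distrib]
    refine prod_eq_one fun i hi => ?_
    rw [mem_range] at hi
    rw [primeToFactorial_mul_reflect p (by omega)]
    exact Even.neg_one_pow ⟨i + m + 2, by ring⟩
  have hV : (∏ k ∈ range (m + 1), primeToFactorial p (2 * (m + k + 1) + (m + (m + 1)))) =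
      (-1) ^ (m + 1) * X := by
    rw [← hZ, ← card_range (m + 1), ← prod_const, card_range, ← prod_mul_distrib]
    refine prod_congr rfl fun k _ => ?_
    rw [show 2 * (m + k + 1) + (m + (m + 1)) = 2 * k + p by omega, primeToFactorial_add_prime]
    ring
  have hY : (∏ k ∈ range (m + 1), primeToFactorial p (2 * (m + k + 1))) * X =
      (-1) ^ (m + 1) := by
    rw [← hZ, ← prod_range_reflect (fun i => primeToFactorial p (2 * i)), ← prod_mul_distrib,
      ← card_range (m + 1), ← prod_const, card_range]
    refine prod_congr rfl fun k hk => ?_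
    rw [mem_range] at hk
    rw [primeToFactorial_mul_reflect p (by omega)]
    exact Odd.neg_one_pow ⟨m + k + 1, by ring⟩
  rw [hV] at h1
  have hsgn : ((-1 : ZMod p) ^ (m + 1)) ≠ 0 := pow_ne_zero _ (by simp)
  refine mul_left_cancel₀ (mul_ne_zero (mul_ne_zero hX0 hW0) hsgn) ?_
  linear_combination X * W * h1 - X * W * S * hY + X ^ 2 * (-1) ^ (m + 1) * hU +
    (-1) ^ (m + 1) * X * hXW

lemma prod_Icc_one_eq_prod_range {M : Type*} [CommMonoid M] (n : ℕ) (f : ℕ → M) :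
    ∏ i ∈ Icc 1 n, f i = ∏ i ∈ range n, f (i + 1) := by
  rw [range_eq_Ico, prod_Ico_add' f 0 n 1]
  rfl

lemma factorial_half_sq {m : ℕ} (hm : p = 4 * m + 3) :
    ((2 * m + 1).factorial : ZMod p) ^ 2 = 1 := by
  rw [← primeToFactorial_eq_factorial p (by omega), sq,
    primeToFactorial_mul_reflect p (by omega)]
  exact Even.neg_one_pow ⟨m + 1, by ring⟩

lemma pow_four_mul_add_two_eq_one {m : ℕ} (hm : p = 4 * m + 3) {a : ZMod p} (ha : a ≠ 0) :
    a ^ (4 * m + 2) = 1 := by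
  have := ZMod.pow_card_sub_one_eq_one ha
  rwa [show p - 1 = 4 * m + 2 by omega] at this

lemma prod_two_mul_add_sq_mul_prod_two_mul_sub_sq {m : ℕ} (hm : p = 4 * m + 3) :
    (∏ i ∈ range (2 * m + 1), ∏ j ∈ range (2 * m + 1),
      oneIfZero (2 * ((i + 1 : ℕ) : ZMod p) + ((j + 1 : ℕ) : ZMod p))) ^ 2 *
    (∏ i ∈ range (2 * m + 1), ∏ j ∈ range (2 * m + 1),
      oneIfZero (2 * ((i + 1 : ℕ) : ZMod p) - ((j + 1 : ℕ) : ZMod p))) ^ 2 = 1 := by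
  have h2 : (2 : ZMod p) ≠ 0 := by
    exact_mod_cast natCast_ne_zero_of_lt p (x := 2) (by omega) (by omega)
  have h : (∏ i ∈ range (2 * m + 1), ∏ j ∈ range (2 * m + 1),
      oneIfZero (2 * ((i + 1 : ℕ) : ZMod p) + ((j + 1 : ℕ) : ZMod p))) *
    (∏ i ∈ range (2 * m + 1), ∏ j ∈ range (2 * m + 1),
      oneIfZero (2 * ((i + 1 : ℕ) : ZMod p) - ((j + 1 : ℕ) : ZMod p))) *
    (2 ^ (2 * m + 1) * ((2 * m + 1).factorial : ZMod p)) = (-1) ^ (2 * m + 1) := by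
    rw [← prod_range_add_one_eq_factorial, Nat.cast_prod]
    rw [pow_mul_prod_range, ← prod_mul_distrib, ← prod_mul_distrib,
      ← card_range (2 * m + 1), ← prod_const, card_range]
    refine prod_congr rfl fun i hi => ?_
    rw [mem_range] at hi
    have := prod_oneIfZero_add_mul_sub p (n := 2 * m + 1) (r := 2 * i + 1) (by omega)
      (Nat.not_dvd_of_pos_of_lt (by omega) (by omega))
    rw [← this]
    have e : ((2 * i + 1 + 1 : ℕ) : ZMod p) = 2 * ((i + 1 : ℕ) : ZMod p) := by push_cast; ring
    simp only [Nat.cast_add (2 * i + 1 + 1), e]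
  have hf := factorial_half_sq p hm
  have h4 := pow_four_mul_add_two_eq_one p hm h2
  have hs : ((-1 : ZMod p) ^ (2 * m + 1)) ^ 2 = 1 := by
    rw [← pow_mul, mul_comm, pow_mul]; simp
  rw [← h, mul_pow, mul_pow, mul_pow, hf, ← pow_mul, show (2 * m + 1) * 2 = 4 * m + 2 by ring,
    h4, mul_one, mul_one] at hs
  exact hs

lemma prod_ite_two_mul_sub {m : ℕ} (hm : p = 4 * m + 3) :
    (∏ i ∈ range (2 * m + 1), ∏ j ∈ range (2 * m + 1),
      if 2 * ((j + 1 : ℕ) : ZMod p) - ((i + 1 : ℕ) : ZMod p) = 0 then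
        2 * ((i + 1 : ℕ) : ZMod p) - ((j + 1 : ℕ) : ZMod p) else 1) =
      3 ^ m * (m.factorial : ZMod p) := by
  rw [prod_comm, show 2 * m + 1 = m + (m + 1) by ring, prod_range_add _ m (m + 1),
    ← prod_range_add_one_eq_factorial, Nat.cast_prod]
  rw [pow_mul_prod_range]
  have h2 : ∀ j i : ℕ, 2 * ((j + 1 : ℕ) : ZMod p) - ((i + 1 : ℕ) : ZMod p) = 0 ↔
      ((2 * (j + 1) : ℕ) : ZMod p) = ((i + 1 : ℕ) : ZMod p) := fun j i => by
    rw [sub_eq_zero]; push_cast; rfl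
  have key : ∀ j < 2 * m + 1, ∀ i < 2 * m + 1,
      (2 * ((j + 1 : ℕ) : ZMod p) - ((i + 1 : ℕ) : ZMod p) = 0 ↔ i = 2 * j + 1) := by
    intro j hj i hi
    rw [h2, ZMod.natCast_eq_natCast_iff', Nat.mod_eq_of_lt (by omega), Nat.mod_eq_of_lt (by omega)]
    omega
  rw [prod_eq_one (s := range (m + 1)), mul_one]
  · refine prod_congr rfl fun j hj => ?_
    rw [mem_range] at hj
    rw [prod_eq_single_of_mem (2 * j + 1) (by rw [mem_range]; omega)]
    · rw [if_pos ((key _ (by omega) _ (by omega)).2 rfl)]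
      push_cast; ring
    · intro i hi hij
      rw [mem_range] at hi
      rw [if_neg fun h => hij ((key _ (by omega) _ (by omega)).1 h)]
  · intro j hj
    rw [mem_range] at hj
    refine prod_eq_one fun i hi => ?_
    rw [mem_range] at hi
    rw [if_neg fun h => ?_]
    have := (key _ (by omega) _ (by omega)).1 h
    omega

lemma prod_ite_two_mul_add {m : ℕ} (hm : p = 4 * m + 3) :
    (∏ i ∈ range (2 * m + 1), ∏ j ∈ range (2 * m + 1),
      if 2 * ((j + 1 : ℕ) : ZMod p) + ((i + 1 : ℕ) : ZMod p) = 0 then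
        2 * ((i + 1 : ℕ) : ZMod p) + ((j + 1 : ℕ) : ZMod p) else 1) *
      (m.factorial : ZMod p) =
      (-3) ^ (m + 1) * ((2 * m + 1).factorial : ZMod p) := by
  have hfac : ((2 * m + 1).factorial : ZMod p) =
      (m.factorial : ZMod p) * ∏ k ∈ range (m + 1), ((m + k + 1 : ℕ) : ZMod p) := by
    rw [← prod_range_add_one_eq_factorial, ← prod_range_add_one_eq_factorial,
      show 2 * m + 1 = m + (m + 1) by ring, prod_range_add]
    push_cast; rfl
  rw [hfac, mul_comm, mul_left_comm]
  congr 1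
  rw [prod_comm, show 2 * m + 1 = m + (m + 1) by ring, prod_range_add _ m (m + 1)]
  rw [pow_mul_prod_range]
  have key : ∀ j < 2 * m + 1, ∀ i < 2 * m + 1,
      (2 * ((j + 1 : ℕ) : ZMod p) + ((i + 1 : ℕ) : ZMod p) = 0 ↔ 2 * j + i + 3 = p) := by
    intro j hj i hi
    have : 2 * ((j + 1 : ℕ) : ZMod p) + ((i + 1 : ℕ) : ZMod p) =
      ((2 * j + i + 3 : ℕ) : ZMod p) := by push_cast; ring
    rw [this, ZMod.natCast_eq_zero_iff]
    refine ⟨fun ⟨c, hc⟩ => ?_, fun h => h ▸ dvd_rfl⟩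
    have : c < 2 := by
      by_contra! hc'
      have := Nat.mul_le_mul_left p hc'
      omega
    interval_cases c <;> omega
  rw [prod_eq_one (s := range m), one_mul]
  · refine prod_congr rfl fun j hj => ?_
    rw [mem_range] at hj
    have e := (key (m + j) (by omega) (2 * (m - j)) (by omega)).2 (by omega)
    rw [prod_eq_single_of_mem (2 * (m - j)) (by rw [mem_range]; omega)]
    · rw [if_pos e]
      linear_combination 2 * e
    · intro i hi hij
      rw [mem_range] at hi
      rw [if_neg fun h => hij ?_]
      have := (key _ (by omega) _ (by omega)).1 h
      omega
  · intro j hj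
    rw [mem_range] at hj
    refine prod_eq_one fun i hi => ?_
    rw [mem_range] at hi
    rw [if_neg fun h => ?_]
    have := (key _ (by omega) _ (by omega)).1 h
    omega

lemma choose_mul_factorial_sq_sq {m : ℕ} (hm : p = 4 * m + 3) :
    (((2 * m).choose m : ℕ) : ZMod p) ^ 2 * (m.factorial : ZMod p) ^ 4 = 4 := by
  have h1 : (((2 * m).choose m : ℕ) : ZMod p) * (m.factorial : ZMod p) ^ 2 =
      ((2 * m).factorial : ZMod p) := by
    have := Nat.choose_mul_factorial_mul_factorial (show m ≤ 2 * m by omega)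
    rw [show 2 * m - m = m by omega] at this
    rw [← this]; push_cast; ring
  have hf := factorial_half_sq p hm
  rw [Nat.factorial_succ] at hf
  have h0 : (4 * (m : ZMod p) + 3) = 0 := by
    have := ZMod.natCast_self p
    rw [← this, congrArg (Nat.cast (R := ZMod p)) hm]
    push_cast; rfl
  push_cast at hf
  rw [← h1] at hf
  set C := (((2 * m).choose m : ℕ) : ZMod p)
  set f := (m.factorial : ZMod p)
  linear_combination 4 * hf - C ^ 2 * f ^ 4 * (4 * (m : ZMod p) + 1) * h0

lemma intCast_ite_dvd (x : ℤ) :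
    (((if (p : ℤ) ∣ x then 1 else x : ℤ)) : ZMod p) = oneIfZero (x : ZMod p) := by
  unfold oneIfZero
  by_cases h : (p : ℤ) ∣ x
  · rw [if_pos h, if_pos ((ZMod.intCast_zmod_eq_zero_iff_dvd x p).2 h), Int.cast_one]
  · rw [if_neg h, if_neg (mt (ZMod.intCast_zmod_eq_zero_iff_dvd x p).1 h)]

end PrimeField


/-- Theorem 1.6, (1.20): let `p > 3` be a prime with `p ≡ 3 (mod 4)` and `δ ∈ {1, -1}`.
Then, in `ℤ/pℤ`,
`T_p(2, 5δ, 2) = (6/p) · δ · 2^δ · 3^{-δ} · C((p-3)/2, (p-3)/4)^{-2δ}`, where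
`T_p(2,5δ,2) = ∏_{1 ≤ i,j ≤ (p-1)/2, p ∤ 2i²+5δij+2j²} (2i² + 5δij + 2j²)`. -/
theorem statement17 (p : ℕ) [Fact p.Prime] (hp3 : 3 < p) (hp : p % 4 = 3)
    (δ : ℤ) (hδ : δ = 1 ∨ δ = -1) :
    ((∏ i ∈ Finset.Icc 1 ((p - 1) / 2), ∏ j ∈ Finset.Icc 1 ((p - 1) / 2),
        if (p : ℤ) ∣ (2 * (i : ℤ) ^ 2 + 5 * δ * (i : ℤ) * (j : ℤ) + 2 * (j : ℤ) ^ 2) then 1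
        else 2 * (i : ℤ) ^ 2 + 5 * δ * (i : ℤ) * (j : ℤ) + 2 * (j : ℤ) ^ 2 : ℤ) : ZMod p)
      = (legendreSym p 6 : ZMod p) * (δ : ZMod p) * (2 : ZMod p) ^ δ * (3 : ZMod p) ^ (-δ)
        * ((Nat.choose ((p - 3) / 2) ((p - 3) / 4) : ZMod p)) ^ (-(2 * δ)) := by
  obtain ⟨m, hm⟩ : ∃ m, p = 4 * m + 3 := ⟨p / 4, by omega⟩
  have h2 : (2 : ZMod p) ≠ 0 := by
    exact_mod_cast natCast_ne_zero_of_lt p (x := 2) (by omega) (by omega)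
  have h3 : (3 : ZMod p) ≠ 0 := by
    exact_mod_cast natCast_ne_zero_of_lt p (x := 3) (by omega) (by omega)
  have hL : (legendreSym p 6 : ZMod p) = 2 ^ (2 * m + 1) * 3 ^ (2 * m + 1) := by
    rw [legendreSym.eq_pow, ← mul_pow, show p / 2 = 2 * m + 1 by omega]
    norm_num
  have hC := choose_mul_factorial_sq_sq p hm
  have hS := prod_oneIfZero_two_mul_add p hm
  have hSS := prod_two_mul_add_sq_mul_prod_two_mul_sub_sq p hm
  have hf0 : (m.factorial : ZMod p) ≠ 0 := by
    rw [← primeToFactorial_eq_factorial p (by omega)]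
    exact primeToFactorial_ne_zero p m
  have hf := factorial_half_sq p hm
  have t2 := pow_four_mul_add_two_eq_one p hm h2
  have t3 := pow_four_mul_add_two_eq_one p hm h3
  have hC0 : (((2 * m).choose m : ℕ) : ZMod p) ≠ 0 := by
    intro h
    rw [h] at hC
    exact mul_ne_zero h2 h2 (by linear_combination -hC)
  rw [show (p - 1) / 2 = 2 * m + 1 by omega, show (p - 3) / 2 = 2 * m by omega,
    show (p - 3) / 4 = m by omega]
  simp only [prod_Icc_one_eq_prod_range, Int.cast_prod, intCast_ite_dvd]
  rw [hL]
  have hne : ∀ i ∈ range (2 * m + 1), ((i + 1 : ℕ) : ZMod p) ≠ 0 := fun i hi =>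
    natCast_ne_zero_of_lt p (by omega) (by rw [mem_range] at hi; omega)
  have hsub : ∀ i ∈ range (2 * m + 1), ∀ j ∈ range (2 * m + 1),
      2 * ((i + 1 : ℕ) : ZMod p) - ((j + 1 : ℕ) : ZMod p) = 0 →
        2 * ((j + 1 : ℕ) : ZMod p) - ((i + 1 : ℕ) : ZMod p) ≠ 0 := fun i hi j _ h h' =>
    mul_ne_zero h3 (hne i hi) (by linear_combination 2 * h + h')
  rcases hδ with rfl | rfl
  · have hA := prod_oneIfZero_mul_swap (range (2 * m + 1))
      (fun i j => 2 * ((i + 1 : ℕ) : ZMod p) + ((j + 1 : ℕ) : ZMod p))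
      (fun i hi j _ h => by
        exact fun h' => mul_ne_zero h3 (hne i hi) (by linear_combination 2 * h - h'))
    have hD := prod_ite_two_mul_add p hm
    trans ∏ i ∈ range (2 * m + 1), ∏ j ∈ range (2 * m + 1),
      oneIfZero ((2 * ((i + 1 : ℕ) : ZMod p) + ((j + 1 : ℕ) : ZMod p)) *
        (2 * ((j + 1 : ℕ) : ZMod p) + ((i + 1 : ℕ) : ZMod p)))
    · refine prod_congr rfl fun i _ => prod_congr rfl fun j _ => ?_
      congr 1
      push_cast; ring
    set A := ∏ i ∈ range (2 * m + 1), ∏ j ∈ range (2 * m + 1),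
      oneIfZero ((2 * ((i + 1 : ℕ) : ZMod p) + ((j + 1 : ℕ) : ZMod p)) *
        (2 * ((j + 1 : ℕ) : ZMod p) + ((i + 1 : ℕ) : ZMod p)))
    set D := ∏ i ∈ range (2 * m + 1), ∏ j ∈ range (2 * m + 1),
      if 2 * ((j + 1 : ℕ) : ZMod p) + ((i + 1 : ℕ) : ZMod p) = 0 then
        2 * ((i + 1 : ℕ) : ZMod p) + ((j + 1 : ℕ) : ZMod p) else 1
    rw [hS] at hA
    set f := (m.factorial : ZMod p)
    set C := (((2 * m).choose m : ℕ) : ZMod p)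
    have hA' : A * 3 ^ (2 * m + 2) = 2 ^ (2 * m) * f ^ 4 := by
      have e : (D * f) ^ 2 = 3 ^ (2 * m + 2) := by
        rw [hD, mul_pow, hf, ← pow_mul, mul_one, show (m + 1) * 2 = 2 * m + 2 by ring]
        exact Even.neg_pow ⟨m + 1, by ring⟩ _
      rw [← e]
      linear_combination f ^ 2 * hA
    have hfin : A * (3 * C ^ 2) = 2 ^ (2 * m + 1) * 3 ^ (2 * m + 1) * 2 := by
      refine mul_right_cancel₀ (pow_ne_zero (2 * m + 2) h3) ?_
      linear_combination 3 * C ^ 2 * hA' + 3 * 2 ^ (2 * m) * hC - 12 * 2 ^ (2 * m) * t3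
    have hfin' : A = 2 ^ (2 * m + 1) * 3 ^ (2 * m + 1) * 2 / (3 * C ^ 2) := by
      rw [eq_div_iff (mul_ne_zero h3 (pow_ne_zero 2 hC0)), hfin]
    rw [hfin', zpow_neg, zpow_neg, zpow_one, zpow_one,
      show (2 * 1 : ℤ) = 2 by norm_num, zpow_ofNat]
    field_simp
    push_cast; ring
  · have hB := prod_oneIfZero_mul_swap (range (2 * m + 1))
      (fun i j => 2 * ((i + 1 : ℕ) : ZMod p) - ((j + 1 : ℕ) : ZMod p)) hsub
    have hD := prod_ite_two_mul_sub p hm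
    trans ∏ i ∈ range (2 * m + 1), ∏ j ∈ range (2 * m + 1),
      oneIfZero (-((2 * ((i + 1 : ℕ) : ZMod p) - ((j + 1 : ℕ) : ZMod p)) *
        (2 * ((j + 1 : ℕ) : ZMod p) - ((i + 1 : ℕ) : ZMod p))))
    · refine prod_congr rfl fun i _ => prod_congr rfl fun j _ => ?_
      congr 1
      push_cast; ring
    rw [prod_oneIfZero_neg_mul_swap (range (2 * m + 1))
      (fun i j => 2 * ((i + 1 : ℕ) : ZMod p) - ((j + 1 : ℕ) : ZMod p)) hsub, card_range,
      Odd.neg_one_pow ⟨m, rfl⟩]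
    rw [hS] at hSS
    rw [hD] at hB
    set B := ∏ i ∈ range (2 * m + 1), ∏ j ∈ range (2 * m + 1),
      oneIfZero ((2 * ((i + 1 : ℕ) : ZMod p) - ((j + 1 : ℕ) : ZMod p)) *
        (2 * ((j + 1 : ℕ) : ZMod p) - ((i + 1 : ℕ) : ZMod p)))
    set f := (m.factorial : ZMod p)
    set C := (((2 * m).choose m : ℕ) : ZMod p)
    have hB' : B * (3 ^ (2 * m) * 2 ^ (2 * m) * f ^ 4) = 1 := by
      linear_combination (2 ^ m * f) ^ 2 * hB + hSS
    have hfin : B * 2 = 2 ^ (2 * m + 1) * 3 ^ (2 * m + 1) * 3 * C ^ 2 := by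
      refine mul_right_cancel₀ (mul_ne_zero (mul_ne_zero (pow_ne_zero (2 * m) h3)
        (pow_ne_zero (2 * m) h2)) (pow_ne_zero 4 hf0)) ?_
      linear_combination 2 * hB' - 2 ^ (4 * m + 1) * 3 ^ (4 * m + 2) * hC -
        2 * 3 ^ (4 * m + 2) * t2 - 2 * t3
    have hfin' : B = 2 ^ (2 * m + 1) * 3 ^ (2 * m + 1) * 3 * C ^ 2 / 2 := by
      rw [eq_div_iff h2, hfin]
    rw [hfin', zpow_neg, zpow_one, neg_neg, zpow_one, show (-(2 * -1) : ℤ) = 2 by norm_num,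
      zpow_ofNat]
    field_simp
    push_cast; ring
end
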